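/- Let d ≥ 2, let 0 ≤ m ≤ d−2 be an integer, M > 0, and let φ, D, N, B_R^+ be as in the context. Let λ > 0, R > 0, and let u ∈ L²(B_R^+) and g ∈ L²(B_R^+;ℝ^d) be such that: g is the weak gradient of u on B_R^+; there is a sequence (u_n) of smooth compactly supported functions on ℝ^d with support(u_n) ∩ D = ∅ and u_n → u in L²(B_R^+), ∇u_n → g in L²(B_R^+;ℝ^d); and for every smooth compactly supported ζ : ℝ^d → ℝ with support contained in B_R(0) and support(ζ) ∩ cl(D) = ∅ one has ∫_{B_R^+} (g·∇ζ + λ u ζ) dx = 0 (that is, u is a W^{1,2} weak solution of −Δu + λu = 0 in B_R^+ with ∂u/∂x^1 = 0 on N ∩ B_R and u = 0 on D ∩ B_R). Set U = |g| + √λ·|u|. Then for every p ∈ [1, 2(m+2)/(m+1)) there is a constant C = C(d,p,M) such that ((1/|B_{R/2}^+|)∫_{B_{R/2}^+} U^p dx)^{1/p} ≤ C·((1/|B_R^+|)∫_{B_R^+} U² dx)^{1/2}. -/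

import Mathlib

open Set Filter MeasureTheory Metric Topology

noncomputable section

/-- `ℝ^d` with the Euclidean norm. -/
abbrev Euc (d : ℕ) := EuclideanSpace ℝ (Fin d)

/-- A smooth compactly supported test function. -/
def IsTest {d : ℕ} (ζ : Euc d → ℝ) : Prop := ContDiff ℝ (⊤ : ℕ∞) ζ ∧ HasCompactSupport ζ

/-- The gradient vector of a differentiable function, as an element of `ℝ^d`. -/
def gradVec {d : ℕ} (ζ : Euc d → ℝ) (x : Euc d) : Euc d :=
  WithLp.toLp 2 (fun i => fderiv ℝ ζ x (EuclideanSpace.single i 1) : Fin d → ℝ)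

/-- The `i`-th partial derivative. -/
def pder {d : ℕ} (i : Fin d) (ζ : Euc d → ℝ) (x : Euc d) : ℝ :=
  fderiv ℝ ζ x (EuclideanSpace.single i 1)

/-- `g` is the weak gradient of `u` on the open set `V`. -/
def HasWeakGradOn {d : ℕ} (u : Euc d → ℝ) (g : Euc d → Euc d) (V : Set (Euc d)) : Prop :=
  ∀ i : Fin d, ∀ ζ : Euc d → ℝ, IsTest ζ → tsupport ζ ⊆ V →
    ∫ x in V, u x * pder i ζ x = - ∫ x in V, g x i * ζ x

/-- `u` (with weak gradient `g`) is approximable in `W^{1,p}(V)` by smooth compactly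
supported functions whose support avoids `D`; this encodes membership in `W^{1,p}_D`. -/
def ApproxWD {d : ℕ} (u : Euc d → ℝ) (g : Euc d → Euc d) (D V : Set (Euc d)) (p : ℝ) : Prop :=
  ∃ un : ℕ → Euc d → ℝ,
    (∀ n, IsTest (un n) ∧ Function.support (un n) ∩ D = ∅) ∧
    Tendsto (fun n => ∫ x in V, |un n x - u x| ^ p) atTop (nhds 0) ∧
    Tendsto (fun n => ∫ x in V, ‖gradVec (un n) x - g x‖ ^ p) atTop (nhds 0)

/-- Membership in `W^{1,p}_D(V)` : `u, g ∈ L^p`, `g` is the weak gradient of `u` on `V`,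
and `u` is approximable by smooth functions vanishing near no point of `D`. -/
def MemW1pD {d : ℕ} (u : Euc d → ℝ) (g : Euc d → Euc d) (D V : Set (Euc d)) (p : ℝ) : Prop :=
  MemLp u (ENNReal.ofReal p) (volume.restrict V) ∧
  MemLp g (ENNReal.ofReal p) (volume.restrict V) ∧
  HasWeakGradOn u g V ∧ ApproxWD u g D V p

/-- The `γ`-Reifenberg flatness assumption with parameter `R1`. -/
def ReifenbergFlat {d : ℕ} (Ω : Set (Euc d)) (γ R1 : ℝ) : Prop :=
  ∀ x0 ∈ frontier Ω, ∀ R ∈ Set.Ioc (0 : ℝ) R1, ∃ ν : Euc d, ‖ν‖ = 1 ∧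
    ({x ∈ ball x0 R | γ * R < inner ℝ (x - x0) ν} ⊆ Ω) ∧
    (Ω ∩ ball x0 R ⊆ {x | -(γ * R) < (inner ℝ (x - x0) ν : ℝ)})

/-- `M`-Lipschitz functions `ℝ^m → ℝ`. -/
def LipConst {m : ℕ} (M : ℝ) (φ : Euc m → ℝ) : Prop :=
  ∀ a b : Euc m, |φ a - φ b| ≤ M * ‖a - b‖

/-- The boundary of `Ω` is decomposed into disjoint nonempty pieces `N` (conormal part)
and `D` (Dirichlet part). -/
def BoundarySplit {d : ℕ} (Ω N D : Set (Euc d)) : Prop :=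
  frontier Ω = N ∪ D ∧ N ∩ D = ∅ ∧ N.Nonempty ∧ D.Nonempty

/-- The interface `Γ = cl N ∩ cl D` is a `(γ,m)`-flat separation with parameter `R1`:
at every point of `Γ` and scale `R ≤ R1` there are orthonormal vectors
`ν 0, …, ν (m+1)`, with `ν 0` a Reifenberg flatness direction for `Ω`, and an
`M`-Lipschitz function `φ : ℝ^m → ℝ` such that, in the corresponding coordinates,
the parts of `∂Ω ∩ B_R(x0)` lying above/below the graph of `φ` at height `±γR`
belong to `D` resp. `N`. -/
def FlatSeparation {d : ℕ} (Ω N D : Set (Euc d)) (m : ℕ) (M γ R1 : ℝ) : Prop :=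
  ∀ x0 ∈ closure N ∩ closure D, ∀ R ∈ Set.Ioc (0 : ℝ) R1,
    ∃ ν : Fin (m + 2) → Euc d, Orthonormal ℝ ν ∧
      ({x ∈ ball x0 R | γ * R < inner ℝ (x - x0) (ν 0)} ⊆ Ω) ∧
      (Ω ∩ ball x0 R ⊆ {x | -(γ * R) < (inner ℝ (x - x0) (ν 0) : ℝ)}) ∧
      ∃ φ : Euc m → ℝ, LipConst M φ ∧
        (frontier Ω ∩ ball x0 R ∩
            {x | φ (WithLp.toLp 2 ((fun i : Fin m => (inner ℝ (x - x0) (ν ⟨i.1 + 2, by omega⟩) : ℝ)) :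
                Fin m → ℝ)) + γ * R < (inner ℝ (x - x0) (ν 1) : ℝ)} ⊆ D) ∧
        (frontier Ω ∩ ball x0 R ∩
            {x | (inner ℝ (x - x0) (ν 1) : ℝ) < φ (WithLp.toLp 2 ((fun i : Fin m =>
                (inner ℝ (x - x0) (ν ⟨i.1 + 2, by omega⟩) : ℝ)) : Fin m → ℝ)) - γ * R} ⊆ N)

/-- Average of `h` over `E`. -/
def avg {d : ℕ} (E : Set (Euc d)) (h : Euc d → ℝ) : ℝ :=
  (volume E).toReal⁻¹ * ∫ x in E, h x

/-- Symmetric, measurable, uniformly `Λ`-elliptic coefficients. -/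
def EllipticSym {d : ℕ} (a : Fin d → Fin d → Euc d → ℝ) (Λ : ℝ) : Prop :=
  (∀ i j, Measurable (a i j)) ∧ (∀ i j x, a i j x = a j i x) ∧
  (∀ x : Euc d, ∀ ξ : Fin d → ℝ,
    Λ * (∑ i, ξ i ^ 2) ≤ ∑ i, ∑ j, a i j x * ξ j * ξ i ∧
      ∑ i, ∑ j, a i j x * ξ j * ξ i ≤ Λ⁻¹ * (∑ i, ξ i ^ 2))

/-- The `(θ, R1)`-small BMO condition on `Ω`. -/
def SmallBMO {d : ℕ} (a : Fin d → Fin d → Euc d → ℝ) (Ω : Set (Euc d)) (θ R1 : ℝ) : Prop :=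
  ∀ i j, ∀ x ∈ closure Ω, ∀ r ∈ Set.Ioc (0 : ℝ) R1,
    avg (Ω ∩ ball x r) (fun y => |a i j y - avg (Ω ∩ ball x r) (a i j)|) < θ

/-- `u ∈ W^{1,2}_D(Ω)` with weak gradient `g` is a weak solution of
`D_i(a_{ij} D_j u) − λ u = f + D_i f_i` in `Ω` with conormal condition
`a_{ij} D_j u n_i = f_i n_i` on `N` and `u = 0` on `D`. -/
def WeakSolMixed {d : ℕ} (a : Fin d → Fin d → Euc d → ℝ) (lam : ℝ)
    (u : Euc d → ℝ) (g : Euc d → Euc d) (f : Euc d → ℝ) (fv : Fin d → Euc d → ℝ)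
    (Ω D : Set (Euc d)) : Prop :=
  ∀ ζ : Euc d → ℝ, IsTest ζ → tsupport ζ ∩ closure D = ∅ →
    ∫ x in Ω, (-(∑ i, ∑ j, a i j x * g x j * pder i ζ x) - lam * u x * ζ x)
      = (∫ x in Ω, f x * ζ x) - ∫ x in Ω, ∑ i, fv i x * pder i ζ x

end

open Set Filter MeasureTheory Metric Topology

noncomputable section

/-- The coordinates `x^3, …, x^{m+2}` of a point of `ℝ^d`, as a point of `ℝ^m`. -/
def projTail {d m : ℕ} (hm : m + 2 ≤ d) (x : Euc d) : Euc m :=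
  WithLp.toLp 2 (fun i : Fin m => x ⟨i.1 + 2, by omega⟩ : Fin m → ℝ)

/-- The upper half ball `B_R^+ = B_R(0) ∩ {x : x^1 > 0}` in `ℝ^d`. -/
def Bplus {d : ℕ} (hd : 0 < d) (R : ℝ) : Set (Euc d) :=
  ball (0 : Euc d) R ∩ {x | 0 < x ⟨0, hd⟩}

/-- The Dirichlet part `D = {x^1 = 0, x^2 > φ(x^3,…,x^{m+2})}` of the boundary
of the half space. -/
def Dhalf {d m : ℕ} (hm : m + 2 ≤ d) (φ : Euc m → ℝ) : Set (Euc d) :=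
  {x | x ⟨0, by omega⟩ = 0 ∧ φ (projTail hm x) < x ⟨1, by omega⟩}

/-- The conormal part `N = {x^1 = 0, x^2 < φ(x^3,…,x^{m+2})}` of the boundary
of the half space. -/
def Nhalf {d m : ℕ} (hm : m + 2 ≤ d) (φ : Euc m → ℝ) : Set (Euc d) :=
  {x | x ⟨0, by omega⟩ = 0 ∧ x ⟨1, by omega⟩ < φ (projTail hm x)}

end

section
open Set Filter MeasureTheory Metric Topology
open scoped ENNReal NNReal

namespace RH

/-- squared `L²` size on `A` -/
noncomputable def Q {d : ℕ} {F : Type*} [NormedAddCommGroup F] (A : Set (Euc d)) (f : Euc d → F) :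
    ℝ≥0∞ := ∫⁻ x in A, ‖f x‖ₑ ^ 2

/-- forward difference -/
def dl {d : ℕ} {F : Type*} [NormedAddCommGroup F] (h : Euc d) (f : Euc d → F) : Euc d → F :=
  fun x => f (x + h) - f x

section basics
variable {d : ℕ} {F : Type*} [NormedAddCommGroup F]

lemma Q_mono_set {A B : Set (Euc d)} (hAB : A ⊆ B) (f : Euc d → F) : Q A f ≤ Q B f :=
  lintegral_mono_set hAB

lemma Q_mono {G : Type*} [NormedAddCommGroup G] {A : Set (Euc d)} (hA : MeasurableSet A)
    {f : Euc d → F} {g : Euc d → G}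
    (h : ∀ x ∈ A, ‖f x‖ ≤ ‖g x‖) : Q A f ≤ Q A g := by
  unfold Q
  refine setLIntegral_mono' hA fun x hx => ?_
  gcongr
  exact enorm_le_iff_norm_le.2 (h x hx)

lemma Q_congr {A : Set (Euc d)} (hA : MeasurableSet A) {f g : Euc d → F}
    (h : ∀ x ∈ A, f x = g x) : Q A f = Q A g :=
  setLIntegral_congr_fun hA fun x hx => by simp only [h x hx]

lemma sq_add_le_enn (a b : ℝ≥0∞) : (a + b) ^ 2 ≤ 2 * a ^ 2 + 2 * b ^ 2 := by
  by_cases ha : a = ⊤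
  · simp [ha]
  by_cases hb : b = ⊤
  · simp [hb]
  lift a to ℝ≥0 using ha
  lift b to ℝ≥0 using hb
  norm_cast
  rw [← NNReal.coe_le_coe]
  push_cast
  nlinarith [sq_nonneg ((a : ℝ) - b)]

lemma Q_add_le [MeasurableSpace F] [OpensMeasurableSpace F] {A : Set (Euc d)} {f g : Euc d → F}
    (hf : Measurable f) :
    Q A (fun x => f x + g x) ≤ 2 * Q A f + 2 * Q A g := by
  unfold Q
  rw [← lintegral_const_mul' _ _ (by simp), ← lintegral_const_mul' _ _ (by simp),
    ← lintegral_add_left (by fun_prop)]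
  refine lintegral_mono fun x => ?_
  refine le_trans ?_ (sq_add_le_enn _ _)
  gcongr
  exact enorm_add_le _ _

lemma Q_sub_le [MeasurableSpace F] [OpensMeasurableSpace F] {A : Set (Euc d)} {f g : Euc d → F}
    (hf : Measurable f) :
    Q A (fun x => f x - g x) ≤ 2 * Q A f + 2 * Q A g := by
  have := Q_add_le (A := A) (g := fun x => - g x) hf
  simpa [sub_eq_add_neg, Q] using this

lemma Q_smul (A : Set (Euc d)) (c : ℝ) [NormedSpace ℝ F] (f : Euc d → F) :
    Q A (fun x => c • f x) = ENNReal.ofReal (c ^ 2) * Q A f := by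
  unfold Q
  rw [← lintegral_const_mul' _ _ (by simp)]
  refine lintegral_congr fun x => ?_
  rw [enorm_smul, mul_pow, Real.enorm_eq_ofReal_abs, ← ENNReal.ofReal_pow (abs_nonneg _), sq_abs]

lemma Q_mul (A : Set (Euc d)) (c : ℝ) (f : Euc d → ℝ) :
    Q A (fun x => c * f x) = ENNReal.ofReal (c ^ 2) * Q A f := Q_smul A c f

lemma setLIntegral_shift_le {A B : Set (Euc d)} (hA : MeasurableSet A) (hB : MeasurableSet B)
    (h : Euc d) (hAB : ∀ x ∈ A, x + h ∈ B) (f : Euc d → ℝ≥0∞) :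
    ∫⁻ x in A, f (x + h) ≤ ∫⁻ x in B, f x := by
  rw [← lintegral_indicator hA, ← lintegral_indicator hB,
    ← lintegral_add_right_eq_self (B.indicator f) h]
  refine lintegral_mono fun x => ?_
  by_cases hx : x ∈ A
  · simp [hx, hAB x hx]
  · simp [hx]

lemma Q_shift {A B : Set (Euc d)} (hA : MeasurableSet A) (hB : MeasurableSet B)
    (h : Euc d) (hAB : ∀ x ∈ A, x + h ∈ B) (f : Euc d → F) :
    Q A (fun x => f (x + h)) ≤ Q B f :=
  setLIntegral_shift_le hA hB h hAB fun x => ‖f x‖ₑ ^ 2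

lemma Q_dl_le [MeasurableSpace F] [BorelSpace F] {A B : Set (Euc d)}
    (hA : MeasurableSet A) (hB : MeasurableSet B)
    (h : Euc d) (hAB : ∀ x ∈ A, x + h ∈ B) (hAB' : A ⊆ B) {f : Euc d → F} (hf : Measurable f) :
    Q A (dl h f) ≤ 4 * Q B f := by
  refine (Q_sub_le (by fun_prop)).trans ?_
  have h1 := Q_shift hA hB h hAB f
  have h2 := Q_mono_set hAB' f
  calc _ ≤ 2 * Q B f + 2 * Q B f := by gcongr
    _ = 4 * Q B f := by rw [← add_mul]; norm_num

lemma sq_lintegral_le {S : Type*} [MeasurableSpace S] (ν : Measure S) {G : S → ℝ≥0∞}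
    (hG : AEMeasurable G ν) : (∫⁻ s, G s ∂ν) ^ 2 ≤ ν univ * ∫⁻ s, G s ^ 2 ∂ν := by
  have := ENNReal.lintegral_mul_le_Lp_mul_Lq ν (p := 2) (q := 2) (by constructor <;> norm_num) hG
    (aemeasurable_const (b := (1 : ℝ≥0∞)))
  simp only [Pi.mul_apply, mul_one, ENNReal.rpow_ofNat, one_pow, lintegral_one] at this
  calc (∫⁻ s, G s ∂ν) ^ 2 ≤ ((∫⁻ s, G s ^ 2 ∂ν) ^ (1 / 2 : ℝ) * (ν univ) ^ (1 / 2 : ℝ)) ^ 2 := by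
        gcongr
    _ = ν univ * ∫⁻ s, G s ^ 2 ∂ν := by
        rw [mul_pow, ← ENNReal.rpow_natCast, ← ENNReal.rpow_natCast, ← ENNReal.rpow_mul,
          ← ENNReal.rpow_mul]
        norm_num [mul_comm]

/-- Minkowski-type inequality for averages. -/
lemma mink {S X : Type*} [MeasurableSpace S] [MeasurableSpace X] (ν : Measure S) [SFinite ν]
    (μ : Measure X) [SFinite μ] {G : S → X → ℝ≥0∞} (hG : Measurable (Function.uncurry G))
    {K : ℝ≥0∞} (hK : ∀ᵐ s ∂ν, ∫⁻ x, G s x ^ 2 ∂μ ≤ K) :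
    ∫⁻ x, (∫⁻ s, G s x ∂ν) ^ 2 ∂μ ≤ (ν univ) ^ 2 * K := by
  have hx : ∀ x, Measurable fun s => G s x := fun x =>
    hG.comp (measurable_id.prodMk measurable_const)
  calc ∫⁻ x, (∫⁻ s, G s x ∂ν) ^ 2 ∂μ ≤ ∫⁻ x, ν univ * ∫⁻ s, G s x ^ 2 ∂ν ∂μ :=
        lintegral_mono fun x => sq_lintegral_le ν (hx x).aemeasurable
    _ = ν univ * ∫⁻ x, ∫⁻ s, G s x ^ 2 ∂ν ∂μ := by
        refine lintegral_const_mul _ ?_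
        exact Measurable.lintegral_prod_left' (f := fun p : S × X => G p.1 p.2 ^ 2) (hG.pow_const 2)
    _ = ν univ * ∫⁻ s, ∫⁻ x, G s x ^ 2 ∂μ ∂ν := by
        congr 1
        exact (lintegral_lintegral_swap (hG.pow_const 2).aemeasurable).symm
    _ ≤ ν univ * ∫⁻ s, K ∂ν := by
        gcongr 1
        exact lintegral_mono_ae hK
    _ = _ := by rw [lintegral_const]; ring

end basics
end RH
end

section
open Set Filter MeasureTheory Metric Topology
open scoped ENNReal NNReal

namespace RH
section grads
variable {d : ℕ}

lemma gradVec_apply (ζ : Euc d → ℝ) (x : Euc d) (i : Fin d) : gradVec ζ x i = pder i ζ x := rfl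

lemma euc_sum (v : Euc d) : v = ∑ i, v i • EuclideanSpace.single i (1 : ℝ) := by
  ext j
  simp [Finset.sum_apply, PiLp.smul_apply, EuclideanSpace.single_apply, Pi.single_apply]

lemma inner_gradVec (ζ : Euc d → ℝ) (x v : Euc d) :
    inner ℝ v (gradVec ζ x) = fderiv ℝ ζ x v := by
  conv_rhs => rw [euc_sum v]
  simp only [map_sum, map_smul, PiLp.inner_apply, gradVec_apply, pder]
  refine Finset.sum_congr rfl fun i _ => ?_
  simp [mul_comm]

lemma gradVec_eq (ζ : Euc d → ℝ) (x : Euc d) :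
    gradVec ζ x = (InnerProductSpace.toDual ℝ (Euc d)).symm (fderiv ℝ ζ x) := by
  refine ext_inner_left ℝ fun v => ?_
  rw [inner_gradVec, real_inner_comm, InnerProductSpace.toDual_symm_apply]

lemma norm_gradVec (ζ : Euc d → ℝ) (x : Euc d) : ‖gradVec ζ x‖ = ‖fderiv ℝ ζ x‖ := by
  rw [gradVec_eq]; simp

lemma continuous_gradVec {ζ : Euc d → ℝ} (h : ContDiff ℝ (⊤ : ℕ∞) ζ) :
    Continuous (gradVec ζ) := by
  have : gradVec ζ = fun x => (InnerProductSpace.toDual ℝ (Euc d)).symm (fderiv ℝ ζ x) :=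
    funext (gradVec_eq ζ)
  rw [this]
  exact (LinearIsometryEquiv.continuous _).comp (h.continuous_fderiv (by simp))

lemma hasCompactSupport_gradVec {ζ : Euc d → ℝ} (h : HasCompactSupport ζ) :
    HasCompactSupport (gradVec ζ) := by
  have : gradVec ζ = fun x => (InnerProductSpace.toDual ℝ (Euc d)).symm (fderiv ℝ ζ x) :=
    funext (gradVec_eq ζ)
  rw [this]
  exact (h.fderiv ℝ).comp_left (g := fun L => (InnerProductSpace.toDual ℝ (Euc d)).symm L) (by simp)

lemma gradVec_zero_of_notMem {ζ : Euc d → ℝ} {x : Euc d} (h : x ∉ tsupport ζ) :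
    gradVec ζ x = 0 := by
  rw [gradVec_eq, (by simpa using (fderiv_of_notMem_tsupport ℝ h) : fderiv ℝ ζ x = 0)]
  simp

lemma isTest_memLp {ζ : Euc d → ℝ} (h : IsTest ζ) (p : ℝ≥0∞) : MemLp ζ p volume :=
  h.1.continuous.memLp_of_hasCompactSupport h.2

lemma isTest_memLp_grad {ζ : Euc d → ℝ} (h : IsTest ζ) (p : ℝ≥0∞) :
    MemLp (gradVec ζ) p volume :=
  (continuous_gradVec h.1).memLp_of_hasCompactSupport (hasCompactSupport_gradVec h.2)

lemma countable_simple_zeros {q q' : ℝ → ℝ} (hq : ∀ t, HasDerivAt q (q' t) t) :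
    {t | q t = 0 ∧ q' t ≠ 0}.Countable := by
  set s := {t | q t = 0 ∧ q' t ≠ 0}
  have hd : DiscreteTopology s := by
    rw [discreteTopology_subtype_iff]
    rintro x ⟨hx0, hx⟩
    have := (hq x).eventually_ne hx (c := 0)
    rw [← _root_.disjoint_iff, Filter.disjoint_principal_right]
    filter_upwards [this] with t ht hts
    exact ht hts.1
  exact (HereditarilyLindelofSpace.isLindelof s).countable hd

lemma ae_fderiv_zero {ζ : Euc d → ℝ} (h : ContDiff ℝ (⊤ : ℕ∞) ζ) (v : Euc d) :
    ∀ᵐ x, ζ x = 0 → fderiv ℝ ζ x v = 0 := by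
  have hc : Continuous fun x => fderiv ℝ ζ x v :=
    (h.continuous_fderiv (by simp)).clm_apply continuous_const
  have hm : MeasurableSet {x | ζ x = 0 → fderiv ℝ ζ x v = 0} := by
    have h1 : MeasurableSet {x | ζ x = 0} := (isClosed_eq h.continuous continuous_const).measurableSet
    have h2 : MeasurableSet {x | fderiv ℝ ζ x v = 0} :=
      (isClosed_eq hc continuous_const).measurableSet
    have : {x | ζ x = 0 → fderiv ℝ ζ x v = 0} = {x | ζ x = 0}ᶜ ∪ {x | fderiv ℝ ζ x v = 0} := by
      ext x
      show (ζ x = 0 → fderiv ℝ ζ x v = 0) ↔ (¬ (ζ x = 0) ∨ fderiv ℝ ζ x v = 0)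
      tauto
    rw [this]
    exact h1.compl.union h2
  let L : ℝ →L[ℝ] Euc d := ContinuousLinearMap.smulRight (1 : ℝ →L[ℝ] ℝ) v
  refine ae_mem_of_ae_add_linearMap_mem L.toLinearMap volume volume hm fun y => ?_
  have hcount := countable_simple_zeros (q := fun t => ζ (y + t • v))
    (q' := fun t => fderiv ℝ ζ (y + t • v) v) (fun t => by
      have h1 : HasFDerivAt ζ (fderiv ℝ ζ (y + t • v)) (y + t • v) :=
        (h.differentiable (by simp) _).hasFDerivAt
      have h2 : HasDerivAt (fun t : ℝ => y + t • v) v t := by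
        simpa using ((hasDerivAt_id t).smul_const v).const_add y
      exact h1.comp_hasDerivAt t h2)
  filter_upwards [hcount.ae_notMem volume] with t ht
  show ζ (y + L t) = 0 → fderiv ℝ ζ (y + L t) v = 0
  intro h0
  by_contra hne
  exact ht ⟨by simpa [L] using h0, by simpa [L] using hne⟩

lemma ae_gradVec_zero {ζ : Euc d → ℝ} (h : ContDiff ℝ (⊤ : ℕ∞) ζ) :
    ∀ᵐ x, ζ x = 0 → gradVec ζ x = 0 := by
  have : ∀ᵐ x, ∀ i : Fin d, ζ x = 0 → fderiv ℝ ζ x (EuclideanSpace.single i 1) = 0 :=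
    ae_all_iff.2 fun i => ae_fderiv_zero h _
  filter_upwards [this] with x hx h0
  ext i
  exact hx i h0

lemma exists_cut : ∃ F : ℝ → ℝ, ContDiff ℝ (⊤ : ℕ∞) F ∧ (∀ t, |t| ≤ 1 → F t = 0) ∧
    (∀ t, 2 < |t| → F t = t) ∧ (∀ t, |F t| ≤ |t|) ∧ ∃ C, ∀ t, |deriv F t| ≤ C := by
  let χ : ContDiffBump (0 : ℝ) := ⟨1, 2, by norm_num, by norm_num⟩
  have hF : ContDiff ℝ (⊤ : ℕ∞) fun t => t * (1 - χ t) :=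
    contDiff_id.mul (contDiff_const.sub χ.contDiff)
  refine ⟨fun t => t * (1 - χ t), hF, ?_, ?_, ?_, ?_⟩
  · intro t ht
    show t * (1 - χ t) = _
    rw [χ.one_of_mem_closedBall (by simpa using ht)]; simp
  · intro t ht
    show t * (1 - χ t) = _
    rw [χ.zero_of_le_dist (by simpa using ht.le)]; simp
  · intro t
    show |t * (1 - χ t)| ≤ _
    rw [abs_mul]
    have h1 := χ.nonneg (x := t)
    have h2 := χ.le_one (x := t)
    have : |1 - χ t| ≤ 1 := by rw [abs_le]; constructor <;> linarith
    nlinarith [abs_nonneg t]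
  · have hc : Continuous (deriv fun t => t * (1 - χ t)) := hF.continuous_deriv (by simp)
    obtain ⟨C, hC⟩ := (isCompact_closedBall (0 : ℝ) 2).exists_bound_of_continuousOn hc.continuousOn
    refine ⟨max C 1, fun t => ?_⟩
    by_cases ht : |t| ≤ 2
    · exact (hC t (by simpa using ht)).trans (le_max_left _ _)
    · push Not at ht
      have : (fun t => t * (1 - χ t)) =ᶠ[𝓝 t] id := by
        have : {t : ℝ | 2 < |t|} ∈ 𝓝 t := (isOpen_lt continuous_const continuous_abs).mem_nhds ht
        filter_upwards [this] with s hs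
        have hs : 2 < |s| := hs
        rw [χ.zero_of_le_dist (by simpa using hs.le)]; simp
      rw [this.deriv_eq]
      simp

lemma eq_upgrade {lam r : ℝ} {D : Set (Euc d)} {u : Euc d → ℝ} {g : Euc d → Euc d}
    (lu : MemLp u 2 volume) (lg : MemLp g 2 volume)
    (eq0 : ∀ ζ : Euc d → ℝ, IsTest ζ → tsupport ζ ⊆ ball 0 r → tsupport ζ ∩ closure D = ∅ →
      ∫ x, ((inner ℝ (g x) (gradVec ζ x) : ℝ) + lam * u x * ζ x) = 0)
    (ζ : Euc d → ℝ) (hζ : IsTest ζ) (hs : tsupport ζ ⊆ ball 0 r) (hD : ∀ x ∈ D, ζ x = 0) :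
    ∫ x, ((inner ℝ (g x) (gradVec ζ x) : ℝ) + lam * u x * ζ x) = 0 := by
  obtain ⟨F, hF, hF0, hF1, hFle, C, hC⟩ := exists_cut
  have hC0 : 0 ≤ C := (abs_nonneg _).trans (hC 0)
  let ζn : ℕ → Euc d → ℝ := fun n x => ((n : ℝ) + 1)⁻¹ * F (((n : ℝ) + 1) * ζ x)
  have hpos : ∀ n : ℕ, (0 : ℝ) < (n : ℝ) + 1 := fun n => by positivity
  have hDc : ∀ x ∈ closure D, ζ x = 0 := fun x hx =>
    (closure_minimal (fun y hy => hD y hy) (isClosed_eq hζ.1.continuous continuous_const)) hx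
  have hsm : ∀ n, ContDiff ℝ (⊤ : ℕ∞) (ζn n) := fun n =>
    contDiff_const.mul (hF.comp (contDiff_const.mul hζ.1))
  have hsupp : ∀ n, tsupport (ζn n) ⊆ tsupport ζ := fun n => by
    refine closure_mono fun x hx => ?_
    rw [Function.mem_support] at hx ⊢
    intro h0
    exact hx (by simp [ζn, h0, hF0 0 (by simp)])
  have htest : ∀ n, IsTest (ζn n) := fun n =>
    ⟨hsm n, IsCompact.of_isClosed_subset hζ.2 (isClosed_tsupport _) (hsupp n)⟩
  have hgrad : ∀ n x, gradVec (ζn n) x = deriv F (((n : ℝ) + 1) * ζ x) • gradVec ζ x := by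
    intro n x
    have h1 : HasFDerivAt ζ (fderiv ℝ ζ x) x := (hζ.1.differentiable (by simp) x).hasFDerivAt
    have h2 : HasDerivAt F (deriv F (((n : ℝ) + 1) * ζ x)) (((n : ℝ) + 1) * ζ x) :=
      (hF.differentiable (by simp) _).hasDerivAt
    have h3 := (h2.comp_hasFDerivAt x (h1.const_mul ((n : ℝ) + 1))).const_mul ((n : ℝ) + 1)⁻¹
    rw [gradVec_eq, gradVec_eq, ← map_smul]
    congr 1
    refine (HasFDerivAt.fderiv h3).trans ?_
    ext v
    have := (hpos n).ne'
    simp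
    field_simp
  have hz : ∀ n, ∫ x, ((inner ℝ (g x) (gradVec (ζn n) x) : ℝ) + lam * u x * ζn n x) = 0 := by
    intro n
    refine eq0 _ (htest n) ((hsupp n).trans hs) ?_
    rw [← Set.disjoint_iff_inter_eq_empty, Set.disjoint_left]
    intro x hx hxD
    have h0 := hDc x hxD
    refine (mem_closure_iff_nhds.1 hx) {y | |((n : ℝ) + 1) * ζ y| < 1} ?_ |>.elim ?_
    · refine (isOpen_lt (by have := hζ.1.continuous; fun_prop) continuous_const).mem_nhds ?_
      show |((n : ℝ) + 1) * ζ x| < 1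
      simp [h0]
    · rintro y ⟨hy1, hy2⟩
      have hy1 : |((n : ℝ) + 1) * ζ y| < 1 := hy1
      exact hy2 (by simp [ζn, hF0 _ hy1.le])
  have hint1 : Integrable (fun x => ‖g x‖ * ‖gradVec ζ x‖) :=
    MemLp.integrable_mul (p := 2) (q := 2) lg.norm (isTest_memLp_grad hζ 2).norm
  have hint2 : Integrable (fun x => ‖u x‖ * ‖ζ x‖) :=
    MemLp.integrable_mul (p := 2) (q := 2) lu.norm (isTest_memLp hζ 2).norm
  have hlim : Tendsto (fun n => ∫ x, ((inner ℝ (g x) (gradVec (ζn n) x) : ℝ) + lam * u x * ζn n x))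
      atTop (𝓝 (∫ x, ((inner ℝ (g x) (gradVec ζ x) : ℝ) + lam * u x * ζ x))) := by
    refine tendsto_integral_of_dominated_convergence
      (fun x => C * (‖g x‖ * ‖gradVec ζ x‖) + |lam| * (‖u x‖ * ‖ζ x‖)) ?_ ?_ ?_ ?_
    · intro n
      refine AEStronglyMeasurable.add ?_ ?_
      · exact lg.1.inner (continuous_gradVec (hsm n)).aestronglyMeasurable
      · exact (lu.1.const_mul lam).mul (hsm n).continuous.aestronglyMeasurable
    · exact (hint1.const_mul C).add (hint2.const_mul _)
    · intro n
      refine Eventually.of_forall fun x => ?_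
      refine (norm_add_le _ _).trans (add_le_add ?_ ?_)
      · refine (norm_inner_le_norm _ _).trans ?_
        rw [hgrad, norm_smul]
        calc ‖g x‖ * (‖deriv F _‖ * ‖gradVec ζ x‖) ≤ ‖g x‖ * (C * ‖gradVec ζ x‖) := by
              gcongr; exact hC _
          _ = _ := by ring
      · rw [norm_mul, norm_mul, Real.norm_eq_abs lam, mul_assoc]
        gcongr
        simp only [ζn, norm_mul, Real.norm_eq_abs]
        have h1 := hFle (((n : ℝ) + 1) * ζ x)
        rw [abs_mul, abs_of_pos (hpos n)] at h1
        rw [abs_of_pos (inv_pos.2 (hpos n)), inv_mul_le_iff₀ (hpos n)]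
        exact h1
    · filter_upwards [ae_gradVec_zero hζ.1] with x hx
      by_cases h0 : ζ x = 0
      · have : ∀ n, gradVec (ζn n) x = 0 := fun n => by rw [hgrad, hx h0, smul_zero]
        simp only [this, hx h0, h0, ζn, mul_zero, hF0 0 (by simp)]
        exact tendsto_const_nhds
      · have hev : ∀ᶠ n : ℕ in atTop, 2 < ((n : ℝ) + 1) * |ζ x| := by
          have : Tendsto (fun n : ℕ => ((n : ℝ) + 1) * |ζ x|) atTop atTop :=
            (tendsto_natCast_atTop_atTop.atTop_add tendsto_const_nhds).atTop_mul_const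
              (abs_pos.2 h0)
          exact this.eventually_gt_atTop 2
        refine tendsto_const_nhds.congr' ?_
        filter_upwards [hev] with n hn
        have hn' : 2 < |((n : ℝ) + 1) * ζ x| := by rwa [abs_mul, abs_of_pos (hpos n)]
        have hd1 : deriv F (((n : ℝ) + 1) * ζ x) = 1 := by
          have : F =ᶠ[𝓝 (((n : ℝ) + 1) * ζ x)] id := by
            have : {t : ℝ | 2 < |t|} ∈ 𝓝 (((n : ℝ) + 1) * ζ x) :=
              (isOpen_lt continuous_const continuous_abs).mem_nhds hn'
            filter_upwards [this] with s hs using hF1 s hs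
          rw [this.deriv_eq]; simp
        have hv : ζn n x = ζ x := by
          simp only [ζn]
          rw [hF1 _ hn', inv_mul_cancel_left₀ (hpos n).ne']
        rw [hgrad, hd1, one_smul, hv]
  simp only [hz] at hlim
  exact (tendsto_nhds_unique hlim tendsto_const_nhds)

end grads
end RH
end

section
open Set Filter MeasureTheory Metric Topology
open scoped ENNReal NNReal

namespace RH
section sol
variable {d : ℕ}

/-- half ball -/
def HB (i0 : Fin d) (r : ℝ) : Set (Euc d) := ball (0 : Euc d) r ∩ {x | 0 < x i0}

lemma measurable_coord (i : Fin d) : Measurable fun x : Euc d => x i := by fun_prop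

lemma HB_meas (i0 : Fin d) (r : ℝ) : MeasurableSet (HB i0 r) :=
  measurableSet_ball.inter (measurableSet_lt measurable_const (measurable_coord i0))

lemma HB_mono (i0 : Fin d) {r r' : ℝ} (h : r ≤ r') : HB i0 r ⊆ HB i0 r' :=
  inter_subset_inter_left _ (ball_subset_ball h)

lemma HB_shift {i0 : Fin d} {r r' : ℝ} {h : Euc d} (h0 : h i0 = 0) (hr : r + ‖h‖ ≤ r') :
    ∀ x ∈ HB i0 r, x + h ∈ HB i0 r' := by
  rintro x ⟨hx1, hx2⟩
  refine ⟨?_, ?_⟩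
  · rw [mem_ball_zero_iff] at hx1 ⊢
    exact (norm_add_le _ _).trans_lt (by linarith)
  · show 0 < (x + h) i0
    have : 0 < x i0 := hx2
    simpa [h0] using this

/-- approximability -/
def Ap (i0 : Fin d) (D : Set (Euc d)) (r : ℝ) (u : Euc d → ℝ) (g : Euc d → Euc d) : Prop :=
  ∃ un : ℕ → Euc d → ℝ, (∀ n, IsTest (un n) ∧ ∀ x ∈ D, un n x = 0) ∧
    Tendsto (fun n => Q (HB i0 r) fun x => un n x - u x) atTop (𝓝 0) ∧
    Tendsto (fun n => Q (HB i0 r) fun x => gradVec (un n) x - g x) atTop (𝓝 0)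

/-- local weak solutions, extended by zero to the lower half space -/
structure Sol (i0 : Fin d) (D : Set (Euc d)) (lam r : ℝ) (u : Euc d → ℝ) (g : Euc d → Euc d) :
    Prop where
  mu : Measurable u
  mg : Measurable g
  lu : MemLp u 2 volume
  lg : MemLp g 2 volume
  zu : ∀ x, x i0 ≤ 0 → u x = 0
  zg : ∀ x, x i0 ≤ 0 → g x = 0
  ap : Ap i0 D r u g
  eq : ∀ ζ : Euc d → ℝ, IsTest ζ → tsupport ζ ⊆ ball 0 r → (∀ x ∈ D, ζ x = 0) →
    ∫ x, ((inner ℝ (g x) (gradVec ζ x) : ℝ) + lam * u x * ζ x) = 0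

/-- energy -/
noncomputable def En (i0 : Fin d) (lam r : ℝ) (u : Euc d → ℝ) (g : Euc d → Euc d) : ℝ≥0∞ :=
  Q (HB i0 r) g + ENNReal.ofReal lam * Q (HB i0 r) u

lemma En_mono (i0 : Fin d) (lam : ℝ) {r r' : ℝ} (h : r ≤ r') (u : Euc d → ℝ) (g : Euc d → Euc d) :
    En i0 lam r u g ≤ En i0 lam r' u g := by
  unfold En
  gcongr <;> exact Q_mono_set (HB_mono i0 h) _

lemma Q_le_En (i0 : Fin d) (lam : ℝ) (r : ℝ) (u : Euc d → ℝ) (g : Euc d → Euc d) :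
    Q (HB i0 r) g ≤ En i0 lam r u g := le_self_add

lemma Q_univ_lt_top {F : Type*} [NormedAddCommGroup F] {f : Euc d → F} (hf : MemLp f 2 volume)
    (A : Set (Euc d)) : Q A f < ⊤ := by
  have := hf.eLpNorm_lt_top
  rw [eLpNorm_lt_top_iff_lintegral_rpow_enorm_lt_top (by norm_num) (by norm_num)] at this
  refine lt_of_le_of_lt ?_ this
  unfold Q
  simp only [ENNReal.toReal_ofNat, ENNReal.rpow_ofNat]
  exact setLIntegral_le_lintegral _ _

lemma Q_le_ofReal {F : Type*} [NormedAddCommGroup F] {f : Euc d → F} (hf : MemLp f 2 volume)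
    {A : Set (Euc d)} : Q A f = ENNReal.ofReal (∫ x in A, ‖f x‖ ^ 2) := by
  have hi : Integrable (fun x => ‖f x‖ ^ 2) volume := hf.integrable_norm_pow (by norm_num)
  rw [ofReal_integral_eq_lintegral_ofReal hi.integrableOn (Eventually.of_forall fun x => by positivity)]
  unfold Q
  refine lintegral_congr fun x => ?_
  rw [ENNReal.ofReal_pow (norm_nonneg _), ofReal_norm]

lemma memLp_shift {F : Type*} [NormedAddCommGroup F] {f : Euc d → F} (hf : MemLp f 2 volume)
    (h : Euc d) : MemLp (fun x => f (x + h)) 2 volume :=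
  hf.comp_measurePreserving (measurePreserving_add_right volume h)

lemma tendsto_inner {H : Type*} [NormedAddCommGroup H] [InnerProductSpace ℝ H]
    {A : Set (Euc d)} (hA : MeasurableSet A) {G F : Euc d → H} {Fn : ℕ → Euc d → H}
    (hG : MemLp G 2 volume) (hG0 : ∀ x ∉ A, G x = 0) (hF : MemLp F 2 volume)
    (hFn : ∀ n, MemLp (Fn n) 2 volume)
    (h : Tendsto (fun n => Q A fun x => Fn n x - F x) atTop (𝓝 0)) :
    Tendsto (fun n => ∫ x, (inner ℝ (G x) (Fn n x) : ℝ)) atTop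
      (𝓝 (∫ x, (inner ℝ (G x) (F x) : ℝ))) := by
  have hIntg : ∀ {F : Euc d → H}, MemLp F 2 volume → Integrable fun x => (inner ℝ (G x) (F x) : ℝ) := by
    intro F hF
    refine Integrable.mono (g := fun x => ‖G x‖ * ‖F x‖) ?_ (hG.1.inner hF.1) ?_
    · exact MemLp.integrable_mul (p := 2) (q := 2) hG.norm hF.norm
    · refine Eventually.of_forall fun x => ?_
      rw [norm_mul, norm_norm, norm_norm]
      exact norm_inner_le_norm _ _
  refine tendsto_integral_of_L1 _ (hIntg hF).1 (Eventually.of_forall fun n => hIntg (hFn n)) ?_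
  have hle : ∀ n, ∫⁻ x, ‖(inner ℝ (G x) (Fn n x) : ℝ) - inner ℝ (G x) (F x)‖ₑ ≤
      (Q A G) ^ (1 / 2 : ℝ) * (Q A fun x => Fn n x - F x) ^ (1 / 2 : ℝ) := by
    intro n
    calc ∫⁻ x, ‖(inner ℝ (G x) (Fn n x) : ℝ) - inner ℝ (G x) (F x)‖ₑ
        ≤ ∫⁻ x in A, ‖G x‖ₑ * ‖Fn n x - F x‖ₑ := by
          rw [← lintegral_indicator hA]
          refine lintegral_mono fun x => ?_
          by_cases hx : x ∈ A
          · rw [indicator_of_mem hx, ← inner_sub_right, ← enorm_norm (G x), ← enorm_norm (Fn n x - F x),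
              ← enorm_mul]
            exact enorm_le_iff_norm_le.2 (by
              rw [norm_mul, norm_norm, norm_norm]; exact norm_inner_le_norm _ _)
          · simp [hG0 x hx]
      _ ≤ _ := by
          have := ENNReal.lintegral_mul_le_Lp_mul_Lq (volume.restrict A) (p := 2) (q := 2)
            (by constructor <;> norm_num) (f := fun x => ‖G x‖ₑ) (g := fun x => ‖Fn n x - F x‖ₑ)
            hG.1.restrict.enorm ((hFn n).1.restrict.sub hF.1.restrict).enorm
          simpa [Q] using this
  have h0 : Tendsto (fun n => (Q A G) ^ (1 / 2 : ℝ) * (Q A fun x => Fn n x - F x) ^ (1 / 2 : ℝ))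
      atTop (𝓝 0) := by
    have h1 := (ENNReal.continuous_rpow_const (y := (1 / 2 : ℝ))).tendsto 0 |>.comp h
    rw [ENNReal.zero_rpow_of_pos (by norm_num)] at h1
    have := ENNReal.Tendsto.const_mul (a := (Q A G) ^ (1 / 2 : ℝ)) h1
      (Or.inr (ENNReal.rpow_ne_top_of_nonneg (by norm_num) (Q_univ_lt_top hG A).ne))
    simpa using this
  exact tendsto_of_tendsto_of_tendsto_of_le_of_le tendsto_const_nhds h0 (fun _ => zero_le) hle

lemma Ap.mono {i0 : Fin d} {D : Set (Euc d)} {r r' : ℝ} {u : Euc d → ℝ} {g : Euc d → Euc d}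
    (h : Ap i0 D r u g) (hr : r' ≤ r) : Ap i0 D r' u g := by
  obtain ⟨un, h1, h2, h3⟩ := h
  refine ⟨un, h1, ?_, ?_⟩
  · exact tendsto_of_tendsto_of_tendsto_of_le_of_le tendsto_const_nhds h2 (fun _ => zero_le)
      fun n => Q_mono_set (HB_mono i0 hr) _
  · exact tendsto_of_tendsto_of_tendsto_of_le_of_le tendsto_const_nhds h3 (fun _ => zero_le)
      fun n => Q_mono_set (HB_mono i0 hr) _

lemma gradVec_shift {ζ : Euc d → ℝ} (h x : Euc d) :
    gradVec (fun y => ζ (y + h)) x = gradVec ζ (x + h) := by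
  rw [gradVec_eq, gradVec_eq, fderiv_comp_add_right]

lemma gradVec_sub {ζ ξ : Euc d → ℝ} (hζ : ContDiff ℝ (⊤ : ℕ∞) ζ) (hξ : ContDiff ℝ (⊤ : ℕ∞) ξ)
    (x : Euc d) : gradVec (fun y => ζ y - ξ y) x = gradVec ζ x - gradVec ξ x := by
  simp only [gradVec_eq]
  rw [fderiv_fun_sub (hζ.differentiable (by simp) x) (hξ.differentiable (by simp) x), map_sub]

lemma gradVec_mul {ζ ξ : Euc d → ℝ} (hζ : ContDiff ℝ (⊤ : ℕ∞) ζ) (hξ : ContDiff ℝ (⊤ : ℕ∞) ξ)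
    (x : Euc d) : gradVec (fun y => ζ y * ξ y) x = ζ x • gradVec ξ x + ξ x • gradVec ζ x := by
  simp only [gradVec_eq]
  rw [fderiv_fun_mul (hζ.differentiable (by simp) x) (hξ.differentiable (by simp) x), map_add,
    map_smul, map_smul]

lemma isTest_shift {ζ : Euc d → ℝ} (hζ : IsTest ζ) (h : Euc d) : IsTest fun x => ζ (x + h) :=
  ⟨hζ.1.comp (contDiff_id.add contDiff_const),
    hζ.2.comp_homeomorph (Homeomorph.addRight h)⟩

lemma isTest_sub {ζ ξ : Euc d → ℝ} (hζ : IsTest ζ) (hξ : IsTest ξ) :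
    IsTest fun x => ζ x - ξ x :=
  ⟨hζ.1.sub hξ.1, hζ.2.sub hξ.2⟩

/-- closedness of `Ap` under differences -/
lemma Ap.dl {i0 : Fin d} {D : Set (Euc d)} {r r' : ℝ} {u : Euc d → ℝ} {g : Euc d → Euc d}
    (ap : Ap i0 D r' u g) (mu : Measurable u) (mg : Measurable g)
    {h : Euc d} (h0 : h i0 = 0) (hD : ∀ x ∈ D, x + h ∈ D) (hr : r + ‖h‖ ≤ r') :
    Ap i0 D r (dl h u) (RH.dl h g) := by
  obtain ⟨un, h1, h2, h3⟩ := ap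
  have hr' : r ≤ r' := by linarith [norm_nonneg h]
  refine ⟨fun n x => un n (x + h) - un n x, fun n =>
    ⟨isTest_sub (isTest_shift (h1 n).1 h) (h1 n).1, fun x hx => ?_⟩, ?_, ?_⟩
  · show un n (x + h) - un n x = 0
    rw [(h1 n).2 x hx, (h1 n).2 _ (hD x hx), sub_zero]
  · have := ENNReal.Tendsto.const_mul (a := 4) h2 (Or.inr (by simp))
    rw [mul_zero] at this
    refine tendsto_of_tendsto_of_tendsto_of_le_of_le tendsto_const_nhds this (fun _ => zero_le)
      fun n => ?_
    refine le_trans (le_of_eq ?_) (Q_dl_le (HB_meas i0 r) (HB_meas i0 r') h (HB_shift h0 hr)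
      (HB_mono i0 hr') ((h1 n).1.1.continuous.measurable.sub mu))
    congr 1
    funext x
    simp only [RH.dl]
    ring
  · have := ENNReal.Tendsto.const_mul (a := 4) h3 (Or.inr (by simp))
    rw [mul_zero] at this
    refine tendsto_of_tendsto_of_tendsto_of_le_of_le tendsto_const_nhds this (fun _ => zero_le)
      fun n => ?_
    refine le_trans (le_of_eq ?_) (Q_dl_le (HB_meas i0 r) (HB_meas i0 r') h (HB_shift h0 hr)
      (HB_mono i0 hr') ((continuous_gradVec (h1 n).1.1).measurable.sub mg))
    congr 1
    funext x
    rw [gradVec_sub (isTest_shift (h1 n).1 h).1 (h1 n).1.1, gradVec_shift]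
    simp only [RH.dl]
    abel

/-- testing the equation with `χ w`. -/
lemma Sol.test {i0 : Fin d} {D : Set (Euc d)} {lam r : ℝ} {u w : Euc d → ℝ} {g W : Euc d → Euc d}
    (s : Sol i0 D lam r u g) (aw : Ap i0 D r w W) (lw : MemLp w 2 volume) (lW : MemLp W 2 volume)
    {χ : Euc d → ℝ} (hχ : IsTest χ) (hs : tsupport χ ⊆ ball 0 r) :
    Integrable (fun x => χ x * ((inner ℝ (g x) (W x) : ℝ) + lam * u x * w x)
      + w x * (inner ℝ (g x) (gradVec χ x) : ℝ)) ∧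
    ∫ x, (χ x * ((inner ℝ (g x) (W x) : ℝ) + lam * u x * w x)
      + w x * (inner ℝ (g x) (gradVec χ x) : ℝ)) = 0 := by
  obtain ⟨wn, h1, h2, h3⟩ := aw
  obtain ⟨C1, hC1⟩ := hχ.1.continuous.bounded_above_of_compact_support hχ.2
  obtain ⟨C2, hC2⟩ := (continuous_gradVec hχ.1).bounded_above_of_compact_support
    (hasCompactSupport_gradVec hχ.2)
  have hχ0 : ∀ x ∉ ball (0 : Euc d) r, χ x = 0 := fun x hx => image_eq_zero_of_notMem_tsupport
    fun h => hx (hs h)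
  have hχ0' : ∀ x ∉ ball (0 : Euc d) r, gradVec χ x = 0 := fun x hx => gradVec_zero_of_notMem
    fun h => hx (hs h)
  -- the two coefficient functions
  have hG1 : MemLp (fun x => χ x • g x) 2 volume := by
    refine MemLp.of_le_mul s.lg (hχ.1.continuous.aestronglyMeasurable.smul s.lg.1) (c := C1)
      (Eventually.of_forall fun x => ?_)
    rw [norm_smul]
    gcongr
    exact hC1 x
  have hG2 : MemLp (fun x => lam * u x * χ x + (inner ℝ (g x) (gradVec χ x) : ℝ)) 2 volume := by
    refine MemLp.add ?_ ?_
    · refine MemLp.of_le_mul s.lu ((s.lu.1.const_mul lam).mul hχ.1.continuous.aestronglyMeasurable)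
        (c := |lam| * C1) (Eventually.of_forall fun x => ?_)
      rw [norm_mul, norm_mul, Real.norm_eq_abs lam]
      calc |lam| * ‖u x‖ * ‖χ x‖ ≤ |lam| * ‖u x‖ * C1 := by gcongr; exact hC1 x
        _ = _ := by ring
    · refine MemLp.of_le_mul s.lg (s.lg.1.inner (continuous_gradVec hχ.1).aestronglyMeasurable)
        (c := C2) (Eventually.of_forall fun x => ?_)
      refine (norm_inner_le_norm _ _).trans ?_
      rw [mul_comm]
      gcongr
      exact hC2 x
  have hA := HB_meas i0 r
  have hnot : ∀ x ∉ HB i0 r, x ∉ ball (0 : Euc d) r ∨ x i0 ≤ 0 := by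
    intro x hx
    by_contra hc
    push Not at hc
    exact hx ⟨hc.1, hc.2⟩
  have l1 := tendsto_inner hA hG1 (fun x hx => by
    rcases hnot x hx with h | h
    · simp [hχ0 x h]
    · simp [s.zg x h]) lW (fun n => isTest_memLp_grad (h1 n).1 2) h3
  have l2 := tendsto_inner hA hG2 (fun x hx => by
    rcases hnot x hx with h | h
    · simp [hχ0 x h, hχ0' x h]
    · simp [s.zg x h, s.zu x h]) lw (fun n => isTest_memLp (h1 n).1 2) h2
  have hi1 : ∀ {W : Euc d → Euc d}, MemLp W 2 volume →
      Integrable fun x => (inner ℝ (χ x • g x) (W x) : ℝ) := by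
    intro W hW
    refine Integrable.mono (g := fun x => ‖χ x • g x‖ * ‖W x‖) ?_ (hG1.1.inner hW.1) ?_
    · exact MemLp.integrable_mul (p := 2) (q := 2) hG1.norm hW.norm
    · refine Eventually.of_forall fun x => ?_
      rw [norm_mul, norm_norm, norm_norm]
      exact norm_inner_le_norm _ _
  have hi2 : ∀ {w : Euc d → ℝ}, MemLp w 2 volume →
      Integrable fun x => (inner ℝ (lam * u x * χ x + (inner ℝ (g x) (gradVec χ x) : ℝ)) (w x) : ℝ) := by
    intro w hw
    have := MemLp.integrable_mul (p := 2) (q := 2) hw hG2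
    exact this
  have l3 := l1.add l2
  have hz : ∀ n, (∫ x, (inner ℝ (χ x • g x) (gradVec (wn n) x) : ℝ)) +
      ∫ x, (inner ℝ (lam * u x * χ x + (inner ℝ (g x) (gradVec χ x) : ℝ)) (wn n x) : ℝ) = 0 := by
    intro n
    rw [← integral_add (hi1 (isTest_memLp_grad (h1 n).1 2)) (hi2 (isTest_memLp (h1 n).1 2))]
    have hsub : tsupport (fun x => χ x * wn n x) ⊆ tsupport χ := by
      exact tsupport_mul_subset_left
    rw [← s.eq (fun x => χ x * wn n x) ⟨hχ.1.mul (h1 n).1.1, hχ.2.mul_right⟩ (hsub.trans hs)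
      (fun x hx => by rw [(h1 n).2 x hx, mul_zero])]
    refine integral_congr_ae (Eventually.of_forall fun x => ?_)
    simp only
    rw [gradVec_mul hχ.1 (h1 n).1.1, inner_add_right, inner_smul_right, inner_smul_right,
      real_inner_smul_left]
    simp only [RCLike.inner_apply, conj_trivial]
    ring
  simp only [hz] at l3
  have := tendsto_nhds_unique l3 tendsto_const_nhds
  rw [← integral_add (hi1 lW) (hi2 lw)] at this
  refine ⟨((hi1 lW).add (hi2 lw)).congr (Eventually.of_forall fun x => ?_), ?_⟩
  · simp only [RCLike.inner_apply, conj_trivial, real_inner_smul_left, Pi.add_apply]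
    ring
  rw [← this]
  refine integral_congr_ae (Eventually.of_forall fun x => ?_)
  simp only [RCLike.inner_apply, conj_trivial, real_inner_smul_left]
  ring

end sol
end RH
end

section
open Set Filter MeasureTheory Metric Topology
open scoped ENNReal NNReal

namespace RH
section est
variable {d : ℕ}

lemma exists_cutoff {r r' : ℝ} (hr : 0 < r) (hrr : r < r') : ∃ η : Euc d → ℝ, ∃ L : ℝ, 0 ≤ L ∧
    IsTest η ∧ (∀ x, 0 ≤ η x) ∧ (∀ x, η x ≤ 1) ∧ (∀ x ∈ ball (0 : Euc d) r, η x = 1) ∧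
    tsupport η ⊆ ball 0 r' ∧ (∀ x, ‖gradVec η x‖ ≤ L) ∧
    (∀ x y, |η x - η y| ≤ L * ‖x - y‖) := by
  let η : ContDiffBump (0 : Euc d) := ⟨r, (r + r') / 2, hr, by linarith⟩
  have ht : IsTest (η : Euc d → ℝ) := ⟨η.contDiff, η.hasCompactSupport⟩
  obtain ⟨L, hL⟩ := (continuous_gradVec ht.1).bounded_above_of_compact_support
    (hasCompactSupport_gradVec ht.2)
  refine ⟨η, L, (norm_nonneg _).trans (hL 0), ht, fun x => η.nonneg, fun x => η.le_one,
    fun x hx => η.one_of_mem_closedBall (ball_subset_closedBall hx), ?_, hL, ?_⟩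
  · rw [η.tsupport_eq]
    refine closedBall_subset_ball ?_
    show (r + r') / 2 < r'
    linarith
  · intro x y
    have := Convex.norm_image_sub_le_of_norm_fderiv_le (𝕜 := ℝ) (f := (η : Euc d → ℝ)) (C := L)
      (s := univ) (x := y) (y := x) (fun z _ => ht.1.differentiable (by simp) z)
      (fun z _ => by rw [← norm_gradVec]; exact hL z) convex_univ (mem_univ _) (mem_univ _)
    simpa using this

lemma Sol.mono {i0 : Fin d} {D : Set (Euc d)} {lam r r' : ℝ} {u : Euc d → ℝ} {g : Euc d → Euc d}
    (s : Sol i0 D lam r' u g) (h : r ≤ r') : Sol i0 D lam r u g :=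
  ⟨s.mu, s.mg, s.lu, s.lg, s.zu, s.zg, s.ap.mono h,
    fun ζ h1 h2 h3 => s.eq ζ h1 (h2.trans (ball_subset_ball h)) h3⟩

lemma En_eq {i0 : Fin d} {lam r : ℝ} (hl : 0 ≤ lam) {u : Euc d → ℝ} {g : Euc d → Euc d}
    (lu : MemLp u 2 volume) (lg : MemLp g 2 volume) :
    En i0 lam r u g = ENNReal.ofReal (∫ x in HB i0 r, (‖g x‖ ^ 2 + lam * ‖u x‖ ^ 2)) := by
  have hi1 : Integrable (fun x => ‖u x‖ ^ 2) volume := lu.integrable_norm_pow (by norm_num)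
  have hi2 : Integrable (fun x => ‖g x‖ ^ 2) volume := lg.integrable_norm_pow (by norm_num)
  rw [integral_add hi2.integrableOn (hi1.const_mul lam).integrableOn, integral_const_mul,
    ENNReal.ofReal_add (integral_nonneg fun x => by positivity)
    (mul_nonneg hl (integral_nonneg fun x => by positivity)), ENNReal.ofReal_mul hl,
    ← Q_le_ofReal lu, ← Q_le_ofReal lg, En]

lemma En_lt_top {i0 : Fin d} {lam r : ℝ} (hl : 0 ≤ lam) {u : Euc d → ℝ} {g : Euc d → Euc d}
    (lu : MemLp u 2 volume) (lg : MemLp g 2 volume) : En i0 lam r u g < ⊤ := by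
  rw [En_eq hl lu lg]; exact ENNReal.ofReal_lt_top

/-- Caccioppoli -/
lemma cacc {r r' : ℝ} (hr : 0 < r) (hrr : r < r') : ∃ C : ℝ≥0, ∀ (i0 : Fin d) (D : Set (Euc d))
    (lam : ℝ) (u : Euc d → ℝ) (g : Euc d → Euc d), 0 ≤ lam → Sol i0 D lam r' u g →
    En i0 lam r u g ≤ C * Q (HB i0 r') u := by
  obtain ⟨η, L, hL, ht, h0, h1, h2, h3, h4, -⟩ := exists_cutoff (d := d) hr hrr
  refine ⟨(4 * L ^ 2).toNNReal, fun i0 D lam u g hl s => ?_⟩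
  obtain ⟨hB, hB0⟩ := s.test s.ap s.lu s.lg (χ := fun x => η x * η x)
    ⟨ht.1.mul ht.1, ht.2.mul_right⟩ (tsupport_mul_subset_left.trans h3)
  have hi1 : Integrable (fun x => ‖u x‖ ^ 2) volume := s.lu.integrable_norm_pow (by norm_num)
  have hi2 : Integrable (fun x => ‖g x‖ ^ 2) volume := s.lg.integrable_norm_pow (by norm_num)
  have key : ∫ x in HB i0 r, (‖g x‖ ^ 2 + lam * ‖u x‖ ^ 2) ≤
      4 * L ^ 2 * ∫ x in HB i0 r', ‖u x‖ ^ 2 := by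
    rw [← integral_indicator (HB_meas _ _), ← integral_indicator (HB_meas _ _), ← integral_const_mul]
    have hrhs : Integrable (fun x => 2 * (η x * η x * ((inner ℝ (g x) (g x) : ℝ) + lam * u x * u x)
      + u x * (inner ℝ (g x) (gradVec (fun x => η x * η x) x) : ℝ))
        + 4 * L ^ 2 * (HB i0 r').indicator (fun x => ‖u x‖ ^ 2) x) :=
      (hB.const_mul 2).add ((hi1.indicator (HB_meas _ _)).const_mul _)
    calc _ ≤ ∫ x, (2 * (η x * η x * ((inner ℝ (g x) (g x) : ℝ) + lam * u x * u x)
      + u x * (inner ℝ (g x) (gradVec (fun x => η x * η x) x) : ℝ))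
        + 4 * L ^ 2 * (HB i0 r').indicator (fun x => ‖u x‖ ^ 2) x) := by
          refine integral_mono ((hi2.add (hi1.const_mul lam)).indicator (HB_meas _ _)) hrhs fun x => ?_
          simp only
          by_cases hx0 : x i0 ≤ 0
          · rw [indicator_of_notMem (fun h => absurd h.2 (not_lt.2 hx0)),
              indicator_of_notMem (fun h => absurd h.2 (not_lt.2 hx0)), s.zu x hx0, s.zg x hx0]
            simp
          push Not at hx0
          by_cases hxr : x ∈ ball (0 : Euc d) r'
          · rw [indicator_of_mem (show x ∈ HB i0 r' from ⟨hxr, hx0⟩), gradVec_mul ht.1 ht.1,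
              inner_add_right, inner_smul_right, real_inner_self_eq_norm_sq]
            have hab : |(inner ℝ (g x) (gradVec η x) : ℝ)| ≤ ‖g x‖ * L :=
              (abs_real_inner_le_norm _ _).trans (by gcongr; exact h4 x)
            set a := (inner ℝ (g x) (gradVec η x) : ℝ)
            have hu : ‖u x‖ ^ 2 = u x ^ 2 := by simp
            rw [hu]
            have ha2 : a ^ 2 ≤ ‖g x‖ ^ 2 * L ^ 2 := by
              rw [← mul_pow, ← sq_abs a]; gcongr
            have hpt : η x ^ 2 * (‖g x‖ ^ 2 + lam * u x ^ 2) ≤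
              2 * (η x * η x * (‖g x‖ ^ 2 + lam * u x * u x) + u x * (η x * a + η x * a))
               + 4 * L ^ 2 * u x ^ 2 := by
              have hlu : 0 ≤ η x ^ 2 * (lam * u x ^ 2) := by positivity
              have hAM : -(4 * (η x * a) * u x) ≤ η x ^ 2 * ‖g x‖ ^ 2 + 4 * L ^ 2 * u x ^ 2 := by
                have h5 : |4 * (η x * a) * u x| ≤ 4 * (η x * (‖g x‖ * L)) * |u x| := by
                  rw [abs_mul, abs_mul, abs_mul, abs_of_nonneg (h0 x)]
                  simp only [Nat.abs_ofNat]
                  have := h0 x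
                  gcongr
                have h6 := neg_abs_le (4 * (η x * a) * u x)
                have h7 := sq_nonneg (η x * ‖g x‖ - 2 * L * |u x|)
                have h8 : |u x| ^ 2 = u x ^ 2 := sq_abs _
                nlinarith
              nlinarith
            by_cases hx1 : x ∈ ball (0 : Euc d) r
            · rw [indicator_of_mem (show x ∈ HB i0 r from ⟨hx1, hx0⟩)]
              simp only [hu]
              rw [h2 x hx1] at hpt ⊢
              linarith
            · rw [indicator_of_notMem (fun h => hx1 h.1)]
              exact le_trans (by positivity) hpt
          · have hz1 : η x = 0 := image_eq_zero_of_notMem_tsupport fun h => hxr (h3 h)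
            rw [indicator_of_notMem (s := HB i0 r') (fun h => hxr h.1), indicator_of_notMem
              (s := HB i0 r) (fun h => hxr (ball_subset_ball hrr.le h.1)), gradVec_mul ht.1 ht.1, hz1]
            simp
      _ = _ := by
          rw [integral_add (hB.const_mul 2) ((hi1.indicator (HB_meas _ _)).const_mul _),
            integral_const_mul, hB0, mul_zero, zero_add]
  rw [En_eq hl s.lu s.lg, Q_le_ofReal s.lu]
  refine (ENNReal.ofReal_le_ofReal key).trans (le_of_eq ?_)
  rw [ENNReal.ofReal_mul (by positivity)]
  rfl

lemma gradVec_bound {f : Euc d → ℝ} (hf : ContDiff ℝ (⊤ : ℕ∞) f) (x h : Euc d) :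
    ‖f (x + h) - f x‖ₑ ≤ ∫⁻ t in Icc (0:ℝ) 1, ‖h‖ₑ * ‖gradVec f (x + t • h)‖ₑ := by
  have hd : ∀ t : ℝ, HasDerivAt (fun t : ℝ => f (x + t • h)) (inner ℝ h (gradVec f (x + t • h))) t := by
    intro t
    rw [inner_gradVec]
    have h1 : HasFDerivAt f (fderiv ℝ f (x + t • h)) (x + t • h) :=
      (hf.differentiable (by simp) _).hasFDerivAt
    have h2 : HasDerivAt (fun t : ℝ => x + t • h) h t := by
      simpa using ((hasDerivAt_id t).smul_const h).const_add x
    exact h1.comp_hasDerivAt t h2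
  have hc : Continuous fun t : ℝ => (inner ℝ h (gradVec f (x + t • h)) : ℝ) := by
    have := continuous_gradVec hf
    fun_prop
  have := intervalIntegral.integral_eq_sub_of_hasDerivAt (a := 0) (b := 1) (fun t _ => hd t)
    (hc.intervalIntegrable 0 1)
  simp only [one_smul, zero_smul, add_zero] at this
  rw [← this, intervalIntegral.integral_of_le zero_le_one]
  refine (enorm_integral_le_lintegral_enorm _).trans ?_
  refine (lintegral_mono_set Ioc_subset_Icc_self).trans ?_
  refine lintegral_mono fun t => ?_
  rw [← enorm_norm h, ← enorm_norm (gradVec f _), ← enorm_mul]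
  exact enorm_le_iff_norm_le.2 (by
    rw [norm_mul, norm_norm, norm_norm]; exact norm_inner_le_norm _ _)

lemma HB_shift' {i0 : Fin d} {r r' : ℝ} {h : Euc d} (h0 : h i0 = 0) (hr : r + ‖h‖ ≤ r') {t : ℝ}
    (ht : t ∈ Icc (0:ℝ) 1) : ∀ x ∈ HB i0 r, x + t • h ∈ HB i0 r' := by
  refine HB_shift (by simp [h0]) ?_
  rw [norm_smul, Real.norm_eq_abs, abs_of_nonneg ht.1]
  nlinarith [norm_nonneg h, ht.2]

lemma dl_smooth {i0 : Fin d} {r r' : ℝ} {f : Euc d → ℝ} (hf : ContDiff ℝ (⊤ : ℕ∞) f) {h : Euc d}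
    (h0 : h i0 = 0) (hr : r + ‖h‖ ≤ r') :
    Q (HB i0 r) (dl h f) ≤ ‖h‖ₑ ^ 2 * Q (HB i0 r') (gradVec f) := by
  have hm := continuous_gradVec hf
  have := mink (volume.restrict (Icc (0:ℝ) 1)) (volume.restrict (HB i0 r))
    (G := fun t x => ‖h‖ₑ * ‖gradVec f (x + t • h)‖ₑ) (K := ‖h‖ₑ ^ 2 * Q (HB i0 r') (gradVec f))
    (by
      refine Measurable.const_mul ?_ _
      refine Continuous.measurable ?_
      refine continuous_enorm.comp (hm.comp ?_)
      fun_prop)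
    (by
      filter_upwards [ae_restrict_mem measurableSet_Icc] with t ht
      simp only [mul_pow]
      rw [lintegral_const_mul' _ _ (by simp)]
      gcongr
      exact Q_shift (HB_meas _ _) (HB_meas _ _) _ (HB_shift' h0 hr ht) _)
  simp only [Measure.restrict_apply_univ, Real.volume_Icc, sub_zero, ENNReal.ofReal_one, one_pow,
    one_mul] at this
  refine le_trans ?_ this
  unfold Q
  refine lintegral_mono fun x => ?_
  gcongr
  exact gradVec_bound hf x h

lemma dlu {i0 : Fin d} {D : Set (Euc d)} {r r' : ℝ} {u : Euc d → ℝ} {g : Euc d → Euc d}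
    (ap : Ap i0 D r' u g) (mu : Measurable u) (mg : Measurable g) {h : Euc d}
    (h0 : h i0 = 0) (hr : r + ‖h‖ ≤ r') :
    Q (HB i0 r) (dl h u) ≤ 4 * ‖h‖ₑ ^ 2 * Q (HB i0 r') g := by
  obtain ⟨un, h1, h2, h3⟩ := ap
  have hle : ∀ n, Q (HB i0 r) (dl h u) ≤ 8 * Q (HB i0 r') (fun x => un n x - u x) +
      (4 * ‖h‖ₑ ^ 2 * Q (HB i0 r') g + 4 * ‖h‖ₑ ^ 2 * Q (HB i0 r') (fun x => gradVec (un n) x - g x)) := by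
    intro n
    have hmn := (h1 n).1.1.continuous.measurable
    have hgn := (continuous_gradVec (h1 n).1.1).measurable
    calc Q (HB i0 r) (dl h u)
        = Q (HB i0 r) (fun x => dl h (un n) x - dl h (fun x => un n x - u x) x) := by
          congr 1; funext x; simp only [dl]; ring
      _ ≤ 2 * Q (HB i0 r) (dl h (un n)) + 2 * Q (HB i0 r) (dl h (fun x => un n x - u x)) := by
          refine Q_sub_le ?_
          unfold dl
          fun_prop
      _ ≤ 2 * (‖h‖ₑ ^ 2 * Q (HB i0 r') (gradVec (un n))) +
          2 * (4 * Q (HB i0 r') (fun x => un n x - u x)) := by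
          gcongr
          · exact dl_smooth (h1 n).1.1 h0 hr
          · exact Q_dl_le (HB_meas _ _) (HB_meas _ _) h (HB_shift h0 hr)
              (HB_mono i0 (by linarith [norm_nonneg h])) (hmn.sub mu)
      _ ≤ 2 * (‖h‖ₑ ^ 2 * (2 * Q (HB i0 r') g + 2 * Q (HB i0 r') (fun x => gradVec (un n) x - g x))) +
          2 * (4 * Q (HB i0 r') (fun x => un n x - u x)) := by
          gcongr
          refine le_trans (le_of_eq ?_) (Q_add_le (f := g) (g := fun x => gradVec (un n) x - g x) mg)
          congr 1; funext x; abel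
      _ = _ := by ring
  have hlim : Tendsto (fun n => 8 * Q (HB i0 r') (fun x => un n x - u x) +
      (4 * ‖h‖ₑ ^ 2 * Q (HB i0 r') g + 4 * ‖h‖ₑ ^ 2 * Q (HB i0 r') (fun x => gradVec (un n) x - g x)))
      atTop (𝓝 (8 * 0 + (4 * ‖h‖ₑ ^ 2 * Q (HB i0 r') g + 4 * ‖h‖ₑ ^ 2 * 0))) := by
    refine Tendsto.add (ENNReal.Tendsto.const_mul h2 (Or.inr (by simp))) (Tendsto.add
      tendsto_const_nhds (ENNReal.Tendsto.const_mul h3 (Or.inr ?_)))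
    exact ENNReal.mul_ne_top (by simp) (by simp)
  simp only [mul_zero, zero_add, add_zero] at hlim
  exact ge_of_tendsto' hlim hle

end est
end RH
end

section
open Set Filter MeasureTheory Metric Topology
open scoped ENNReal NNReal

namespace RH
section sav
variable {d : ℕ}

lemma memLp_dl {F : Type*} [NormedAddCommGroup F] {f : Euc d → F} (hf : MemLp f 2 volume)
    (h : Euc d) : MemLp (dl h f) 2 volume := (memLp_shift hf h).sub hf

lemma meas_dl {F : Type*} [NormedAddCommGroup F] [MeasurableSpace F] [BorelSpace F]
    [SecondCountableTopology F] {f : Euc d → F}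
    (hf : Measurable f) (h : Euc d) : Measurable (dl h f) := by
  unfold dl; fun_prop

lemma int4 {B S J1 J2 : Euc d → ℝ} (hB : Integrable B) (hS : Integrable S) (h1 : Integrable J1)
    (h2 : Integrable J2) (a b : ℝ) : ∫ x, ((-2) * B x + S x + (a * J1 x + b * J2 x)) =
    (-2) * (∫ x, B x) + (∫ x, S x) + (a * (∫ x, J1 x) + b * ∫ x, J2 x) := by
  have e1 : Integrable fun x => (-2) * B x + S x := (hB.const_mul (-2)).add hS
  have e2 : Integrable fun x => a * J1 x + b * J2 x := (h1.const_mul a).add (h2.const_mul b)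
  rw [integral_add e1 e2, integral_add (hB.const_mul (-2)) hS,
    integral_add (h1.const_mul a) (h2.const_mul b), integral_const_mul, integral_const_mul,
    integral_const_mul]

/-- Savare's estimate in the cone of directions -/
lemma sav {r r' : ℝ} (hr : 0 < r) (hrr : r < r') : ∃ C : ℝ≥0, ∀ (i0 : Fin d) (D : Set (Euc d))
    (lam : ℝ) (u : Euc d → ℝ) (g : Euc d → Euc d), 0 ≤ lam → Sol i0 D lam r' u g →
    ∀ h : Euc d, h i0 = 0 → (∀ x ∈ D, x + h ∈ D) → ‖h‖ ≤ (r' - r) / 2 →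
    En i0 lam r (dl h u) (dl h g) ≤ C * ‖h‖ₑ * En i0 lam r' u g := by
  obtain ⟨χ, L, hL, ht, h0, h1, h2, h3, h4, h5⟩ :=
    exists_cutoff (d := d) (r := r) (r' := (r + r') / 2) hr (by linarith)
  refine ⟨(6 * L).toNNReal, fun i0 D lam u g hl s h hi hD hn => ?_⟩
  by_cases hh : h = 0
  · have e1 : dl h u = fun _ => 0 := by funext x; simp [dl, hh]
    have e2 : dl h g = fun _ => 0 := by funext x; simp [dl, hh]
    rw [e1, e2]
    simp [En, Q]
  have hpos : 0 < ‖h‖ := norm_pos_iff.2 hh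
  set r1 := (r + r') / 2 with hr1
  have hr1' : r1 + ‖h‖ ≤ r' := by rw [hr1]; linarith
  have hr1r : r1 ≤ r' := by linarith
  have hrr1 : r ≤ r1 := by rw [hr1]; linarith
  have s1 := s.mono hr1r
  have lw := memLp_dl s.lu h
  have lW := memLp_dl s.lg h
  obtain ⟨hB, hB0⟩ := s1.test (s.ap.dl s.mu s.mg hi hD hr1') lw lW ht h3
  set w := dl h u with hw
  set W := dl h g with hW
  have iu : Integrable (fun x => ‖u x‖ ^ 2) volume := s.lu.integrable_norm_pow (by norm_num)
  have ig : Integrable (fun x => ‖g x‖ ^ 2) volume := s.lg.integrable_norm_pow (by norm_num)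
  have iw : Integrable (fun x => ‖w x‖ ^ 2) volume := lw.integrable_norm_pow (by norm_num)
  have iW : Integrable (fun x => ‖W x‖ ^ 2) volume := lW.integrable_norm_pow (by norm_num)
  set e : Euc d → ℝ := fun x => ‖g x‖ ^ 2 + lam * ‖u x‖ ^ 2 with he
  have e0 : ∀ x, 0 ≤ e x := fun x => by rw [he]; positivity
  have ie : Integrable e := ig.add (iu.const_mul lam)
  have hχb : ∀ x, ‖χ x‖ ≤ 1 := fun x => by rw [Real.norm_eq_abs, abs_of_nonneg (h0 x)]; exact h1 x
  have i1 : Integrable fun x => χ x * e (x + h) :=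
    (ie.comp_add_right h).bdd_mul ht.1.continuous.aestronglyMeasurable (Eventually.of_forall hχb)
  have i2 : Integrable fun x => χ x * e x :=
    ie.bdd_mul ht.1.continuous.aestronglyMeasurable (Eventually.of_forall hχb)
  have i1' : Integrable fun x => χ (x - h) * e x := by
    have := i1.comp_sub_right h
    simpa using this
  -- shift term
  have hshift : ∫ x, (χ x * e (x + h) - χ x * e x) ≤ L * ‖h‖ * ∫ x in HB i0 r', e x := by
    rw [integral_sub i1 i2]
    have : ∫ x, χ x * e (x + h) = ∫ x, χ (x - h) * e x := by
      rw [← integral_add_right_eq_self (fun x => χ (x - h) * e x) h]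
      simp
    rw [this, ← integral_sub i1' i2, ← integral_indicator (HB_meas _ _), ← integral_const_mul]
    refine integral_mono (i1'.sub i2) ((ie.indicator (HB_meas _ _)).const_mul _) fun x => ?_
    simp only
    by_cases hx : x ∈ HB i0 r'
    · rw [indicator_of_mem hx]
      have h6 := h5 (x - h) x
      rw [sub_sub_cancel_left, norm_neg] at h6
      have h7 := (le_abs_self _).trans h6
      nlinarith [e0 x]
    · rw [indicator_of_notMem hx, mul_zero]
      by_cases hx0 : x i0 ≤ 0
      · have : e x = 0 := by rw [he]; simp [s.zu x hx0, s.zg x hx0]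
        simp [this]
      · have hxb : x ∉ ball (0 : Euc d) r' := fun hb => hx ⟨hb, not_le.1 hx0⟩
        have hz1 : χ x = 0 := image_eq_zero_of_notMem_tsupport fun hm =>
          hxb (ball_subset_ball hr1r (h3 hm))
        have hz2 : χ (x - h) = 0 := image_eq_zero_of_notMem_tsupport fun hm => by
          have := h3 hm
          apply hxb
          rw [mem_ball_zero_iff] at this ⊢
          have h8 := norm_le_norm_sub_add x h
          linarith
        rw [hz1, hz2]; simp
  have hwle : ∫ x in HB i0 r1, ‖w x‖ ^ 2 ≤ 4 * ‖h‖ ^ 2 * ∫ x in HB i0 r', ‖g x‖ ^ 2 := by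
    have := dlu s.ap s.mu s.mg hi hr1'
    rw [Q_le_ofReal lw, Q_le_ofReal s.lg, ← ofReal_norm, ← ENNReal.ofReal_pow (norm_nonneg _),
      show (4 : ℝ≥0∞) = ENNReal.ofReal 4 by simp, ← ENNReal.ofReal_mul (by positivity),
      ← ENNReal.ofReal_mul (by positivity)] at this
    refine (ENNReal.ofReal_le_ofReal_iff ?_).1 this
    exact mul_nonneg (by positivity) (integral_nonneg fun x => by positivity)
  have hge : ∫ x in HB i0 r1, ‖g x‖ ^ 2 ≤ ∫ x in HB i0 r', e x := by
    refine (setIntegral_mono_set ig.integrableOn (Eventually.of_forall fun x => by simp) 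
      (HB_mono i0 hr1r).eventuallyLE).trans ?_
    refine integral_mono ig.integrableOn ie.integrableOn fun x => ?_
    simp only [he]
    have : 0 ≤ lam * ‖u x‖ ^ 2 := by positivity
    linarith
  have hge' : ∫ x in HB i0 r', ‖g x‖ ^ 2 ≤ ∫ x in HB i0 r', e x := by
    refine integral_mono ig.integrableOn ie.integrableOn fun x => ?_
    simp only [he]
    have : 0 ≤ lam * ‖u x‖ ^ 2 := by positivity
    linarith
  have key : ∫ x in HB i0 r, (‖W x‖ ^ 2 + lam * ‖w x‖ ^ 2) ≤
      6 * L * ‖h‖ * ∫ x in HB i0 r', e x := by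
    have J1 := iw.indicator (HB_meas i0 r1)
    have J2 := ig.indicator (HB_meas i0 r1)
    calc _ = ∫ x, (HB i0 r).indicator (fun x => ‖W x‖ ^ 2 + lam * ‖w x‖ ^ 2) x := by
          rw [← integral_indicator (HB_meas _ _)]
      _ ≤ ∫ x, ((-2) * (χ x * ((inner ℝ (g x) (W x) : ℝ) + lam * u x * w x)
      + w x * (inner ℝ (g x) (gradVec χ x) : ℝ)) + (χ x * e (x + h) - χ x * e x) + 
        (L * ‖h‖⁻¹ * (HB i0 r1).indicator (fun x => ‖w x‖ ^ 2) x + 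
          L * ‖h‖ * (HB i0 r1).indicator (fun x => ‖g x‖ ^ 2) x)) := by
          refine integral_mono ((iW.add (iw.const_mul lam)).indicator (HB_meas _ _))
            (((hB.const_mul (-2)).add (i1.sub i2)).add ((J1.const_mul _).add (J2.const_mul _)))
            fun x => ?_
          simp only
          have hLHS : (HB i0 r).indicator (fun x => ‖W x‖ ^ 2 + lam * ‖w x‖ ^ 2) x ≤
              χ x * (‖W x‖ ^ 2 + lam * ‖w x‖ ^ 2) := by
            by_cases hx : x ∈ HB i0 r
            · rw [indicator_of_mem hx, h2 x hx.1, one_mul]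
            · rw [indicator_of_notMem hx]
              have := h0 x
              positivity
          refine hLHS.trans ?_
          have hid : χ x * (‖W x‖ ^ 2 + lam * ‖w x‖ ^ 2) =
            (-2) * (χ x * ((inner ℝ (g x) (W x) : ℝ) + lam * u x * w x)) + 
              (χ x * e (x + h) - χ x * e x) := by
            have e1 : ‖g (x + h)‖ ^ 2 = ‖g x‖ ^ 2 + 2 * (inner ℝ (g x) (W x) : ℝ) + ‖W x‖ ^ 2 := by
              have : g (x + h) = g x + W x := by simp [hW, dl]
              rw [this, norm_add_sq_real]
            have e2 : ‖u (x + h)‖ ^ 2 = (u x + w x) ^ 2 := by simp [hw, dl]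
            have e3 : ‖u x‖ ^ 2 = u x ^ 2 := by simp
            have e4 : ‖w x‖ ^ 2 = w x ^ 2 := by simp
            simp only [he]
            rw [e1, e2, e3, e4]
            ring
          rw [hid]
          have hcs : 2 * (w x * (inner ℝ (g x) (gradVec χ x) : ℝ)) ≤
            L * ‖h‖⁻¹ * (HB i0 r1).indicator (fun x => ‖w x‖ ^ 2) x + 
          L * ‖h‖ * (HB i0 r1).indicator (fun x => ‖g x‖ ^ 2) x := by
            by_cases hx : x ∈ HB i0 r1
            · rw [indicator_of_mem hx, indicator_of_mem hx]
              have h6 : |(inner ℝ (g x) (gradVec χ x) : ℝ)| ≤ ‖g x‖ * L :=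
                (abs_real_inner_le_norm _ _).trans (by gcongr; exact h4 x)
              have h7 : w x * (inner ℝ (g x) (gradVec χ x) : ℝ) ≤ ‖w x‖ * (‖g x‖ * L) := by
                refine (le_abs_self _).trans ?_
                rw [abs_mul]
                gcongr
                exact le_of_eq (Real.norm_eq_abs _).symm
              have h8 : 2 * (‖w x‖ * ‖g x‖) ≤ ‖h‖⁻¹ * ‖w x‖ ^ 2 + ‖h‖ * ‖g x‖ ^ 2 := by
                have h9 := mul_nonneg (inv_pos.2 hpos).le (sq_nonneg (‖w x‖ - ‖h‖ * ‖g x‖))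
                have h10 : ‖h‖⁻¹ * (‖w x‖ - ‖h‖ * ‖g x‖) ^ 2 =
                  ‖h‖⁻¹ * ‖w x‖ ^ 2 + ‖h‖ * ‖g x‖ ^ 2 - 2 * (‖w x‖ * ‖g x‖) := by
                  field_simp
                  ring
                linarith
              nlinarith
            · have hz : w x * (inner ℝ (g x) (gradVec χ x) : ℝ) = 0 := by
                by_cases hx0 : x i0 ≤ 0
                · simp [s.zg x hx0]
                · rw [gradVec_zero_of_notMem fun hm => hx ⟨h3 hm, not_le.1 hx0⟩]
                  simp
              rw [hz, indicator_of_notMem hx, indicator_of_notMem hx]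
              simp
          linarith
      _ = (∫ x, (χ x * e (x + h) - χ x * e x)) + (L * ‖h‖⁻¹ * (∫ x in HB i0 r1, ‖w x‖ ^ 2) +
            L * ‖h‖ * ∫ x in HB i0 r1, ‖g x‖ ^ 2) := by
          refine (int4 hB (i1.sub i2) J1 J2 _ _).trans ?_
          rw [hB0, integral_indicator (HB_meas _ _), integral_indicator (HB_meas _ _)]
          simp
      _ ≤ L * ‖h‖ * (∫ x in HB i0 r', e x) + (L * ‖h‖⁻¹ * (4 * ‖h‖ ^ 2 * ∫ x in HB i0 r', e x) +
            L * ‖h‖ * ∫ x in HB i0 r', e x) := by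
          gcongr
          refine hwle.trans ?_
          gcongr
      _ = _ := by field_simp; ring
  rw [En_eq hl lw lW, En_eq hl s.lu s.lg]
  refine (ENNReal.ofReal_le_ofReal key).trans (le_of_eq ?_)
  rw [ENNReal.ofReal_mul (by positivity), ENNReal.ofReal_mul (by positivity), ofReal_norm]
  rfl

end sav
end RH
end

section
open Set Filter MeasureTheory Metric Topology
open scoped ENNReal NNReal

namespace RH
section tang
variable {d : ℕ}

/-- cone condition for the Dirichlet set -/
def Cone (i0 : Fin d) (K : ℝ) (e : Euc d) (D : Set (Euc d)) : Prop :=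
  ‖e‖ ≤ 1 ∧ e i0 = 0 ∧ ∀ (h : Euc d) (t : ℝ), h i0 = 0 → K * ‖h‖ ≤ t → ∀ x ∈ D, x + (h + t • e) ∈ D

lemma Q_dl_split {F : Type*} [NormedAddCommGroup F] [MeasurableSpace F] [BorelSpace F]
    [SecondCountableTopology F] {i0 : Fin d} {r r' : ℝ} {f : Euc d → F} (hf : Measurable f)
    {h b : Euc d} (hb : b i0 = 0) (hr : r + ‖b‖ ≤ r') :
    Q (HB i0 r) (dl h f) ≤ 2 * Q (HB i0 r') (dl (h + b) f) + 2 * Q (HB i0 r') (dl b f) := by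
  have e : dl h f = fun x => dl (h + b) f (x + (-b)) - dl b f (x + (-b)) := by
    funext x
    simp only [dl]
    rw [show x + -b + (h + b) = x + h by abel, show x + -b + b = x by abel]
    abel
  have hs : ∀ x ∈ HB i0 r, x + (-b) ∈ HB i0 r' := HB_shift (by simp [hb]) (by simpa using hr)
  rw [e]
  have hm := meas_dl hf (h + b)
  refine (Q_sub_le (by fun_prop)).trans ?_
  gcongr
  · exact Q_shift (HB_meas _ _) (HB_meas _ _) _ hs (dl (h + b) f)
  · exact Q_shift (HB_meas _ _) (HB_meas _ _) _ hs (dl b f)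

lemma En_dl_split {i0 : Fin d} {r r' lam : ℝ} {u : Euc d → ℝ} {g : Euc d → Euc d}
    (mu : Measurable u) (mg : Measurable g)
    {h b : Euc d} (hb : b i0 = 0) (hr : r + ‖b‖ ≤ r') :
    En i0 lam r (dl h u) (dl h g) ≤ 2 * En i0 lam r' (dl (h + b) u) (dl (h + b) g) +
      2 * En i0 lam r' (dl b u) (dl b g) := by
  have h1 := Q_dl_split mg (h := h) hb hr
  have h2 := Q_dl_split mu (h := h) hb hr
  unfold En
  calc _ ≤ (2 * Q (HB i0 r') (dl (h + b) g) + 2 * Q (HB i0 r') (dl b g)) +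
      ENNReal.ofReal lam * (2 * Q (HB i0 r') (dl (h + b) u) + 2 * Q (HB i0 r') (dl b u)) := by
        gcongr
    _ = _ := by ring

/-- tangential differences -/
lemma tang {r r' : ℝ} (hr : 0 < r) (hrr : r < r') {K : ℝ} (hK : 0 ≤ K) : ∃ C : ℝ≥0,
    ∀ (i0 : Fin d) (e : Euc d) (D : Set (Euc d)), Cone i0 K e D → ∀
    (lam : ℝ) (u : Euc d → ℝ) (g : Euc d → Euc d), 0 ≤ lam → Sol i0 D lam r' u g →
    ∀ h : Euc d, h i0 = 0 → ‖h‖ ≤ (r' - r) / (4 * (K + 1)) →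
    En i0 lam r (dl h u) (dl h g) ≤ C * ‖h‖ₑ * En i0 lam r' u g := by
  obtain ⟨C, hC⟩ := sav (d := d) (r := (r + r') / 2) (r' := r') (by linarith) (by linarith)
  refine ⟨2 * C * (K + 1).toNNReal + 2 * C * (K + 1).toNNReal,
    fun i0 e D hD lam u g hl s h h0 hh => ?_⟩
  obtain ⟨he1, he0, hc⟩ := hD
  have hh' : ‖h‖ * (4 * (K + 1)) ≤ r' - r := by rwa [le_div_iff₀ (by positivity)] at hh
  set b : Euc d := (K * ‖h‖) • e with hb
  have hbn : ‖b‖ ≤ K * ‖h‖ := by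
    rw [hb, norm_smul, Real.norm_of_nonneg (by positivity)]
    exact mul_le_of_le_one_right (by positivity) he1
  have hb0 : b i0 = 0 := by simp [hb, he0]
  have hn := norm_nonneg h
  have han : ‖h + b‖ ≤ (K + 1) * ‖h‖ := (norm_add_le _ _).trans (by linarith)
  have hbn' : ‖b‖ ≤ (K + 1) * ‖h‖ := by linarith
  have h1 := hC i0 D lam u g hl s (h + b) (by simp [h0, hb0]) (hc h _ h0 le_rfl)
    (by nlinarith)
  have h2 := hC i0 D lam u g hl s b hb0 (by
    have := hc 0 (K * ‖h‖) (by simp) (by simp; positivity)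
    simpa using this) (by nlinarith)
  refine (En_dl_split s.mu s.mg hb0 (r' := (r + r') / 2) (by nlinarith)).trans ?_
  have conv : ∀ v : Euc d, ‖v‖ ≤ (K + 1) * ‖h‖ → ‖v‖ₑ ≤ (K + 1).toNNReal * ‖h‖ₑ := by
    intro v hv
    rw [← ofReal_norm, ← ofReal_norm]
    refine (ENNReal.ofReal_le_ofReal hv).trans ?_
    rw [ENNReal.ofReal_mul (by positivity)]
    rfl
  calc _ ≤ 2 * (C * ((K + 1).toNNReal * ‖h‖ₑ) * En i0 lam r' u g) +
      2 * (C * ((K + 1).toNNReal * ‖h‖ₑ) * En i0 lam r' u g) := by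
        gcongr
        · exact h1.trans (by gcongr; exact conv _ han)
        · exact h2.trans (by gcongr; exact conv _ hbn')
    _ = _ := by push_cast; ring

lemma Sol.dly {i0 : Fin d} {D : Set (Euc d)} {lam r r' : ℝ} {u : Euc d → ℝ} {g : Euc d → Euc d}
    (s : Sol i0 D lam r' u g) {h : Euc d} (h0 : h i0 = 0) (hD : ∀ x ∈ D, x + h ∈ D)
    (hD' : ∀ x ∈ D, x - h ∈ D) (hr : r + ‖h‖ ≤ r') : Sol i0 D lam r (dl h u) (dl h g) := by
  refine ⟨meas_dl s.mu h, meas_dl s.mg h, memLp_dl s.lu h, memLp_dl s.lg h, fun x hx => ?_,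
    fun x hx => ?_, s.ap.dl s.mu s.mg h0 hD hr, fun ζ hζ hs hz => ?_⟩
  · simp only [dl]; rw [s.zu x hx, s.zu (x + h) (by simpa [h0] using hx), sub_zero]
  · simp only [dl]; rw [s.zg x hx, s.zg (x + h) (by simpa [h0] using hx), sub_zero]
  have hrr : r ≤ r' := by linarith [norm_nonneg h]
  have e1 := s.eq ζ hζ (hs.trans (ball_subset_ball hrr)) hz
  have hζ' := isTest_shift hζ (-h)
  have hts : tsupport (fun x => ζ (x + -h)) ⊆ ball 0 r' := by
    have : tsupport (fun x => ζ (x + -h)) = (Homeomorph.addRight (-h)) ⁻¹' tsupport ζ :=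
      tsupport_comp_eq_preimage ζ (Homeomorph.addRight (-h))
    rw [this]
    intro x hx
    have hx := hs hx
    rw [mem_ball_zero_iff] at hx ⊢
    have hx : ‖x + -h‖ < r := hx
    have h8 := norm_le_norm_sub_add x h
    rw [sub_eq_add_neg] at h8
    linarith
  have e2 := s.eq _ hζ' hts (fun x hx => hz _ (by simpa [sub_eq_add_neg] using hD' x hx))
  simp only [gradVec_shift] at e2
  rw [← integral_add_right_eq_self _ h] at e2
  simp only [add_neg_cancel_right] at e2
  have int : ∀ {u : Euc d → ℝ} {g : Euc d → Euc d}, MemLp u 2 volume → MemLp g 2 volume →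
      Integrable fun x => (inner ℝ (g x) (gradVec ζ x) : ℝ) + lam * u x * ζ x := by
    intro u g lu lg
    refine Integrable.add ?_ ?_
    · refine Integrable.mono (g := fun x => ‖g x‖ * ‖gradVec ζ x‖) ?_
        (lg.1.inner (continuous_gradVec hζ.1).aestronglyMeasurable) ?_
      · exact MemLp.integrable_mul (p := 2) (q := 2) lg.norm (isTest_memLp_grad hζ 2).norm
      · refine Eventually.of_forall fun x => ?_
        rw [norm_mul, norm_norm, norm_norm]
        exact norm_inner_le_norm _ _
    · exact MemLp.integrable_mul (p := 2) (q := 2) (lu.const_mul lam) (isTest_memLp hζ 2)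
  have := integral_sub (int (memLp_shift s.lu h) (memLp_shift s.lg h)) (int s.lu s.lg)
  rw [e1, e2, sub_zero] at this
  rw [← this]
  refine integral_congr_ae (Eventually.of_forall fun x => ?_)
  simp only [dl, inner_sub_left]
  ring

lemma gradVec_const_mul {ζ : Euc d → ℝ} (hζ : ContDiff ℝ (⊤ : ℕ∞) ζ) (c : ℝ)
    (x : Euc d) : gradVec (fun y => c * ζ y) x = c • gradVec ζ x := by
  simp only [gradVec_eq]
  rw [fderiv_const_mul (hζ.differentiable (by simp) x), map_smul]

lemma Sol.smul {i0 : Fin d} {D : Set (Euc d)} {lam r : ℝ} {u : Euc d → ℝ} {g : Euc d → Euc d}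
    (s : Sol i0 D lam r u g) (c : ℝ) : Sol i0 D lam r (fun x => c * u x) (fun x => c • g x) := by
  refine ⟨s.mu.const_mul c, s.mg.const_smul c, s.lu.const_mul c, s.lg.const_smul c,
    fun x hx => by simp [s.zu x hx], fun x hx => by simp [s.zg x hx], ?_, fun ζ hζ hs hz => ?_⟩
  · obtain ⟨un, h1, h2, h3⟩ := s.ap
    refine ⟨fun n x => c * un n x, fun n => ⟨⟨contDiff_const.mul (h1 n).1.1, (h1 n).1.2.mul_left⟩,
      fun x hx => by simp [(h1 n).2 x hx]⟩, ?_, ?_⟩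
    · have := ENNReal.Tendsto.const_mul (a := ENNReal.ofReal (c ^ 2)) h2 (Or.inr (by simp))
      rw [mul_zero] at this
      refine this.congr fun n => ?_
      rw [← Q_mul]
      simp only [mul_sub]
    · have := ENNReal.Tendsto.const_mul (a := ENNReal.ofReal (c ^ 2)) h3 (Or.inr (by simp))
      rw [mul_zero] at this
      refine this.congr fun n => ?_
      rw [← Q_smul]
      simp only [smul_sub, gradVec_const_mul (h1 n).1.1]
  · have := congrArg (fun t => c * t) (s.eq ζ hζ hs hz)
    simp only [mul_zero] at this
    rw [← integral_const_mul] at this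
    rw [← this]
    refine integral_congr_ae (Eventually.of_forall fun x => ?_)
    simp only [real_inner_smul_left]
    ring

lemma En_smul (i0 : Fin d) (lam r c : ℝ) (u : Euc d → ℝ) (g : Euc d → Euc d) :
    En i0 lam r (fun x => c * u x) (fun x => c • g x) = ENNReal.ofReal (c ^ 2) * En i0 lam r u g := by
  unfold En
  rw [Q_mul, Q_smul]
  ring

/-- smooth directions -/
lemma ydiff {r r' : ℝ} (hr : 0 < r) (hrr : r < r') : ∃ C : ℝ≥0, ∀ (i0 : Fin d) (D : Set (Euc d))
    (lam : ℝ) (u : Euc d → ℝ) (g : Euc d → Euc d), 0 ≤ lam → Sol i0 D lam r' u g →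
    ∀ h : Euc d, h i0 = 0 → (∀ x ∈ D, x + h ∈ D) → (∀ x ∈ D, x - h ∈ D) → ‖h‖ ≤ (r' - r) / 2 →
    En i0 lam r (dl h u) (dl h g) ≤ C * ‖h‖ₑ ^ 2 * En i0 lam r' u g := by
  obtain ⟨C, hC⟩ := cacc (d := d) (r := r) (r' := (r + r') / 2) hr (by linarith)
  refine ⟨C * 4, fun i0 D lam u g hl s h h0 hD hD' hh => ?_⟩
  have s' := s.dly h0 hD hD' (r := (r + r') / 2) (by linarith)
  refine (hC i0 D lam _ _ hl s').trans ?_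
  have := dlu s.ap s.mu s.mg h0 (r := (r + r') / 2) (by linarith)
  calc _ ≤ C * (4 * ‖h‖ₑ ^ 2 * Q (HB i0 r') g) := by gcongr
    _ ≤ C * (4 * ‖h‖ₑ ^ 2 * En i0 lam r' u g) := by gcongr; exact Q_le_En ..
    _ = _ := by push_cast; ring

lemma lamE {r r' : ℝ} (hr : 0 < r) (hrr : r < r') : ∃ C : ℝ≥0, ∀ (i0 : Fin d) (D : Set (Euc d))
    (lam : ℝ) (u : Euc d → ℝ) (g : Euc d → Euc d), 0 ≤ lam → Sol i0 D lam r' u g →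
    ENNReal.ofReal lam * En i0 lam r u g ≤ C * En i0 lam r' u g := by
  obtain ⟨C, hC⟩ := cacc (d := d) hr hrr
  refine ⟨C, fun i0 D lam u g hl s => ?_⟩
  calc _ ≤ ENNReal.ofReal lam * (C * Q (HB i0 r') u) := by gcongr; exact hC i0 D lam u g hl s
    _ = C * (ENNReal.ofReal lam * Q (HB i0 r') u) := by ring
    _ ≤ _ := by gcongr; exact le_add_self

end tang
end RH
end

section
open Set Filter MeasureTheory Metric Topology
open scoped ENNReal NNReal Convolution

namespace RH
section moll
variable {d : ℕ}

lemma inner_single' (v : Euc d) (i : Fin d) (c : ℝ) :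
    (inner ℝ (c • EuclideanSpace.single i (1:ℝ)) v : ℝ) = c * v i := by
  rw [real_inner_smul_left, EuclideanSpace.inner_single_left]; simp

lemma pder_continuous {ζ : Euc d → ℝ} (h : ContDiff ℝ (⊤ : ℕ∞) ζ) (i : Fin d) :
    Continuous (pder i ζ) := (h.continuous_fderiv (by simp)).clm_apply continuous_const

lemma pder_hasCompactSupport {ζ : Euc d → ℝ} (h : HasCompactSupport ζ) (i : Fin d) :
    HasCompactSupport (pder i ζ) :=
  (h.fderiv ℝ).comp_left (g := fun L : Euc d →L[ℝ] ℝ => L (EuclideanSpace.single i 1)) (by simp)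

lemma pder_zero_of_notMem {ζ : Euc d → ℝ} {x : Euc d} (h : x ∉ tsupport ζ) (i : Fin d) :
    pder i ζ x = 0 := by
  rw [← gradVec_apply, gradVec_zero_of_notMem h]; rfl

lemma coord_memLp {g : Euc d → Euc d} (hg : MemLp g 2 volume) (i : Fin d) :
    MemLp (fun x => g x i) 2 volume := by
  refine hg.mono ((EuclideanSpace.proj (𝕜 := ℝ) i).continuous.comp_aestronglyMeasurable hg.1)
    (Eventually.of_forall fun x => ?_)
  exact PiLp.norm_apply_le (g x) i

lemma Q_coord_le (A : Set (Euc d)) (g : Euc d → Euc d) (i : Fin d) :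
    Q A (fun x => g x i) ≤ Q A g := by
  unfold Q
  refine lintegral_mono fun x => ?_
  gcongr
  exact enorm_le_iff_norm_le.2 (PiLp.norm_apply_le (g x) i)

lemma Sol.wg {i0 : Fin d} {D : Set (Euc d)} {lam r : ℝ} {u : Euc d → ℝ} {g : Euc d → Euc d}
    (s : Sol i0 D lam r u g) (i : Fin d) {ζ : Euc d → ℝ} (hζ : IsTest ζ) (hs : tsupport ζ ⊆ HB i0 r) :
    ∫ x, u x * pder i ζ x = - ∫ x, g x i * ζ x := by
  obtain ⟨un, h1, h2, h3⟩ := s.ap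
  have hp : MemLp (pder i ζ) 2 volume :=
    (pder_continuous hζ.1 i).memLp_of_hasCompactSupport (pder_hasCompactSupport hζ.2 i)
  have l1 := tendsto_inner (HB_meas i0 r) hp
    (fun x hx => pder_zero_of_notMem (fun h => hx (hs h)) i) s.lu (fun n => isTest_memLp (h1 n).1 2) h2
  have l2 := tendsto_inner (HB_meas i0 r) (G := fun x => ζ x • EuclideanSpace.single i (1:ℝ))
    ((hζ.1.continuous.smul continuous_const).memLp_of_hasCompactSupport hζ.2.smul_right)
    (fun x hx => by rw [image_eq_zero_of_notMem_tsupport (fun h => hx (hs h)), zero_smul]) s.lg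
    (fun n => isTest_memLp_grad (h1 n).1 2) h3
  have hz : ∀ n, (∫ x, (inner ℝ (pder i ζ x) (un n x) : ℝ)) =
      - ∫ x, (inner ℝ (ζ x • EuclideanSpace.single i (1:ℝ)) (gradVec (un n) x) : ℝ) := by
    intro n
    have hd1 := (h1 n).1.1.differentiable (by simp)
    have hd2 := hζ.1.differentiable (by simp)
    have := integral_mul_fderiv_eq_neg_fderiv_mul_of_integrable (𝕜 := ℝ) (μ := volume)
      (f := un n) (g := ζ)
      (v := EuclideanSpace.single i 1) ?_ ?_ ?_ (fun x _ => hd1 x) (fun x _ => hd2 x)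
    · calc _ = ∫ x, un n x * fderiv ℝ ζ x (EuclideanSpace.single i 1) := rfl
        _ = _ := this
        _ = _ := by
          congr 1
          refine integral_congr_ae (Eventually.of_forall fun x => ?_)
          simp only [inner_single', gradVec_apply]
          rw [mul_comm]; rfl
    · exact (((pder_continuous (h1 n).1.1 i).mul hζ.1.continuous).integrable_of_hasCompactSupport
        hζ.2.mul_left)
    · exact ((((h1 n).1.1.continuous).mul (pder_continuous hζ.1 i)).integrable_of_hasCompactSupport
        (h1 n).1.2.mul_right)
    · exact ((((h1 n).1.1.continuous).mul hζ.1.continuous).integrable_of_hasCompactSupport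
        (h1 n).1.2.mul_right)
  simp only [hz] at l1
  have := tendsto_nhds_unique l1 l2.neg
  calc _ = ∫ x, (inner ℝ (pder i ζ x) (u x) : ℝ) := rfl
    _ = _ := this
    _ = _ := by
      congr 1
      refine integral_congr_ae (Eventually.of_forall fun x => ?_)
      simp only [inner_single']
      rw [mul_comm]

/-- mollification -/
noncomputable def moll (φ : ContDiffBump (0 : Euc d)) (f : Euc d → ℝ) (x : Euc d) : ℝ :=
  ∫ t, φ.normed volume t * f (x - t)

lemma moll_eq_conv (φ : ContDiffBump (0 : Euc d)) (f : Euc d → ℝ) :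
    moll φ f = (φ.normed volume ⋆[ContinuousLinearMap.mul ℝ ℝ, volume] f) := by
  funext x
  simp [moll, convolution_def]

lemma moll_contDiff (φ : ContDiffBump (0 : Euc d)) {f : Euc d → ℝ} (hf : MemLp f 2 volume) :
    ContDiff ℝ (⊤ : ℕ∞) (moll φ f) := by
  rw [moll_eq_conv]
  exact φ.hasCompactSupport_normed.contDiff_convolution_left _ φ.contDiff_normed
    (hf.locallyIntegrable (by norm_num))

lemma isTest_normed (φ : ContDiffBump (0 : Euc d)) : IsTest (φ.normed volume) :=
  ⟨φ.contDiff_normed, φ.hasCompactSupport_normed⟩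

lemma pder_moll (φ : ContDiffBump (0 : Euc d)) {f : Euc d → ℝ} (hf : MemLp f 2 volume) (i : Fin d)
    (x : Euc d) : pder i (moll φ f) x = ∫ t, pder i (φ.normed volume) t * f (x - t) := by
  have h := (φ.hasCompactSupport_normed (μ := volume)).hasFDerivAt_convolution_left (μ := volume) (ContinuousLinearMap.mul ℝ ℝ)
    (φ.contDiff_normed (n := 1) (μ := volume)) (hf.locallyIntegrable (by norm_num)) x
  rw [← moll_eq_conv] at h
  unfold pder
  rw [h.fderiv, convolution_def, ContinuousLinearMap.integral_apply]
  · rfl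
  · have h1 := (φ.hasCompactSupport_normed (μ := volume)).fderiv ℝ
    have h2 := (φ.contDiff_normed (n := 1) (μ := volume)).continuous_fderiv (by simp)
    exact (h1.convolutionExists_left _ h2 (hf.locallyIntegrable (by norm_num))) x

/-- the reflected, translated kernel -/
lemma kern_test (φ : ContDiffBump (0 : Euc d)) (x : Euc d) :
    IsTest (fun z => φ.normed volume (x - z)) := by
  refine ⟨(isTest_normed φ).1.comp (contDiff_const.sub contDiff_id), ?_⟩
  exact (isTest_normed φ).2.comp_homeomorph (Homeomorph.subLeft x)

lemma kern_supp (φ : ContDiffBump (0 : Euc d)) (x : Euc d) :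
    tsupport (fun z => φ.normed volume (x - z)) ⊆ closedBall x φ.rOut := by
  have : tsupport (fun z => φ.normed volume (x - z)) =
    (Homeomorph.subLeft x) ⁻¹' tsupport (φ.normed volume) :=
      tsupport_comp_eq_preimage (φ.normed volume) (Homeomorph.subLeft x)
  rw [this, φ.tsupport_normed_eq]
  intro z hz
  have hz : x - z ∈ closedBall (0 : Euc d) φ.rOut := hz
  rw [mem_closedBall_zero_iff] at hz
  rw [mem_closedBall, dist_comm, dist_eq_norm]
  exact hz

lemma kern_pder (φ : ContDiffBump (0 : Euc d)) (x z : Euc d) (i : Fin d) :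
    pder i (fun z => φ.normed volume (x - z)) z = - pder i (φ.normed volume) (x - z) := by
  unfold pder
  have h1 : HasFDerivAt (φ.normed volume) (fderiv ℝ (φ.normed volume) (x - z)) (x - z) :=
    ((isTest_normed φ).1.differentiable (by simp) _).hasFDerivAt
  have h2 : HasFDerivAt (fun z : Euc d => x - z) (-(ContinuousLinearMap.id ℝ (Euc d))) z :=
    (hasFDerivAt_id z).const_sub x
  have := h1.comp z h2
  rw [HasFDerivAt.fderiv (f := fun z => φ.normed volume (x - z)) this]
  simp

/-- upper part of a ball -/
def AB (i0 : Fin d) (σ r : ℝ) : Set (Euc d) := ball (0 : Euc d) r ∩ {x | σ < x i0}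

lemma AB_meas (i0 : Fin d) (σ r : ℝ) : MeasurableSet (AB i0 σ r) :=
  measurableSet_ball.inter (measurableSet_lt measurable_const (measurable_coord i0))

lemma AB_mono (i0 : Fin d) (σ : ℝ) {r r' : ℝ} (h : r ≤ r') : AB i0 σ r ⊆ AB i0 σ r' :=
  inter_subset_inter_left _ (ball_subset_ball h)

lemma AB_shift {i0 : Fin d} {σ r r' : ℝ} {h : Euc d} (h0 : 0 ≤ h i0) (hr : r + ‖h‖ ≤ r') :
    ∀ x ∈ AB i0 σ r, x + h ∈ AB i0 σ r' := by
  rintro x ⟨hx1, hx2⟩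
  refine ⟨?_, ?_⟩
  · rw [mem_ball_zero_iff] at hx1 ⊢
    exact (norm_add_le _ _).trans_lt (by linarith)
  · show σ < (x + h) i0
    have : σ < x i0 := hx2
    simp only [PiLp.add_apply]
    linarith

lemma AB_ball {i0 : Fin d} {σ r r' : ℝ} (hr : r + σ ≤ r') {x y : Euc d} (hx : x ∈ AB i0 σ r)
    (hy : y ∈ closedBall x σ) : y ∈ HB i0 r' := by
  obtain ⟨hx1, hx2⟩ := hx
  have hx2 : σ < x i0 := hx2
  rw [mem_closedBall, dist_eq_norm] at hy
  rw [mem_ball_zero_iff] at hx1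
  refine ⟨?_, ?_⟩
  · rw [mem_ball_zero_iff]
    have := norm_le_norm_sub_add y x
    linarith
  · show 0 < y i0
    have h1 := (PiLp.norm_apply_le (y - x) i0).trans hy
    rw [Real.norm_eq_abs] at h1
    have h2 := (abs_le.1 h1).1
    simp only [PiLp.sub_apply] at h2
    linarith

lemma Sol.moll_grad {i0 : Fin d} {D : Set (Euc d)} {lam r r' : ℝ} {u : Euc d → ℝ} {g : Euc d → Euc d}
    (s : Sol i0 D lam r' u g) (φ : ContDiffBump (0 : Euc d)) (hr : r + φ.rOut ≤ r') (i : Fin d)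
    {x : Euc d} (hx : x ∈ AB i0 φ.rOut r) :
    pder i (moll φ u) x = moll φ (fun y => g y i) x := by
  rw [pder_moll φ s.lu]
  have h1 := s.wg i (kern_test φ x) ((kern_supp φ x).trans fun y hy => AB_ball hr hx hy)
  simp only [kern_pder] at h1
  unfold moll
  rw [← integral_sub_left_eq_self _ volume x, ← integral_sub_left_eq_self (fun t => φ.normed volume t * _) volume x]
  simp only [sub_sub_cancel]
  simp only [mul_neg, integral_neg, neg_inj] at h1
  simp only [mul_comm] at h1 ⊢
  exact h1

lemma Sol.moll_div {i0 : Fin d} {D : Set (Euc d)} {lam r r' : ℝ} {u : Euc d → ℝ} {g : Euc d → Euc d}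
    (s : Sol i0 D lam r' u g) (hD : ∀ x ∈ D, x i0 = 0)
    (φ : ContDiffBump (0 : Euc d)) (hr : r + φ.rOut ≤ r')
    {x : Euc d} (hx : x ∈ AB i0 φ.rOut r) :
    ∑ i, pder i (moll φ (fun y => g y i)) x = lam * moll φ u x := by
  have hsup : tsupport (fun z => φ.normed volume (x - z)) ⊆ HB i0 r' :=
    (kern_supp φ x).trans fun y hy => AB_ball hr hx hy
  have hk := kern_test φ x
  have h1 := s.eq _ hk (hsup.trans inter_subset_left) (fun y hy => by
    refine image_eq_zero_of_notMem_tsupport (f := fun z => φ.normed volume (x - z)) fun h => ?_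
    have : 0 < y i0 := (hsup h).2
    rw [hD y hy] at this
    exact lt_irrefl _ this)
  have hcoord : ∀ i, Integrable fun z => g z i * pder i (fun z => φ.normed volume (x - z)) z := fun i =>
    MemLp.integrable_mul (p := 2) (q := 2) (coord_memLp s.lg i)
      ((pder_continuous hk.1 i).memLp_of_hasCompactSupport (pder_hasCompactSupport hk.2 i))
  have hu : Integrable fun z => lam * u z * φ.normed volume (x - z) :=
    MemLp.integrable_mul (p := 2) (q := 2) (s.lu.const_mul lam) (isTest_memLp hk 2)
  have e1 : ∀ z, (inner ℝ (g z) (gradVec (fun z => φ.normed volume (x - z)) z) : ℝ) =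
      ∑ i, g z i * pder i (fun z => φ.normed volume (x - z)) z := by
    intro z
    rw [PiLp.inner_apply]
    refine Finset.sum_congr rfl fun i _ => ?_
    rw [gradVec_apply]
    exact mul_comm _ _
  simp only [e1] at h1
  rw [integral_add (integrable_finsetSum _ fun i _ => hcoord i) hu,
    integral_finsetSum _ fun i _ => hcoord i] at h1
  have e2 : ∀ i, pder i (moll φ (fun y => g y i)) x =
      - ∫ z, g z i * pder i (fun z => φ.normed volume (x - z)) z := by
    intro i
    rw [pder_moll φ (coord_memLp s.lg i), ← integral_sub_left_eq_self _ volume x, ← integral_neg]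
    refine integral_congr_ae (Eventually.of_forall fun z => ?_)
    simp only [kern_pder, sub_sub_cancel]
    ring
  have e3 : lam * moll φ u x = ∫ z, lam * u z * φ.normed volume (x - z) := by
    unfold moll
    rw [← integral_sub_left_eq_self _ volume x, ← integral_const_mul]
    refine integral_congr_ae (Eventually.of_forall fun z => ?_)
    simp only [sub_sub_cancel]
    ring
  rw [e3]
  simp only [e2, Finset.sum_neg_distrib]
  linarith

lemma moll_int (φ : ContDiffBump (0 : Euc d)) {f : Euc d → ℝ} (hf : MemLp f 2 volume) (x : Euc d) :
    Integrable fun t => φ.normed volume t * f (x - t) := by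
  have h1 := isTest_memLp (isTest_normed φ) 2
  refine MemLp.integrable_mul (p := 2) (q := 2) h1 ?_
  exact hf.comp_measurePreserving (Measure.measurePreserving_sub_left volume x)

lemma moll_dl (φ : ContDiffBump (0 : Euc d)) {f : Euc d → ℝ} (hf : MemLp f 2 volume) (h : Euc d) :
    dl h (moll φ f) = moll φ (dl h f) := by
  funext x
  simp only [dl, moll]
  rw [← integral_sub (moll_int φ hf _) (moll_int φ hf _)]
  refine integral_congr_ae (Eventually.of_forall fun t => ?_)
  simp only
  rw [show x + h - t = x - t + h by abel]
  ring

lemma moll_mul (φ : ContDiffBump (0 : Euc d)) (f : Euc d → ℝ) (c : ℝ) :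
    moll φ (fun x => c * f x) = fun x => c * moll φ f x := by
  funext x
  simp only [moll]
  rw [← integral_const_mul]
  refine integral_congr_ae (Eventually.of_forall fun t => ?_)
  simp only; ring

lemma Q_moll_le (φ : ContDiffBump (0 : Euc d)) {f : Euc d → ℝ} (mf : Measurable f) {i0 : Fin d}
    {r r' : ℝ} (hr : r + φ.rOut ≤ r') : Q (AB i0 φ.rOut r) (moll φ f) ≤ Q (HB i0 r') f := by
  have hn : Measurable fun t => ENNReal.ofReal (φ.normed volume t) :=
    (isTest_normed φ).1.continuous.measurable.ennreal_ofReal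
  set ν := (volume : Measure (Euc d)).withDensity fun t => ENNReal.ofReal (φ.normed volume t) with hν
  have h1 : ν univ = 1 := by
    rw [hν, withDensity_apply _ MeasurableSet.univ, Measure.restrict_univ,
      ← ofReal_integral_eq_lintegral_ofReal φ.integrable_normed (Eventually.of_forall φ.nonneg_normed),
      φ.integral_normed, ENNReal.ofReal_one]
  have : SFinite ν := by
    have : IsFiniteMeasure ν := ⟨by rw [h1]; simp⟩
    infer_instance
  have hm : Measurable (Function.uncurry fun (t x : Euc d) => ‖f (x - t)‖ₑ) := by
    apply Measurable.enorm
    exact mf.comp (measurable_snd.sub measurable_fst)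
  have := mink ν (volume.restrict (AB i0 φ.rOut r)) (G := fun t x => ‖f (x - t)‖ₑ)
    (K := Q (HB i0 r') f) hm (by
      rw [hν, ae_withDensity_iff hn]
      refine Eventually.of_forall fun t ht => ?_
      have ht' : t ∈ closedBall (0 : Euc d) φ.rOut := by
        rw [← φ.tsupport_normed_eq (μ := volume)]
        refine subset_tsupport _ ?_
        intro h0
        simp [h0] at ht
      rw [mem_closedBall_zero_iff] at ht'
      have := Q_shift (AB_meas i0 φ.rOut r) (HB_meas i0 r') (-t) (fun x hx => AB_ball hr hx (by
        rw [mem_closedBall, dist_eq_norm]; simpa using ht')) f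
      simpa [Q, sub_eq_add_neg] using this)
  rw [h1, one_pow, one_mul] at this
  refine le_trans ?_ this
  unfold Q
  refine lintegral_mono fun x => ?_
  gcongr
  rw [hν, lintegral_withDensity_eq_lintegral_mul _ hn (by fun_prop)]
  refine (enorm_integral_le_lintegral_enorm _).trans (le_of_eq ?_)
  refine lintegral_congr fun t => ?_
  simp only [Pi.mul_apply]
  rw [enorm_mul, Real.enorm_eq_ofReal (φ.nonneg_normed t)]

end moll
end RH
end

section
open Set Filter MeasureTheory Metric Topology
open scoped ENNReal NNReal

namespace RH
section normal
variable {d : ℕ}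

lemma Q_sum_le {ι : Type*} (S : Finset ι) {A : Set (Euc d)} {f : ι → Euc d → ℝ}
    (hf : ∀ j ∈ S, Measurable (f j)) {K : ℝ≥0∞} (hK : ∀ j ∈ S, Q A (f j) ≤ K) :
    Q A (fun x => ∑ j ∈ S, f j x) ≤ 4 ^ S.card * K := by
  classical
  induction S using Finset.induction_on with
  | empty => simp [Q]
  | insert a S ha ih =>
    simp only [Finset.sum_insert ha]
    refine (Q_add_le (hf a (Finset.mem_insert_self _ _))).trans ?_
    have h1 := hK a (Finset.mem_insert_self _ _)
    have h2 := ih (fun j hj => hf j (Finset.mem_insert_of_mem hj))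
      (fun j hj => hK j (Finset.mem_insert_of_mem hj))
    rw [Finset.card_insert_of_notMem ha, pow_succ]
    calc _ ≤ 2 * (1 * K) + 2 * (4 ^ S.card * K) := by rw [one_mul]; gcongr
      _ ≤ 2 * (4 ^ S.card * K) + 2 * (4 ^ S.card * K) := by
        gcongr
        exact one_le_pow₀ (by norm_num)
      _ = 4 ^ S.card * 4 * K := by ring

lemma mink_ker {κ : Euc d → ℝ} {L : ℝ} (hL : ∀ z, |κ z| ≤ L)
    (h0 : ∀ z, z ∉ closedBall (0 : Euc d) 1 → κ z = 0) {A : Set (Euc d)}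
    {F : Euc d → Euc d → ℝ} (hF : Measurable (Function.uncurry F)) {K : ℝ≥0∞}
    (hK : ∀ z ∈ closedBall (0 : Euc d) 1, Q A (F z) ≤ K) :
    Q A (fun y => ∫ z, κ z * F z y) ≤
      (ENNReal.ofReal L * volume (closedBall (0 : Euc d) 1)) ^ 2 * K := by
  have h := mink (volume.restrict (closedBall (0 : Euc d) 1)) (volume.restrict A)
    (G := fun z x => ENNReal.ofReal L * ‖F z x‖ₑ) (K := ENNReal.ofReal L ^ 2 * K)
    (by
      have : Measurable fun q : Euc d × Euc d => ‖F q.1 q.2‖ₑ := hF.enorm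
      exact this.const_mul _)
    (by
      refine (ae_restrict_iff' measurableSet_closedBall).2 (Eventually.of_forall fun z hz => ?_)
      simp only [mul_pow]
      rw [lintegral_const_mul' _ _ (by simp)]
      gcongr
      exact hK z hz)
  rw [Measure.restrict_apply_univ] at h
  calc _ ≤ _ := ?_
    _ ≤ _ := h
    _ = _ := by ring
  unfold Q
  refine lintegral_mono fun x => ?_
  gcongr
  have e : ∫ z, κ z * F z x = ∫ z in closedBall (0 : Euc d) 1, κ z * F z x :=
    (setIntegral_eq_integral_of_forall_compl_eq_zero fun z hz => by rw [h0 z hz, zero_mul]).symm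
  simp only [e]
  refine (enorm_integral_le_lintegral_enorm _).trans (lintegral_mono fun z => ?_)
  rw [enorm_mul]
  gcongr
  rw [Real.enorm_eq_ofReal_abs]
  exact ENNReal.ofReal_le_ofReal (hL z)

/-- tangential projection -/
noncomputable def pr (i0 : Fin d) (z : Euc d) : Euc d := z - z i0 • EuclideanSpace.single i0 (1 : ℝ)

lemma pr_continuous (i0 : Fin d) : Continuous (pr i0) := by
  unfold pr
  exact continuous_id.sub (((EuclideanSpace.proj (𝕜 := ℝ) i0).continuous).smul continuous_const)

lemma pr_apply (i0 : Fin d) (z : Euc d) : pr i0 z i0 = 0 := by simp [pr]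

lemma pr_norm (i0 : Fin d) (z : Euc d) : ‖pr i0 z‖ ≤ ‖z‖ := by
  rw [EuclideanSpace.norm_eq, EuclideanSpace.norm_eq]
  refine Real.sqrt_le_sqrt (Finset.sum_le_sum fun i _ => ?_)
  by_cases h : i = i0
  · subst h; rw [pr_apply]; simp; positivity
  · simp [pr, h]

lemma pr_add (i0 : Fin d) (z w : Euc d) : pr i0 (z + w) = pr i0 z + pr i0 w := by
  simp only [pr, PiLp.add_apply, add_smul]; abel

lemma pr_smul (i0 : Fin d) (c : ℝ) (z : Euc d) : pr i0 (c • z) = c • pr i0 z := by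
  simp only [pr, PiLp.smul_apply, smul_sub, smul_smul, smul_eq_mul]

/-- as a continuous linear map -/
noncomputable def prL (i0 : Fin d) : Euc d →L[ℝ] Euc d :=
  ⟨⟨⟨pr i0, pr_add i0⟩, pr_smul i0⟩, pr_continuous i0⟩

lemma prL_apply (i0 : Fin d) (z : Euc d) : prL i0 z = pr i0 z := rfl

lemma pr_single {i0 j : Fin d} (h : j ≠ i0) :
    pr i0 (EuclideanSpace.single j (1 : ℝ)) = EuclideanSpace.single j (1 : ℝ) := by
  simp [pr, h.symm]

lemma exists_ker (d : ℕ) : ∃ ψ : Euc d → ℝ, ∃ L : ℝ, IsTest ψ ∧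
    (∀ z, z ∉ closedBall (0 : Euc d) 1 → ψ z = 0) ∧
    (∀ j z, z ∉ closedBall (0 : Euc d) 1 → pder j ψ z = 0) ∧
    (∫ z, ψ z = 1) ∧ (∀ z, |ψ z| ≤ L) ∧ (∀ j z, |pder j ψ z| ≤ L) ∧ 0 ≤ L := by
  let φ : ContDiffBump (0 : Euc d) := ⟨1/2, 1, by norm_num, by norm_num⟩
  have ht := isTest_normed φ
  have hts : tsupport (φ.normed volume) = closedBall (0 : Euc d) 1 := φ.tsupport_normed_eq
  obtain ⟨L1, hL1⟩ := ht.1.continuous.bounded_above_of_compact_support ht.2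
  have h2 : ∀ j, ∃ L2, ∀ z, ‖pder j (φ.normed volume) z‖ ≤ L2 := fun j =>
    (pder_continuous ht.1 j).bounded_above_of_compact_support (pder_hasCompactSupport ht.2 j)
  choose L2 hL2 using h2
  have hL20 : ∀ j, 0 ≤ L2 j := fun j => (norm_nonneg _).trans (hL2 j 0)
  have hL10 : 0 ≤ L1 := (norm_nonneg _).trans (hL1 0)
  refine ⟨φ.normed volume, L1 + ∑ j, L2 j, ht, ?_, ?_, φ.integral_normed, ?_, ?_, ?_⟩
  · intro z hz
    rw [← hts] at hz
    exact image_eq_zero_of_notMem_tsupport hz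
  · intro j z hz
    rw [← hts] at hz
    exact pder_zero_of_notMem hz j
  · intro z
    have := Finset.sum_nonneg (s := Finset.univ) fun j _ => hL20 j
    have := hL1 z
    rw [Real.norm_eq_abs] at this
    linarith
  · intro j z
    have := Finset.single_le_sum (f := L2) (fun j _ => hL20 j) (Finset.mem_univ j)
    have := hL2 j z
    rw [Real.norm_eq_abs] at this
    linarith
  · have := Finset.sum_nonneg (s := Finset.univ) fun j _ => hL20 j
    linarith

lemma ker_int {ψ h : Euc d → ℝ} (hψ : Continuous ψ)
    (h0 : ∀ z, z ∉ closedBall (0 : Euc d) 1 → ψ z = 0) (hh : Continuous h) :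
    Integrable fun z => ψ z * h z := by
  refine (hψ.mul hh).integrable_of_hasCompactSupport
    (HasCompactSupport.intro (isCompact_closedBall (0 : Euc d) 1) fun z hz => ?_)
  simp [h0 z hz]

lemma ibp {ψ F : Euc d → ℝ} (hψ : IsTest ψ) (h0 : ∀ z, z ∉ closedBall (0 : Euc d) 1 → ψ z = 0)
    (h0' : ∀ j z, z ∉ closedBall (0 : Euc d) 1 → pder j ψ z = 0)
    (hF : ContDiff ℝ 1 F) {i0 j : Fin d} (hj : j ≠ i0) {s : ℝ} (hs : 0 < s) (y : Euc d) :
    ∫ z, ψ z * pder j F (y + s • pr i0 z) = - s⁻¹ * ∫ z, pder j ψ z * dl (s • pr i0 z) F y := by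
  have hc : Continuous fun z => y + s • pr i0 z := continuous_const.add ((pr_continuous i0).const_smul s)
  have hF' : Continuous (fderiv ℝ F) := hF.continuous_fderiv (by simp)
  have hG : ∀ z, HasFDerivAt (fun z => dl (s • pr i0 z) F y)
      ((fderiv ℝ F (y + s • pr i0 z)).comp (s • prL i0)) z := by
    intro z
    have h1 : HasFDerivAt (fun z => y + s • pr i0 z) (s • prL i0) z :=
      (((prL i0).hasFDerivAt (x := z)).const_smul s).const_add y
    have h2 := (hF.differentiable (by simp) (y + s • pr i0 z)).hasFDerivAt
    exact (h2.comp z h1).sub_const _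
  have hGe : ∀ z, fderiv ℝ (fun z => dl (s • pr i0 z) F y) z (EuclideanSpace.single j 1) =
      s * pder j F (y + s • pr i0 z) := by
    intro z
    rw [(hG z).fderiv]
    simp [prL_apply, pr_single hj, pder]
  have hGc : Continuous fun z => dl (s • pr i0 z) F y := (hF.continuous.comp hc).sub continuous_const
  have := integral_mul_fderiv_eq_neg_fderiv_mul_of_integrable (𝕜 := ℝ) (μ := volume)
      (f := ψ) (g := fun z => dl (s • pr i0 z) F y)
      (v := EuclideanSpace.single j 1) ?_ ?_ ?_ (fun x _ => hψ.1.differentiable (by simp) x)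
      (fun x _ => (hG x).differentiableAt)
  · simp only [hGe] at this
    have e : ∫ z, ψ z * (s * pder j F (y + s • pr i0 z)) = s * ∫ z, ψ z * pder j F (y + s • pr i0 z) := by
      rw [← integral_const_mul]
      refine integral_congr_ae (Eventually.of_forall fun z => ?_)
      simp only; ring
    rw [e] at this
    have e2 : ∫ z, fderiv ℝ ψ z (EuclideanSpace.single j 1) * dl (s • pr i0 z) F y =
      ∫ z, pder j ψ z * dl (s • pr i0 z) F y := rfl
    rw [e2] at this
    rw [neg_mul, ← mul_neg, ← this]
    field_simp
  · exact ker_int (pder_continuous hψ.1 j) (h0' j) hGc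
  · simp only [hGe]
    exact ker_int hψ.1.continuous h0
      (continuous_const.mul ((hF'.comp hc).clm_apply continuous_const))
  · exact ker_int hψ.1.continuous h0 hGc


end normal
end RH
end

section
open Set Filter MeasureTheory Metric Topology
open scoped ENNReal NNReal

namespace RH
section normal
variable {d : ℕ}

lemma ker_meas {κ : Euc d → ℝ} {F : Euc d → Euc d → ℝ} (hκ : Continuous κ)
    (hF : Continuous (Function.uncurry F)) : Measurable fun y => ∫ z, κ z * F z y := by
  have : Continuous fun q : Euc d × Euc d => κ q.2 * F q.2 q.1 :=
    (hκ.comp continuous_snd).mul (hF.comp (continuous_snd.prodMk continuous_fst))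
  exact (this.stronglyMeasurable.integral_prod_right' (ν := volume)).measurable

lemma dl_cont {F : Euc d → ℝ} (hF : Continuous F) (i0 : Fin d) (s : ℝ) :
    Continuous (Function.uncurry fun z : Euc d => dl (s • pr i0 z) F) := by
  have := pr_continuous (d := d) i0
  unfold dl Function.uncurry
  fun_prop

lemma mid {ψ f : Euc d → ℝ} (hψ : IsTest ψ) (h0 : ∀ z, z ∉ closedBall (0 : Euc d) 1 → ψ z = 0)
    (hf : ContDiff ℝ 1 f) (i0 : Fin d) {s : ℝ} (hs : 0 < s) (x : Euc d) :
    (∫ z, ψ z * f (x + s • EuclideanSpace.single i0 (1:ℝ) + s • pr i0 z)) - ∫ z, ψ z * f (x + s • pr i0 z)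
      = ∫ τ in Ioc 0 s, ∫ z, ψ z * pder i0 f (x + τ • EuclideanSpace.single i0 (1:ℝ) + s • pr i0 z) := by
  set e0 : Euc d := EuclideanSpace.single i0 (1:ℝ) with he0
  have hpr := pr_continuous (d := d) i0
  have hf' : Continuous (pder i0 f) := (hf.continuous_fderiv (by simp)).clm_apply continuous_const
  have hfc := hf.continuous
  have hcc : Continuous fun q : ℝ × Euc d => ψ q.2 * pder i0 f (x + q.1 • e0 + s • pr i0 q.2) := by
    have := hψ.1.continuous
    fun_prop
  rw [integral_integral_swap]
  · rw [← integral_sub]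
    · refine integral_congr_ae (Eventually.of_forall fun z => ?_)
      simp only
      rw [integral_const_mul, ← mul_sub]
      congr 1
      rw [← intervalIntegral.integral_of_le hs.le]
      rw [intervalIntegral.integral_eq_sub_of_hasDerivAt (f := fun τ => f (x + τ • e0 + s • pr i0 z))]
      · simp
      · intro τ _
        have h1 : HasDerivAt (fun τ : ℝ => x + τ • e0 + s • pr i0 z) e0 τ := by
          have := (((hasDerivAt_id τ).smul_const e0).const_add x).add_const (s • pr i0 z)
          simpa using this
        have h2 := (hf.differentiable (by simp) (x + τ • e0 + s • pr i0 z)).hasFDerivAt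
        exact h2.comp_hasDerivAt τ h1
      · apply Continuous.intervalIntegrable
        fun_prop
    · exact ker_int hψ.1.continuous h0 (by fun_prop)
    · exact ker_int hψ.1.continuous h0 (by fun_prop)
  · have e1 : (volume.restrict (Ioc (0:ℝ) s)).prod (volume : Measure (Euc d)) =
        (volume.prod volume).restrict (Ioc (0:ℝ) s ×ˢ univ) := by
      rw [← Measure.prod_restrict, Measure.restrict_univ]
    rw [e1]
    have h2 : IntegrableOn (fun q : ℝ × Euc d => ψ q.2 * pder i0 f (x + q.1 • e0 + s • pr i0 q.2))
        (Icc (0:ℝ) s ×ˢ closedBall (0 : Euc d) 1) (volume.prod volume) :=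
      hcc.continuousOn.integrableOn_compact (isCompact_Icc.prod (isCompact_closedBall _ _))
    have h3 : IntegrableOn (fun q : ℝ × Euc d => ψ q.2 * pder i0 f (x + q.1 • e0 + s • pr i0 q.2))
        (Ioc (0:ℝ) s ×ˢ univ) (volume.prod volume) := by
      refine h2.of_forall_sdiff_eq_zero (measurableSet_Ioc.prod MeasurableSet.univ) fun q hq => ?_
      obtain ⟨⟨hq1, _⟩, hq2⟩ := hq
      have : q.2 ∉ closedBall (0 : Euc d) 1 := fun h => hq2 ⟨Ioc_subset_Icc_self hq1, h⟩
      simp only [h0 _ this, zero_mul]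
    exact h3

lemma enorm_smul_pr (i0 : Fin d) {s : ℝ} (hs : 0 ≤ s) {z : Euc d} (hz : z ∈ closedBall (0 : Euc d) 1) :
    ‖s • pr i0 z‖ ≤ s := by
  rw [norm_smul, Real.norm_of_nonneg hs]
  rw [mem_closedBall_zero_iff] at hz
  have := (pr_norm i0 z).trans hz
  nlinarith

theorem normal (d : ℕ) : ∃ C : ℝ≥0, ∀ (i0 : Fin d) (r r' δ σ : ℝ) (f e : Euc d → ℝ)
    (F : Fin d → Euc d → ℝ), ContDiff ℝ 1 f → Continuous e → (∀ j, ContDiff ℝ 1 (F j)) →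
    (∀ x ∈ AB i0 σ r', pder i0 f x = (∑ j ∈ Finset.univ.erase i0, pder j (F j) x) + e x) →
    ∀ E : ℝ≥0∞, Q (AB i0 σ r') e ≤ E →
    (∀ h, h i0 = 0 → ‖h‖ ≤ δ → Q (AB i0 σ r') (dl h f) ≤ ‖h‖ₑ * E) →
    (∀ j, ∀ h, h i0 = 0 → ‖h‖ ≤ δ → Q (AB i0 σ r') (dl h (F j)) ≤ ‖h‖ₑ * E) →
    ∀ s : ℝ, 0 ≤ s → s ≤ 1 → s ≤ δ → s ≤ (r' - r) / 2 →
    Q (AB i0 σ r) (dl (s • EuclideanSpace.single i0 (1:ℝ)) f) ≤ C * ENNReal.ofReal s * E := by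
  obtain ⟨ψ, L, hψ, h0, h0', hIntg, hL, hL', hL0⟩ := exists_ker d
  have hVfin : (ENNReal.ofReal L * volume (closedBall (0 : Euc d) 1)) ^ 2 ≠ ⊤ := by
    have := measure_closedBall_lt_top (μ := volume) (x := (0 : Euc d)) (r := 1)
    finiteness
  refine ⟨((ENNReal.ofReal L * volume (closedBall (0 : Euc d) 1)) ^ 2).toNNReal * (14 + 8 * 4 ^ d), ?_⟩
  intro i0 r r' δ σ f e F hf he hF heq E hE hdf hdF s hs0 hs1 hsδ hsr
  rw [ENNReal.coe_mul, ENNReal.coe_toNNReal hVfin]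
  set V := (ENNReal.ofReal L * volume (closedBall (0 : Euc d) 1)) ^ 2 with hV
  rcases hs0.eq_or_lt with rfl | hs
  · simp [dl, Q]
  set e0 : Euc d := EuclideanSpace.single i0 (1:ℝ) with he0
  have he0i : e0 i0 = 1 := by simp [he0]
  have he0n : ‖e0‖ = 1 := by simp [he0]
  have hψc := hψ.1.continuous
  have hpr := pr_continuous (d := d) i0
  set S := ENNReal.ofReal s with hS
  have hzS : ∀ z ∈ closedBall (0 : Euc d) 1, ‖s • pr i0 z‖ₑ ≤ S := fun z hz => by
    rw [← ofReal_norm]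
    exact ENNReal.ofReal_le_ofReal (enorm_smul_pr i0 hs0 hz)
  have hzi : ∀ z : Euc d, (s • pr i0 z) i0 = 0 := fun z => by simp [pr_apply]
  -- pieces
  let P : Euc d → ℝ := fun y => ∫ z, ψ z * dl (s • pr i0 z) f y
  let T : Fin d → Euc d → ℝ := fun j y => ∫ z, pder j ψ z * dl (s • pr i0 z) (F j) y
  let W : Euc d → ℝ := fun y => ∫ z, ψ z * e (y + s • pr i0 z)
  let H : Euc d → ℝ := fun y => (∑ j ∈ Finset.univ.erase i0, - s⁻¹ * T j y) + W y
  have mP : Measurable P := ker_meas hψc (dl_cont hf.continuous i0 s)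
  have mT : ∀ j, Measurable (T j) := fun j =>
    ker_meas (pder_continuous hψ.1 j) (dl_cont (hF j).continuous i0 s)
  have mW : Measurable W := ker_meas (F := fun z y => e (y + s • pr i0 z)) hψc
    (by unfold Function.uncurry; fun_prop)
  have mS : Measurable fun y => ∑ j ∈ Finset.univ.erase i0, - s⁻¹ * T j y :=
    Finset.measurable_sum _ fun j _ => (mT j).const_mul _
  have mH : Measurable H := mS.add mW
  have hr1 : r + s ≤ r' := by linarith
  have qP : Q (AB i0 σ (r + s)) P ≤ V * (S * E) := by
    refine mink_ker hL h0 (dl_cont hf.continuous i0 s).measurable fun z hz => ?_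
    refine (Q_mono_set (AB_mono i0 σ hr1) _).trans ?_
    refine (hdf _ (hzi z) ((enorm_smul_pr i0 hs0 hz).trans hsδ)).trans ?_
    gcongr
    exact hzS z hz
  have qT : ∀ j, Q (AB i0 σ (r + s)) (T j) ≤ V * (S * E) := by
    intro j
    refine mink_ker (hL' j) (h0' j) (dl_cont (hF j).continuous i0 s).measurable fun z hz => ?_
    refine (Q_mono_set (AB_mono i0 σ hr1) _).trans ?_
    refine (hdF j _ (hzi z) ((enorm_smul_pr i0 hs0 hz).trans hsδ)).trans ?_
    gcongr
    exact hzS z hz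
  have qW : Q (AB i0 σ (r + s)) W ≤ V * E := by
    refine mink_ker (F := fun z y => e (y + s • pr i0 z)) hL h0
      (by unfold Function.uncurry; exact Continuous.measurable (by fun_prop)) fun z hz => ?_
    refine (Q_shift (AB_meas _ _ _) (AB_meas i0 σ r') (s • pr i0 z) (AB_shift (hzi z).ge ?_) e).trans hE
    have := enorm_smul_pr i0 hs0 hz
    linarith
  have hinv : ENNReal.ofReal ((-s⁻¹) ^ 2) * S ^ 2 = 1 := by
    rw [hS, ← ENNReal.ofReal_pow hs0, ← ENNReal.ofReal_mul (by positivity), neg_sq, ← mul_pow,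
      inv_mul_cancel₀ hs.ne', one_pow, ENNReal.ofReal_one]
  have qH : S ^ 2 * Q (AB i0 σ (r + s)) H ≤ V * (2 * 4 ^ d + 2) * S * E := by
    have h1 : Q (AB i0 σ (r + s)) (fun y => ∑ j ∈ Finset.univ.erase i0, - s⁻¹ * T j y) ≤
        4 ^ d * (ENNReal.ofReal ((-s⁻¹) ^ 2) * (V * (S * E))) := by
      refine (Q_sum_le _ (fun j _ => (mT j).const_mul _)
        (K := ENNReal.ofReal ((-s⁻¹) ^ 2) * (V * (S * E))) fun j _ => ?_).trans ?_
      · rw [Q_mul]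
        gcongr
        exact qT j
      · gcongr
        · norm_num
        · exact (Finset.card_le_univ _).trans (by simp)
    have hSS : S ^ 2 ≤ S := by
      rw [sq]
      have : S ≤ 1 := by
        rw [hS, ← ENNReal.ofReal_one]
        exact ENNReal.ofReal_le_ofReal hs1
      calc S * S ≤ S * 1 := by gcongr
        _ = S := mul_one _
    calc S ^ 2 * Q (AB i0 σ (r + s)) H
        ≤ S ^ 2 * (2 * (4 ^ d * (ENNReal.ofReal ((-s⁻¹) ^ 2) * (V * (S * E)))) + 2 * (V * E)) := by
          gcongr
          refine (Q_add_le mS).trans ?_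
          gcongr
      _ = 2 * 4 ^ d * V * S * E * (ENNReal.ofReal ((-s⁻¹) ^ 2) * S ^ 2) + 2 * V * E * S ^ 2 := by ring
      _ ≤ 2 * 4 ^ d * V * S * E * 1 + 2 * V * E * S := by rw [hinv]; gcongr
      _ = _ := by ring
  -- the middle term
  have mG : Measurable fun q : ℝ × Euc d => H (q.2 + q.1 • e0) := by
    apply mH.comp
    exact Continuous.measurable (by fun_prop)
  have mI : Measurable fun x => ∫ τ in Ioc 0 s, H (x + τ • e0) :=
    ((mG.comp measurable_swap).stronglyMeasurable.integral_prod_right'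
      (ν := volume.restrict (Ioc 0 s))).measurable
  have qI : Q (AB i0 σ r) (fun x => ∫ τ in Ioc 0 s, H (x + τ • e0)) ≤ V * (2 * 4 ^ d + 2) * S * E := by
    have h := mink (volume.restrict (Ioc 0 s)) (volume.restrict (AB i0 σ r))
      (G := fun τ x => ‖H (x + τ • e0)‖ₑ) (K := Q (AB i0 σ (r + s)) H) mG.enorm (by
        refine (ae_restrict_iff' measurableSet_Ioc).2 (Eventually.of_forall fun τ hτ => ?_)
        refine Q_shift (AB_meas _ _ _) (AB_meas i0 σ (r+s)) (τ • e0) (AB_shift ?_ ?_) H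
        · simp [he0i, hτ.1.le]
        · rw [norm_smul, he0n, Real.norm_of_nonneg hτ.1.le]; linarith [hτ.2])
    rw [Measure.restrict_apply_univ, Real.volume_Ioc, sub_zero] at h
    refine le_trans ?_ (h.trans qH)
    unfold Q
    refine lintegral_mono fun x => ?_
    gcongr
    exact enorm_integral_le_lintegral_enorm _
  -- the identity
  have hid : ∀ x ∈ AB i0 σ r, dl (s • e0) f x =
      (-P (x + s • e0) + P x) + ∫ τ in Ioc 0 s, H (x + τ • e0) := by
    intro x hx
    have hPe : ∀ y, P y = (∫ z, ψ z * f (y + s • pr i0 z)) - f y := by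
      intro y
      have h1 : Integrable fun z => ψ z * f (y + s • pr i0 z) :=
        ker_int hψc h0 (by have := hf.continuous; fun_prop)
      have h2 : Integrable fun z => ψ z * f y := ker_int hψc h0 continuous_const
      have : f y = ∫ z, ψ z * f y := by rw [integral_mul_const, hIntg, one_mul]
      conv_rhs => rw [this, ← integral_sub h1 h2]
      refine integral_congr_ae (Eventually.of_forall fun z => ?_)
      simp only [dl]; ring
    have hm := mid hψ h0 hf i0 hs x
    have hHe : ∫ τ in Ioc 0 s, H (x + τ • e0) =
        ∫ τ in Ioc 0 s, ∫ z, ψ z * pder i0 f (x + τ • e0 + s • pr i0 z) := by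
      refine setIntegral_congr_fun measurableSet_Ioc fun τ hτ => ?_
      set y := x + τ • e0 with hy
      have hy' : y ∈ AB i0 σ (r + s) := by
        refine AB_shift ?_ ?_ x hx
        · simp [he0i, hτ.1.le]
        · rw [norm_smul, he0n, Real.norm_of_nonneg hτ.1.le]; linarith [hτ.2]
      have e1 : ∀ z, ψ z * pder i0 f (y + s • pr i0 z) =
          (∑ j ∈ Finset.univ.erase i0, ψ z * pder j (F j) (y + s • pr i0 z)) + ψ z * e (y + s • pr i0 z) := by
        intro z
        by_cases hz : z ∈ closedBall (0 : Euc d) 1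
        · rw [heq _ (AB_shift (hzi z).ge (by have := enorm_smul_pr i0 hs0 hz; linarith) y hy'), mul_add,
            Finset.mul_sum]
        · simp [h0 z hz]
      have hFi : ∀ j, Integrable fun z => ψ z * pder j (F j) (y + s • pr i0 z) := fun j => by
        refine ker_int hψc h0 ?_
        have : Continuous (pder j (F j)) :=
          ((hF j).continuous_fderiv (by simp)).clm_apply continuous_const
        fun_prop
      show (∑ j ∈ Finset.univ.erase i0, - s⁻¹ * T j y) + W y = ∫ z, ψ z * pder i0 f (y + s • pr i0 z)
      simp only [e1]
      rw [integral_add (integrable_finsetSum _ fun j _ => hFi j) (ker_int hψc h0 (by fun_prop)),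
        integral_finsetSum _ fun j _ => hFi j]
      congr 1
      refine Finset.sum_congr rfl fun j hj => ?_
      rw [ibp hψ h0 h0' (hF j) (Finset.ne_of_mem_erase hj) hs]
    rw [hHe, ← hm, hPe, hPe]
    simp only [dl]
    ring
  rw [Q_congr (AB_meas _ _ _) hid]
  have mP' : Measurable fun x => -P (x + s • e0) := by
    have : Measurable fun x : Euc d => x + s • e0 := by fun_prop
    exact (mP.comp this).neg
  have q1 : Q (AB i0 σ r) (fun x => -P (x + s • e0)) ≤ V * (S * E) := by
    have e : Q (AB i0 σ r) (fun x => -P (x + s • e0)) = Q (AB i0 σ r) (fun x => P (x + s • e0)) := by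
      simp [Q]
    rw [e]
    refine (Q_shift (AB_meas _ _ _) (AB_meas i0 σ (r+s)) (s • e0) (AB_shift ?_ ?_) P).trans qP
    · simp [he0i, hs0]
    · rw [norm_smul, he0n, Real.norm_of_nonneg hs0]; linarith
  have q2 : Q (AB i0 σ r) P ≤ V * (S * E) := (Q_mono_set (AB_mono i0 σ (by linarith)) _).trans qP
  calc _ ≤ 2 * (2 * (V * (S * E)) + 2 * (V * (S * E))) + 2 * (V * (2 * 4 ^ d + 2) * S * E) := by
        refine (Q_add_le (mP'.add mP)).trans ?_
        gcongr
        refine (Q_add_le mP').trans ?_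
        gcongr
    _ = V * (12 + 4 * 4 ^ d) * S * E := by ring
    _ ≤ _ := by
        push_cast
        gcongr <;> norm_num

end normal
end RH
end

section
open Set Filter MeasureTheory Metric Topology
open scoped ENNReal NNReal

namespace RH
section m1
variable {d : ℕ}

/-- the components entering `U` -/
noncomputable def comp (lam : ℝ) (u : Euc d → ℝ) (g : Euc d → Euc d) : Option (Fin d) → Euc d → ℝ
  | none => fun x => Real.sqrt lam * u x
  | some j => fun x => g x j

lemma comp_meas {lam : ℝ} {u : Euc d → ℝ} {g : Euc d → Euc d} (hu : Measurable u) (hg : Measurable g)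
    (c : Option (Fin d)) : Measurable (comp lam u g c) := by
  cases c with
  | none => exact hu.const_mul _
  | some j => exact (measurable_coord j).comp hg

lemma comp_memLp {lam : ℝ} {u : Euc d → ℝ} {g : Euc d → Euc d} (hu : MemLp u 2 volume)
    (hg : MemLp g 2 volume) (c : Option (Fin d)) : MemLp (comp lam u g c) 2 volume := by
  cases c with
  | none => exact hu.const_mul _
  | some j => exact coord_memLp hg j

lemma comp_dl (lam : ℝ) (u : Euc d → ℝ) (g : Euc d → Euc d) (h : Euc d) (c : Option (Fin d)) :
    comp lam (dl h u) (dl h g) c = dl h (comp lam u g c) := by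
  cases c with
  | none => funext x; simp only [comp, dl]; ring
  | some j => funext x; simp [comp, dl]

lemma comp_smul (lam : ℝ) (u : Euc d → ℝ) (g : Euc d → Euc d) (a : ℝ) (c : Option (Fin d)) :
    comp lam (fun x => a * u x) (fun x => a • g x) c = fun x => a * comp lam u g c x := by
  cases c with
  | none => funext x; simp only [comp]; ring
  | some j => funext x; simp [comp]

lemma Q_comp_le {lam : ℝ} (hl : 0 ≤ lam) (i0 : Fin d) (r : ℝ) (u : Euc d → ℝ) (g : Euc d → Euc d)
    (c : Option (Fin d)) : Q (HB i0 r) (comp lam u g c) ≤ En i0 lam r u g := by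
  cases c with
  | none =>
    show Q (HB i0 r) (fun x => Real.sqrt lam * u x) ≤ _
    rw [Q_mul, Real.sq_sqrt hl]
    exact le_add_self
  | some j => exact (Q_coord_le _ _ j).trans le_self_add

lemma AB_open (i0 : Fin d) (σ r : ℝ) : IsOpen (AB i0 σ r) :=
  isOpen_ball.inter (isOpen_lt continuous_const (EuclideanSpace.proj (𝕜 := ℝ) i0).continuous)

lemma pder_congr_open {f h : Euc d → ℝ} {A : Set (Euc d)} (hA : IsOpen A) (hfh : ∀ x ∈ A, f x = h x)
    (i : Fin d) {x : Euc d} (hx : x ∈ A) : pder i f x = pder i h x := by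
  unfold pder
  rw [Filter.EventuallyEq.fderiv_eq (f := h)]
  filter_upwards [hA.mem_nhds hx] with y hy using hfh y hy

lemma pder_comm {f : Euc d → ℝ} (hf : ContDiff ℝ (⊤ : ℕ∞) f) (i j : Fin d) (x : Euc d) :
    pder i (pder j f) x = pder j (pder i f) x := by
  have hs : IsSymmSndFDerivAt ℝ f x :=
    hf.contDiffAt.isSymmSndFDerivAt (by simp; exact WithTop.coe_le_coe.2 le_top)
  have hd : DifferentiableAt ℝ (fderiv ℝ f) x :=
    ((hf.fderiv_right (m := (⊤ : ℕ∞)) (by simp)).differentiable (by simp)) x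
  have key : ∀ i j : Fin d, pder i (pder j f) x =
      fderiv ℝ (fderiv ℝ f) x (EuclideanSpace.single i 1) (EuclideanSpace.single j 1) := by
    intro i j
    unfold pder
    rw [fderiv_clm_apply hd (differentiableAt_const _)]
    simp
  rw [key, key]
  exact hs _ _

lemma pder_contDiff {f : Euc d → ℝ} (hf : ContDiff ℝ (⊤ : ℕ∞) f) (i : Fin d) :
    ContDiff ℝ (⊤ : ℕ∞) (pder i f) :=
  (hf.fderiv_right (by simp)).clm_apply contDiff_const

lemma pder_const_mul {f : Euc d → ℝ} (hf : ContDiff ℝ (⊤ : ℕ∞) f) (c : ℝ) (i : Fin d) (x : Euc d) :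
    pder i (fun x => c * f x) x = c * pder i f x := by
  unfold pder
  rw [fderiv_const_mul (hf.differentiable (by simp) x)]
  simp

/-- data of the domain -/
structure Dom (i0 : Fin d) (K : ℝ) (D : Set (Euc d)) (Y : Set (Fin d)) : Prop where
  cone : ∃ e, Cone i0 K e D
  flat : ∀ x ∈ D, x i0 = 0
  ne : i0 ∉ Y
  inv : ∀ j ∈ Y, ∀ t : ℝ, ∀ x ∈ D, x + t • EuclideanSpace.single j (1:ℝ) ∈ D

lemma tang_moll {r r' : ℝ} (hr : 0 < r) (hrr : r < r') {K : ℝ} (hK : 0 ≤ K) : ∃ C : ℝ≥0, ∃ δ > 0, ∃ σ0 > 0,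
    ∀ (i0 : Fin d) (D : Set (Euc d)) (Y : Set (Fin d)), Dom i0 K D Y → ∀
    (lam : ℝ) (u : Euc d → ℝ) (g : Euc d → Euc d), 0 ≤ lam → Sol i0 D lam r' u g →
    ∀ φ : ContDiffBump (0 : Euc d), φ.rOut ≤ σ0 → ∀ c,
    (Q (AB i0 φ.rOut r) (moll φ (comp lam u g c)) ≤ En i0 lam r' u g) ∧
    (∀ h : Euc d, h i0 = 0 → ‖h‖ ≤ δ →
      Q (AB i0 φ.rOut r) (dl h (moll φ (comp lam u g c))) ≤ C * ‖h‖ₑ * En i0 lam r' u g) := by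
  obtain ⟨C, hC⟩ := tang (d := d) (r := (r + r') / 2) (r' := r') (by linarith) (by linarith) hK
  refine ⟨C, (r' - (r + r') / 2) / (4 * (K + 1)), by
    have : 0 < r' - (r + r') / 2 := by linarith
    positivity, (r' - r) / 2, by linarith, fun i0 D Y hD lam u g hl s φ hφ c => ⟨?_, ?_⟩⟩
  · refine (Q_moll_le φ (comp_meas s.mu s.mg c) (r' := r') (by linarith)).trans ?_
    exact Q_comp_le hl i0 r' u g c
  · intro h h0 hh
    obtain ⟨e, he⟩ := hD.cone
    rw [moll_dl φ (comp_memLp s.lu s.lg c), ← comp_dl]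
    refine (Q_moll_le φ (comp_meas (meas_dl s.mu h) (meas_dl s.mg h) c)
      (r' := (r + r') / 2) (by linarith)).trans ?_
    refine (Q_comp_le hl i0 _ _ _ c).trans ?_
    exact hC i0 e D he lam u g hl s h h0 hh

lemma normal_moll {r r' : ℝ} (hr : 0 < r) (hrr : r < r') {K : ℝ} (hK : 0 ≤ K) : ∃ C : ℝ≥0, ∃ δ > 0, ∃ σ0 > 0,
    ∀ (i0 : Fin d) (D : Set (Euc d)) (Y : Set (Fin d)), Dom i0 K D Y → ∀
    (lam : ℝ) (u : Euc d → ℝ) (g : Euc d → Euc d), 0 ≤ lam → Sol i0 D lam r' u g →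
    ∀ φ : ContDiffBump (0 : Euc d), φ.rOut ≤ σ0 → ∀ c,
    (∀ s : ℝ, 0 ≤ s → s ≤ δ →
      Q (AB i0 φ.rOut r) (dl (s • EuclideanSpace.single i0 (1:ℝ)) (moll φ (comp lam u g c))) ≤
        C * ENNReal.ofReal s * En i0 lam r' u g) := by
  set r1 := (r + r') / 2 with hr1
  obtain ⟨Cn, hCn⟩ := normal d
  obtain ⟨Ct, δ, hδ, σ0, hσ0, ht⟩ := tang_moll (d := d) (r := r1) (r' := r') (by linarith) (by linarith) hK
  obtain ⟨Cl, hCl⟩ := lamE (d := d) (r := (r1 + r') / 2) (r' := r') (by linarith) (by linarith)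
  refine ⟨Cn * (Ct + Cl), min (min 1 δ) ((r1 - r) / 2), ?_, min σ0 ((r' - r1) / 2), ?_, ?_⟩
  · refine lt_min (lt_min one_pos hδ) (by linarith)
  · refine lt_min hσ0 (by linarith)
  intro i0 D Y hD lam u g hl s φ hφ c t ht0 htδ
  have hφ1 : φ.rOut ≤ σ0 := hφ.trans (min_le_left _ _)
  have hφ2 : φ.rOut ≤ (r' - r1) / 2 := hφ.trans (min_le_right _ _)
  have htan := ht i0 D Y hD lam u g hl s φ hφ1
  have hlam := hCl i0 D lam u g hl s
  set E := En i0 lam r' u g with hE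
  set σ := φ.rOut with hσ
  have sm : ∀ c, ContDiff ℝ (⊤ : ℕ∞) (moll φ (comp lam u g c)) := fun c =>
    moll_contDiff φ (comp_memLp s.lu s.lg c)
  have smu : ContDiff ℝ (⊤ : ℕ∞) (moll φ u) := moll_contDiff φ s.lu
  have htan' : ∀ c, ∀ h : Euc d, h i0 = 0 → ‖h‖ ≤ δ →
      Q (AB i0 σ r1) (dl h (moll φ (comp lam u g c))) ≤ ‖h‖ₑ * ((Ct + Cl) * E) := by
    intro c h h0 hh
    refine ((htan c).2 h h0 hh).trans ?_
    calc (Ct : ℝ≥0∞) * ‖h‖ₑ * E ≤ (Ct + Cl) * ‖h‖ₑ * E := by gcongr; exact le_self_add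
      _ = _ := by ring
  have hzero : ∀ h : Euc d, Q (AB i0 σ r1) (dl h (fun _ => (0:ℝ))) ≤ ‖h‖ₑ * ((Ct + Cl) * E) := by
    intro h; simp [dl, Q]
  have hgrad : ∀ i, ∀ x ∈ AB i0 σ r1, pder i (moll φ u) x = moll φ (comp lam u g (some i)) x :=
    fun i x hx => s.moll_grad φ (r := r1) (by linarith) i hx
  have t1 : t ≤ 1 := htδ.trans ((min_le_left _ _).trans (min_le_left _ _))
  have t2 : t ≤ δ := htδ.trans ((min_le_left _ _).trans (min_le_right _ _))
  have t3 : t ≤ (r1 - r) / 2 := htδ.trans (min_le_right _ _)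
  have hle1 : ∀ c : Option (Fin d), ContDiff ℝ 1 (moll φ (comp lam u g c)) := fun c =>
    (sm c).of_le (by simp)
  have fin : ∀ (e : Euc d → ℝ) (F : Fin d → Euc d → ℝ), Continuous e → (∀ j, ContDiff ℝ 1 (F j)) →
      (∀ x ∈ AB i0 σ r1, pder i0 (moll φ (comp lam u g c)) x =
        (∑ j ∈ Finset.univ.erase i0, pder j (F j) x) + e x) →
      Q (AB i0 σ r1) e ≤ (Ct + Cl) * E →
      (∀ j, ∀ h, h i0 = 0 → ‖h‖ ≤ δ → Q (AB i0 σ r1) (dl h (F j)) ≤ ‖h‖ₑ * ((Ct + Cl) * E)) →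
      Q (AB i0 σ r) (dl (t • EuclideanSpace.single i0 (1:ℝ)) (moll φ (comp lam u g c))) ≤
        (Cn * (Ct + Cl) : ℝ≥0) * ENNReal.ofReal t * E := by
    intro e F he hF heq hQe hQF
    refine (hCn i0 r r1 δ σ _ e F (hle1 c) he hF heq ((Ct + Cl) * E) hQe (htan' c) hQF t ht0 t1 t2 t3).trans ?_
    push_cast
    exact le_of_eq (by ring)
  have hmu : Q (AB i0 σ r1) (moll φ u) ≤ Q (HB i0 ((r1 + r') / 2)) u := Q_moll_le φ s.mu (by linarith)
  have hsq : moll φ (comp lam u g none) = fun x => Real.sqrt lam * moll φ u x := moll_mul φ u _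
  cases c with
  | none =>
    refine fin (fun x => Real.sqrt lam * moll φ (comp lam u g (some i0)) x) (fun _ _ => 0)
      (continuous_const.mul (sm _).continuous) (fun _ => contDiff_const) (fun x hx => ?_) ?_
      (fun _ h _ _ => hzero h)
    · rw [hsq, pder_const_mul smu, hgrad i0 x hx]
      simp [pder]
    · rw [Q_mul, Real.sq_sqrt hl]
      calc _ ≤ ENNReal.ofReal lam * En i0 lam ((r1 + r') / 2) u g := by
            gcongr
            refine (Q_moll_le φ (comp_meas s.mu s.mg _) (r' := (r1 + r') / 2) (by linarith)).trans ?_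
            exact Q_comp_le hl _ _ _ _ _
        _ ≤ Cl * E := hlam
        _ ≤ _ := by gcongr; exact le_add_self
  | some i =>
    by_cases hi : i = i0
    · subst hi
      refine fin (fun x => lam * moll φ u x) (fun j x => -1 * moll φ (comp lam u g (some j)) x)
        (continuous_const.mul smu.continuous) (fun j => contDiff_const.mul (hle1 _)) (fun x hx => ?_) ?_ ?_
      · have := s.moll_div hD.flat φ (r := r1) (by linarith) hx
        rw [← Finset.add_sum_erase _ _ (Finset.mem_univ i)] at this
        simp only [pder_const_mul (sm _), ← Finset.mul_sum]
        rw [← this]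
        simp only [comp]
        ring
      · rw [Q_mul]
        calc _ ≤ ENNReal.ofReal (lam ^ 2) * Q (HB i ((r1 + r') / 2)) u := by gcongr
          _ = ENNReal.ofReal lam * (ENNReal.ofReal lam * Q (HB i ((r1 + r') / 2)) u) := by
            rw [sq, ENNReal.ofReal_mul hl]; ring
          _ ≤ ENNReal.ofReal lam * En i lam ((r1 + r') / 2) u g := by gcongr; exact le_add_self
          _ ≤ Cl * E := hlam
          _ ≤ _ := by gcongr; exact le_add_self
      · intro j h h0 hh
        have : dl h (fun x => -1 * moll φ (comp lam u g (some j)) x) =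
            fun x => -1 * dl h (moll φ (comp lam u g (some j))) x := by
          funext x; simp only [dl]; ring
        rw [this, Q_mul]
        simpa using htan' (some j) h h0 hh
    · classical
      refine fin (fun _ => 0) (fun j => if j = i then moll φ (comp lam u g (some i0)) else fun _ => 0)
        continuous_const (fun j => ?_) (fun x hx => ?_) ?_ ?_
      · split_ifs
        · exact hle1 _
        · exact contDiff_const
      · rw [Finset.sum_eq_single i]
        · rw [if_pos rfl, add_zero,
            ← pder_congr_open (AB_open i0 σ r1) (hgrad i) i0 hx,
            ← pder_congr_open (AB_open i0 σ r1) (hgrad i0) i hx]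
          exact pder_comm smu _ _ _
        · intro j _ hj
          rw [if_neg hj]; simp [pder]
        · intro h; exact absurd (Finset.mem_erase.2 ⟨hi, Finset.mem_univ _⟩) h
      · simp [Q]
      · intro j h h0 hh
        split_ifs
        · exact htan' _ h h0 hh
        · exact hzero h

theorem M1 {r r' : ℝ} (hr : 0 < r) (hrr : r < r') {K : ℝ} (hK : 0 ≤ K) : ∃ C : ℝ≥0, ∃ δ > 0, ∃ σ0 > 0,
    ∀ (i0 : Fin d) (D : Set (Euc d)) (Y : Set (Fin d)), Dom i0 K D Y → ∀
    (lam : ℝ) (u : Euc d → ℝ) (g : Euc d → Euc d), 0 ≤ lam → Sol i0 D lam r' u g →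
    ∀ φ : ContDiffBump (0 : Euc d), φ.rOut ≤ σ0 → ∀ c,
    (Q (AB i0 φ.rOut r) (moll φ (comp lam u g c)) ≤ C * En i0 lam r' u g) ∧
    (∀ z : Euc d, 0 ≤ z i0 → ‖z‖ ≤ δ →
      Q (AB i0 φ.rOut r) (dl z (moll φ (comp lam u g c))) ≤ C * ‖z‖ₑ * En i0 lam r' u g) := by
  set r1 := (r + r') / 2 with hr1
  obtain ⟨Cn, δ, hδ, σ0, hσ0, hn⟩ := normal_moll (d := d) (r := r1) (r' := r') (by linarith) (by linarith) hK
  obtain ⟨Ct, δ', hδ', σ0', hσ0', ht⟩ := tang_moll (d := d) (r := r) (r' := r') (by linarith) (by linarith) hK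
  refine ⟨2 * Cn + 2 * Ct + 1, min (min δ δ') (r1 - r), lt_min (lt_min hδ hδ') (by linarith), min σ0 σ0',
    lt_min hσ0 hσ0', fun i0 D Y hD lam u g hl s φ hφ c => ?_⟩
  have hn := hn i0 D Y hD lam u g hl s φ (hφ.trans (min_le_left _ _)) c
  have ht := ht i0 D Y hD lam u g hl s φ (hφ.trans (min_le_right _ _)) c
  have sm := (moll_contDiff φ (comp_memLp (lam := lam) s.lu s.lg c)).continuous
  set f := moll φ (comp lam u g c) with hf
  set E := En i0 lam r' u g
  refine ⟨ht.1.trans ?_, fun z hz0 hz => ?_⟩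
  · push_cast
    calc E = 1 * E := (one_mul _).symm
      _ ≤ _ := by gcongr; exact le_add_self
  have e : dl z f = fun x => dl (z i0 • EuclideanSpace.single i0 (1:ℝ)) f (x + pr i0 z) + dl (pr i0 z) f x := by
    funext x
    simp only [dl, pr]
    rw [show x + (z - z i0 • EuclideanSpace.single i0 (1:ℝ)) + z i0 • EuclideanSpace.single i0 (1:ℝ) = x + z by abel]
    ring
  have hzi : |z i0| ≤ ‖z‖ := PiLp.norm_apply_le z i0
  rw [abs_of_nonneg hz0] at hzi
  rw [e]
  refine (Q_add_le ?_).trans ?_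
  · refine Continuous.measurable ?_
    unfold dl
    fun_prop
  have hz1 : ‖z‖ ≤ δ := hz.trans ((min_le_left _ _).trans (min_le_left _ _))
  have hz2 : ‖z‖ ≤ δ' := hz.trans ((min_le_left _ _).trans (min_le_right _ _))
  have hz3 : ‖z‖ ≤ r1 - r := hz.trans (min_le_right _ _)
  have hzE : ENNReal.ofReal (z i0) ≤ ‖z‖ₑ := by
    rw [← ofReal_norm]; exact ENNReal.ofReal_le_ofReal hzi
  have hpE : ‖pr i0 z‖ₑ ≤ ‖z‖ₑ := enorm_le_iff_norm_le.2 (pr_norm i0 z)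
  have hpn := pr_norm i0 z
  calc _ ≤ 2 * (Cn * ‖z‖ₑ * E) + 2 * (Ct * ‖z‖ₑ * E) := by
        gcongr
        · refine (Q_shift (AB_meas _ _ _) (AB_meas i0 φ.rOut r1) (pr i0 z)
            (AB_shift (pr_apply i0 z).ge (by linarith)) _).trans ?_
          refine (hn _ hz0 (hzi.trans hz1)).trans ?_
          gcongr
        · refine (ht.2 _ (pr_apply i0 z) (hpn.trans hz2)).trans ?_
          gcongr
    _ = (2 * Cn + 2 * Ct) * ‖z‖ₑ * E := by ring
    _ ≤ _ := by
      push_cast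
      gcongr ?_ * _ * _
      exact le_self_add

end m1
end RH
end

section
open Set Filter MeasureTheory Metric Topology
open scoped ENNReal NNReal

namespace RH
section m2
variable {d : ℕ}

/-- iterated partial derivative along a list -/
noncomputable def dL : List (Fin d) → (Euc d → ℝ) → Euc d → ℝ
  | [], f => f
  | j :: L, f => pder j (dL L f)

lemma dL_contDiff (L : List (Fin d)) {f : Euc d → ℝ} (hf : ContDiff ℝ (⊤ : ℕ∞) f) :
    ContDiff ℝ (⊤ : ℕ∞) (dL L f) := by
  induction L with
  | nil => exact hf
  | cons j L ih => exact pder_contDiff ih j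

lemma dl_contDiff {f : Euc d → ℝ} (hf : ContDiff ℝ (⊤ : ℕ∞) f) (h : Euc d) :
    ContDiff ℝ (⊤ : ℕ∞) (dl h f) :=
  (hf.comp (contDiff_id.add contDiff_const)).sub hf

lemma pder_dl {f : Euc d → ℝ} (hf : ContDiff ℝ (⊤ : ℕ∞) f) (h : Euc d) (j : Fin d) :
    pder j (dl h f) = dl h (pder j f) := by
  funext x
  unfold pder dl
  have hd := hf.differentiable (by simp)
  have h1 : DifferentiableAt ℝ (fun x => f (x + h)) x := by fun_prop
  rw [fderiv_fun_sub h1 (hd x), fderiv_comp_add_right]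
  simp

lemma dL_dl (L : List (Fin d)) {f : Euc d → ℝ} (hf : ContDiff ℝ (⊤ : ℕ∞) f) (h : Euc d) :
    dL L (dl h f) = dl h (dL L f) := by
  induction L with
  | nil => rfl
  | cons j L ih =>
    show pder j (dL L (dl h f)) = dl h (pder j (dL L f))
    rw [ih, pder_dl (dL_contDiff L hf)]

lemma dL_mul (L : List (Fin d)) {f : Euc d → ℝ} (hf : ContDiff ℝ (⊤ : ℕ∞) f) (a : ℝ) :
    dL L (fun x => a * f x) = fun x => a * dL L f x := by
  induction L with
  | nil => rfl
  | cons j L ih =>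
    funext x
    show pder j (dL L _) x = a * pder j (dL L f) x
    rw [ih, pder_const_mul (dL_contDiff L hf)]

lemma fatou_pder {F : Euc d → ℝ} (hF : ContDiff ℝ (⊤ : ℕ∞) F) (A : Set (Euc d)) (j : Fin d)
    {K : ℝ≥0∞} {t : ℝ} (ht : 0 < t) (h : ∀ s : ℝ, 0 < s → s ≤ t →
      Q A (fun x => s⁻¹ * dl (s • EuclideanSpace.single j (1:ℝ)) F x) ≤ K) : Q A (pder j F) ≤ K := by
  let s : ℕ → ℝ := fun n => t * (1 / ((n : ℝ) + 1))
  have hs0 : ∀ n, 0 < s n := fun n => by positivity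
  have hst : ∀ n, s n ≤ t := fun n => by
    have : 1 / ((n : ℝ) + 1) ≤ 1 := by
      rw [div_le_one (by positivity)]; linarith [n.cast_nonneg (α := ℝ)]
    calc s n ≤ t * 1 := mul_le_mul_of_nonneg_left this ht.le
      _ = t := mul_one t
  have hsl : Tendsto s atTop (𝓝[≠] 0) := by
    refine tendsto_nhdsWithin_iff.2 ⟨?_, Eventually.of_forall fun n => (hs0 n).ne'⟩
    have := (tendsto_one_div_add_atTop_nhds_zero_nat (𝕜 := ℝ)).const_mul t
    rwa [mul_zero] at this
  have hlim : ∀ x, Tendsto (fun n => (s n)⁻¹ * dl (s n • EuclideanSpace.single j (1:ℝ)) F x) atTop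
      (𝓝 (pder j F x)) := by
    intro x
    have h1 := (hF.differentiable (by simp) x).hasFDerivAt.hasLineDerivAt (EuclideanSpace.single j (1:ℝ))
    exact h1.tendsto_slope_zero.comp hsl
  have hFc := hF.continuous
  unfold Q
  calc ∫⁻ x in A, ‖pder j F x‖ₑ ^ 2
      = ∫⁻ x in A, liminf (fun n => ‖(s n)⁻¹ * dl (s n • EuclideanSpace.single j (1:ℝ)) F x‖ₑ ^ 2) atTop := by
        refine lintegral_congr fun x => ?_
        have := (ENNReal.continuous_pow 2).continuousAt.tendsto.comp (hlim x).enorm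
        exact this.liminf_eq.symm
    _ ≤ liminf (fun n => ∫⁻ x in A, ‖(s n)⁻¹ * dl (s n • EuclideanSpace.single j (1:ℝ)) F x‖ₑ ^ 2) atTop := by
        refine lintegral_liminf_le fun n => ?_
        have : Continuous fun x => (s n)⁻¹ * dl (s n • EuclideanSpace.single j (1:ℝ)) F x := by
          unfold dl; fun_prop
        exact (this.measurable.enorm.pow_const 2)
    _ ≤ K := by
        refine liminf_le_of_le (by isBoundedDefault) fun b hb => ?_
        obtain ⟨n, hn⟩ := hb.exists
        exact hn.trans (h (s n) (hs0 n) (hst n))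

theorem M2 {K : ℝ} (hK : 0 ≤ K) (L : List (Fin d)) : ∀ {r r' : ℝ}, 0 < r → r < r' →
    ∃ C : ℝ≥0, ∃ δ > 0, ∃ σ0 > 0,
    ∀ (i0 : Fin d) (D : Set (Euc d)) (Y : Set (Fin d)), Dom i0 K D Y → (∀ j ∈ L, j ∈ Y) → ∀
    (lam : ℝ) (u : Euc d → ℝ) (g : Euc d → Euc d), 0 ≤ lam → Sol i0 D lam r' u g →
    ∀ φ : ContDiffBump (0 : Euc d), φ.rOut ≤ σ0 → ∀ c,
    (Q (AB i0 φ.rOut r) (dL L (moll φ (comp lam u g c))) ≤ C * En i0 lam r' u g) ∧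
    (∀ z : Euc d, 0 ≤ z i0 → ‖z‖ ≤ δ →
      Q (AB i0 φ.rOut r) (dl z (dL L (moll φ (comp lam u g c)))) ≤ C * ‖z‖ₑ * En i0 lam r' u g) := by
  induction L with
  | nil =>
    intro r r' hr hrr
    obtain ⟨C, δ, hδ, σ0, hσ0, h⟩ := M1 (d := d) hr hrr hK
    exact ⟨C, δ, hδ, σ0, hσ0, fun i0 D Y hD _ => h i0 D Y hD⟩
  | cons j L ih =>
    intro r r' hr hrr
    set r1 := (r + r') / 2 with hr1
    obtain ⟨C, δ, hδ, σ0, hσ0, h⟩ := ih (r := r) (r' := r1) hr (by linarith)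
    obtain ⟨Cy, hy⟩ := ydiff (d := d) (r := r1) (r' := r') (by linarith) (by linarith)
    refine ⟨C * Cy, δ, hδ, σ0, hσ0, fun i0 D Y hD hL lam u g hl s φ hφ c => ?_⟩
    have hjY : j ∈ Y := hL j (by simp)
    have hj : i0 ≠ j := fun h => hD.ne (h ▸ hjY)
    have sm := moll_contDiff φ (comp_memLp (lam := lam) s.lu s.lg c)
    have ht : 0 < (r' - r1) / 2 := by linarith
    have key : ∀ t : ℝ, 0 < t → t ≤ (r' - r1) / 2 →
        (Q (AB i0 φ.rOut r) (fun x => t⁻¹ * dl (t • EuclideanSpace.single j (1:ℝ))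
          (dL L (moll φ (comp lam u g c))) x) ≤ (C * Cy : ℝ≥0) * En i0 lam r' u g) ∧
        (∀ z : Euc d, 0 ≤ z i0 → ‖z‖ ≤ δ →
          Q (AB i0 φ.rOut r) (fun x => t⁻¹ * dl (t • EuclideanSpace.single j (1:ℝ))
          (dl z (dL L (moll φ (comp lam u g c)))) x) ≤ (C * Cy : ℝ≥0) * ‖z‖ₑ * En i0 lam r' u g) := by
      intro t ht0 htt
      set h' : Euc d := t • EuclideanSpace.single j (1:ℝ) with hh'
      have hn : ‖h'‖ = t := by rw [hh', norm_smul]; simp [ht0.le]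
      have hi : h' i0 = 0 := by simp [hh', hj]
      have inv1 : ∀ x ∈ D, x + h' ∈ D := hD.inv j hjY t
      have inv2 : ∀ x ∈ D, x - h' ∈ D := fun x hx => by
        have := hD.inv j hjY (-t) x hx
        rwa [neg_smul, ← sub_eq_add_neg] at this
      have s1 := (s.dly hi inv1 inv2 (r := r1) (by rw [hn]; linarith)).smul t⁻¹
      have e1 := hy i0 D lam u g hl s h' hi inv1 inv2 (by rw [hn]; exact htt)
      have e2 : En i0 lam r1 (fun x => t⁻¹ * dl h' u x) (fun x => t⁻¹ • dl h' g x) ≤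
          Cy * En i0 lam r' u g := by
        rw [En_smul]
        have e3 : ENNReal.ofReal (t⁻¹ ^ 2) * ‖h'‖ₑ ^ 2 = 1 := by
          rw [← ofReal_norm, hn, ← ENNReal.ofReal_pow ht0.le, ← ENNReal.ofReal_mul (by positivity),
            ← mul_pow, inv_mul_cancel₀ ht0.ne', one_pow, ENNReal.ofReal_one]
        calc _ ≤ ENNReal.ofReal (t⁻¹ ^ 2) * (Cy * ‖h'‖ₑ ^ 2 * En i0 lam r' u g) := by gcongr
          _ = (ENNReal.ofReal (t⁻¹ ^ 2) * ‖h'‖ₑ ^ 2) * (Cy * En i0 lam r' u g) := by ring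
          _ = _ := by rw [e3, one_mul]
      have e4 := h i0 D Y hD (fun j hj => hL j (by simp [hj])) lam _ _ hl s1 φ hφ c
      have e5 : dL L (moll φ (comp lam (fun x => t⁻¹ * dl h' u x) (fun x => t⁻¹ • dl h' g x) c)) =
          fun x => t⁻¹ * dl h' (dL L (moll φ (comp lam u g c))) x := by
        rw [comp_smul, moll_mul, comp_dl, ← moll_dl φ (comp_memLp s.lu s.lg c),
          dL_mul L (dl_contDiff sm h'), dL_dl L sm]
      rw [e5] at e4
      refine ⟨e4.1.trans ?_, fun z hz0 hz => ?_⟩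
      · push_cast
        rw [mul_assoc]
        gcongr
      · have e6 : (fun x => t⁻¹ * dl h' (dl z (dL L (moll φ (comp lam u g c)))) x) =
          dl z (fun x => t⁻¹ * dl h' (dL L (moll φ (comp lam u g c))) x) := by
          funext x
          simp only [dl]
          rw [show x + h' + z = x + z + h' by abel]
          ring
        rw [e6]
        refine (e4.2 z hz0 hz).trans ?_
        calc _ ≤ C * ‖z‖ₑ * (Cy * En i0 lam r' u g) := by gcongr
          _ = _ := by push_cast; ring
    refine ⟨?_, fun z hz0 hz => ?_⟩
    · exact fatou_pder (dL_contDiff L sm) _ j ht fun t h1 h2 => (key t h1 h2).1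
    · show Q _ (dl z (pder j (dL L _))) ≤ _
      rw [← pder_dl (dL_contDiff L sm)]
      exact fatou_pder (dl_contDiff (dL_contDiff L sm) z) _ j ht fun t h1 h2 => (key t h1 h2).2 z hz0 hz

end m2
end RH
end

section
open Set Filter MeasureTheory Metric Topology
open scoped ENNReal NNReal

namespace RH

lemma lp_abs (N : ℕ) (hN : 1 ≤ N) {p : ℝ} (hp1 : 1 ≤ p) (hp : (N : ℝ) * p < 2 * (N + 1)) {C1 : ℝ} (hC1 : 0 < C1)
    (V : ℝ≥0) : ∃ C : ℝ≥0, ∀ {X : Type} [MeasurableSpace X] (μ : Measure X), μ univ ≤ V →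
    ∀ (f : X → ℝ) (b s : ℕ → X → ℝ), (∀ i, Measurable (s i)) → Measurable f →
    (∀ᵐ x ∂μ, ∀ i, f x = b i x + s i x ∧ |b i x| ≤ C1 * 2 ^ (i * N)) →
    (∀ i, ∫⁻ x, ‖s i x‖ₑ ^ 2 ∂μ ≤ ENNReal.ofReal (C1 * (1/4) ^ i)) →
    ∫⁻ x, ‖f x‖ₑ ^ p ∂μ ≤ C := by
  have hp0 : 0 < p := by linarith
  set ρ : ℝ := (2:ℝ) ^ ((N : ℝ) * p) / 4 ^ (N + 1) with hρ
  have hρ0 : 0 ≤ ρ := by positivity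
  have hρ1 : ρ < 1 := by
    rw [hρ, div_lt_one (by positivity)]
    calc (2:ℝ) ^ ((N : ℝ) * p) < (2:ℝ) ^ (2 * ((N:ℝ) + 1)) := Real.rpow_lt_rpow_of_exponent_lt (by norm_num) hp
      _ = 4 ^ (N + 1) := by
        rw [Real.rpow_mul (by norm_num)]
        norm_num
        rw [← Real.rpow_natCast]
        push_cast
        rfl
  set c : ℝ := (2 * C1 * 2 ^ N) ^ p * C1⁻¹ with hc
  have hsum : Summable fun i : ℕ => c * ρ ^ i := (summable_geometric_of_lt_one hρ0 hρ1).mul_left c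
  have hfin : ∑' i : ℕ, ENNReal.ofReal (c * ρ ^ i) ≠ ⊤ := hsum.tsum_ofReal_ne_top
  refine ⟨(ENNReal.ofReal (2 * C1) ^ p * V + ∑' i : ℕ, ENNReal.ofReal (c * ρ ^ i)).toNNReal, ?_⟩
  intro X _ μ hμ f b s ms mf hdec hs
  rw [ENNReal.coe_toNNReal (by finiteness)]
  let a : ℕ → ℝ := fun i => C1 * 2 ^ (i * N)
  have ha : ∀ i, 0 < a i := fun i => by positivity
  let S : ℕ → Set X := fun i => {x | 2 * a i < |f x|}
  have mS : ∀ i, MeasurableSet (S i) := fun i => measurableSet_lt measurable_const mf.norm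
  have hpt : ∀ x, ‖f x‖ₑ ^ p ≤ ENNReal.ofReal (2 * C1) ^ p +
      ∑' i, (S i).indicator (fun _ => ENNReal.ofReal (2 * a (i + 1)) ^ p) x := by
    intro x
    have hex : ∃ i : ℕ, |f x| ≤ 2 * a i := by
      obtain ⟨i, hi⟩ := pow_unbounded_of_one_lt (|f x| / (2 * C1)) (one_lt_two (α := ℝ))
      refine ⟨i, ?_⟩
      rw [div_lt_iff₀ (by positivity)] at hi
      have : (2:ℝ) ^ i ≤ 2 ^ (i * N) := pow_le_pow_right₀ (by norm_num) (Nat.le_mul_of_pos_right i (by omega))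
      simp only [a]
      nlinarith
    classical
    have hfx : ‖f x‖ₑ = ENNReal.ofReal |f x| := Real.enorm_eq_ofReal_abs _
    rw [hfx]
    rcases Nat.eq_zero_or_pos (Nat.find hex) with h0 | h0
    · have := Nat.find_spec hex
      rw [h0] at this
      refine le_trans ?_ le_self_add
      gcongr
      simpa [a] using this
    · obtain ⟨k, hk⟩ : ∃ k, Nat.find hex = k + 1 := ⟨Nat.find hex - 1, by omega⟩
      have h1 := Nat.find_spec hex
      have h2 := Nat.find_min hex (m := k) (by omega)
      rw [hk] at h1
      rw [not_le] at h2
      refine le_trans ?_ le_add_self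
      refine le_trans ?_ (ENNReal.le_tsum k)
      rw [indicator_of_mem (show x ∈ S k from h2)]
      gcongr
  have hmS : ∀ i, μ (S i) ≤ ENNReal.ofReal (C1⁻¹ * (1 / 4 ^ (N+1)) ^ i) := by
    intro i
    have h1 : μ (S i) ≤ μ {x | ENNReal.ofReal (a i ^ 2) ≤ ‖s i x‖ₑ ^ 2} := by
      refine measure_mono_ae ?_
      filter_upwards [hdec] with x hx hxS
      have hxS : 2 * a i < |f x| := hxS
      obtain ⟨h1, h2⟩ := hx i
      show ENNReal.ofReal (a i ^ 2) ≤ ‖s i x‖ₑ ^ 2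
      rw [Real.enorm_eq_ofReal_abs, ← ENNReal.ofReal_pow (abs_nonneg _)]
      refine ENNReal.ofReal_le_ofReal ?_
      have : a i ≤ |s i x| := by
        have h3 := abs_add_le (b i x) (s i x)
        rw [← h1] at h3
        simp only [a] at hxS ⊢
        linarith
      exact pow_le_pow_left₀ (ha i).le this 2
    have h2 := mul_meas_ge_le_lintegral (μ := μ) (f := fun x => ‖s i x‖ₑ ^ 2) ((ms i).enorm.pow_const 2)
      (ENNReal.ofReal (a i ^ 2))
    have h3 := h2.trans (hs i)
    have h4 : 0 < a i ^ 2 := pow_pos (ha i) 2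
    refine h1.trans ?_
    rw [mul_comm, ← ENNReal.le_div_iff_mul_le (Or.inl (ENNReal.ofReal_pos.2 h4).ne') (Or.inl (by simp)),
      ← ENNReal.ofReal_div_of_pos h4] at h3
    refine h3.trans (ENNReal.ofReal_le_ofReal (le_of_eq ?_))
    simp only [a]
    have : (4:ℝ) ^ (N + 1) = 4 * (2 ^ N) ^ 2 := by
      rw [pow_succ, ← pow_mul, mul_comm N 2, pow_mul]; norm_num; ring
    rw [this, mul_comm i N, pow_mul]
    field_simp
    rw [← pow_mul, mul_comm i 2, pow_mul, ← mul_pow]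
    congr 1
    field_simp
  calc ∫⁻ x, ‖f x‖ₑ ^ p ∂μ ≤ ∫⁻ x, (ENNReal.ofReal (2 * C1) ^ p +
      ∑' i, (S i).indicator (fun _ => ENNReal.ofReal (2 * a (i + 1)) ^ p) x) ∂μ := lintegral_mono hpt
    _ = ENNReal.ofReal (2 * C1) ^ p * μ univ + ∑' i, ENNReal.ofReal (2 * a (i + 1)) ^ p * μ (S i) := by
      rw [lintegral_add_left measurable_const, lintegral_const, lintegral_tsum]
      · congr 2
        funext i
        rw [lintegral_indicator_const (mS i)]
      · exact fun i => (measurable_const.indicator (mS i)).aemeasurable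
    _ ≤ _ := by
      gcongr with i
      refine (mul_le_mul_right (hmS i) _).trans (le_of_eq ?_)
      rw [ENNReal.ofReal_rpow_of_pos (by have := ha (i+1); positivity), ← ENNReal.ofReal_mul (by positivity)]
      congr 1
      simp only [a, hc, hρ]
      have : 2 * (C1 * 2 ^ ((i + 1) * N)) = (2 * C1 * 2 ^ N) * (2 ^ N) ^ i := by
        rw [add_mul, one_mul, pow_add, mul_comm i N, pow_mul]; ring
      rw [this, Real.mul_rpow (by positivity) (by positivity)]
      have e2 : (((2:ℝ) ^ N) ^ i) ^ p = ((2:ℝ) ^ ((N:ℝ) * p)) ^ i := by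
        rw [← Real.rpow_natCast, ← Real.rpow_natCast, ← Real.rpow_natCast, ← Real.rpow_mul (by norm_num),
          ← Real.rpow_mul (by norm_num), ← Real.rpow_mul (by norm_num)]
        ring_nf
      rw [e2]
      simp only [div_pow, one_pow]
      ring

end RH
end

section
open Set Filter MeasureTheory Metric Topology
open scoped ENNReal NNReal

namespace RH
section boxes
variable {d : ℕ}

/-- half-open box with lower corner `x` and sides `a` -/
def Bx (x : Euc d) (a : Fin d → ℝ) : Set (Euc d) := {w | ∀ i, x i < w i ∧ w i ≤ x i + a i}

lemma Bx_meas (x : Euc d) (a : Fin d → ℝ) : MeasurableSet (Bx x a) := by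
  have : Bx x a = ⋂ i, ({w | x i < w i} ∩ {w | w i ≤ x i + a i}) := by
    ext w; simp [Bx]
  rw [this]
  exact MeasurableSet.iInter fun i => (measurableSet_lt measurable_const (measurable_coord i)).inter
    (measurableSet_le (measurable_coord i) measurable_const)

lemma Bx_mono (x : Euc d) {a b : Fin d → ℝ} (h : ∀ i, a i ≤ b i) : Bx x a ⊆ Bx x b :=
  fun w hw i => ⟨(hw i).1, (hw i).2.trans (by linarith [h i])⟩

lemma Bx_volume (x : Euc d) (a : Fin d → ℝ) : volume (Bx x a) = ∏ i, ENNReal.ofReal (a i) := by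
  have h := (EuclideanSpace.volume_preserving_symm_measurableEquiv_toLp (Fin d)).symm
  have : Bx x a = (MeasurableEquiv.toLp 2 (Fin d → ℝ)).symm ⁻¹' (Set.pi univ fun i => Ioc (x i) (x i + a i)) := by
    ext w; simp [Bx]
  rw [this, (EuclideanSpace.volume_preserving_symm_measurableEquiv_toLp (Fin d)).measure_preimage
    (MeasurableSet.univ_pi fun i => measurableSet_Ioc).nullMeasurableSet, Real.volume_pi_Ioc]
  simp

lemma norm_le_box {v : Euc d} {t : ℝ} (h : ∀ i, |v i| ≤ t) : ‖v‖ ≤ d * t := by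
  have h1 : v = ∑ i, v i • EuclideanSpace.single i (1:ℝ) := by
    ext j
    simp [Finset.sum_apply, Pi.single_apply]
  calc ‖v‖ = ‖∑ i, v i • EuclideanSpace.single i (1:ℝ)‖ := by rw [← h1]
    _ ≤ ∑ i, ‖v i • EuclideanSpace.single i (1:ℝ)‖ := norm_sum_le _ _
    _ ≤ ∑ i : Fin d, t := Finset.sum_le_sum fun i _ => by
      rw [norm_smul]; simpa using h i
    _ = d * t := by simp

lemma Bx_sub {i0 : Fin d} {σ r r' t : ℝ} {x : Euc d} (hx : x ∈ AB i0 σ r) {a : Fin d → ℝ} (ha : ∀ i, a i ≤ t)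
    (hr : r + d * t ≤ r') : Bx x a ⊆ AB i0 σ r' := by
  intro w hw
  have hn : ‖w - x‖ ≤ d * t := norm_le_box fun i => by
    have := hw i
    have := ha i
    simp only [PiLp.sub_apply]
    rw [abs_le]
    constructor <;> linarith
  have := AB_shift (i0 := i0) (σ := σ) (r := r) (r' := r') (h := w - x)
    (by have := (hw i0).1; simp only [PiLp.sub_apply]; linarith) (by linarith) x hx
  simpa using this

lemma halve (x : Euc d) (a : Fin d → ℝ) (i : Fin d) {s : ℝ} (hs : 0 ≤ s) {h : Euc d → ℝ} (hh : Measurable h) :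
    5 * Q (Bx x (Function.update a i s)) h ≤ 3 * Q (Bx x (Function.update a i (2 * s))) h +
      6 * Q (Bx x (Function.update a i s)) (dl (s • EuclideanSpace.single i (1:ℝ)) h) := by
  set W := Bx x (Function.update a i s) with hW
  set Z := Bx x (Function.update a i (2*s)) with hZ
  set e : Euc d := s • EuclideanSpace.single i (1:ℝ) with he
  have hei : e i = s := by simp [he]
  have hej : ∀ j, j ≠ i → e j = 0 := fun j hj => by simp [he, hj]
  by_cases hfin : Q Z h = ⊤
  · rw [hfin]; simp
  set Y := Q W (fun w => h (w + e)) with hY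
  have h1 : 2 * Q W h ≤ 3 * Y + 6 * Q W (dl e h) := by
    rw [hY]; unfold Q
    rw [← lintegral_const_mul' _ _ (by simp), ← lintegral_const_mul' _ _ (by simp),
      ← lintegral_const_mul' _ _ (by simp),
      ← lintegral_add_left (by fun_prop)]
    refine lintegral_mono fun w => ?_
    simp only [dl, Real.enorm_eq_ofReal_abs]
    generalize h (w + e) = α
    generalize h w = β
    rw [← ENNReal.ofReal_pow (abs_nonneg _), ← ENNReal.ofReal_pow (abs_nonneg _),
      ← ENNReal.ofReal_pow (abs_nonneg _), sq_abs, sq_abs, sq_abs,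
      show (2:ℝ≥0∞) = ENNReal.ofReal 2 by simp, show (3:ℝ≥0∞) = ENNReal.ofReal 3 by simp,
      show (6:ℝ≥0∞) = ENNReal.ofReal 6 by simp,
      ← ENNReal.ofReal_mul (by norm_num), ← ENNReal.ofReal_mul (by norm_num),
      ← ENNReal.ofReal_mul (by norm_num), ← ENNReal.ofReal_add (by positivity) (by positivity)]
    refine ENNReal.ofReal_le_ofReal ?_
    nlinarith [sq_nonneg (3 * α - 2 * β)]
  have hWZ : W ⊆ Z := Bx_mono x fun j => by
    by_cases hj : j = i
    · subst hj; simp; linarith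
    · simp [hj]
  have mZ2 : MeasurableSet (Z ∩ {w | x i + s < w i}) :=
    (Bx_meas _ _).inter (measurableSet_lt measurable_const (measurable_coord i))
  have h2 : Q W h + Y ≤ Q Z h := by
    have : Y ≤ Q (Z ∩ {w | x i + s < w i}) h := by
      refine Q_shift (Bx_meas _ _) mZ2 e (fun w hw => ⟨fun j => ?_, ?_⟩) h
      · have := hw j
        by_cases hj : j = i
        · subst hj
          simp only [Function.update_self, PiLp.add_apply, hei] at this ⊢
          constructor <;> linarith
        · simp only [Function.update_of_ne hj, PiLp.add_apply, hej j hj] at this ⊢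
          simpa using this
      · have := (hw i).1
        show x i + s < (w + e) i
        simp only [PiLp.add_apply, hei]; linarith
    refine (add_le_add_right this _).trans ?_
    unfold Q
    rw [← lintegral_union mZ2]
    · exact lintegral_mono_set (union_subset hWZ inter_subset_left)
    · rw [Set.disjoint_left]
      rintro w hw ⟨_, hw2⟩
      have := (hw i).2
      simp only [Function.update_self] at this
      have hw2 : x i + s < w i := hw2
      linarith
  have hYf : Y ≠ ⊤ := fun hc => hfin (top_le_iff.1 (by rw [← hc]; exact le_add_self.trans h2))
  have h3 : 5 * Q W h + 3 * Y ≤ (3 * Q Z h + 6 * Q W (dl e h)) + 3 * Y := by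
    calc 5 * Q W h + 3 * Y = 3 * (Q W h + Y) + 2 * Q W h := by ring
      _ ≤ 3 * Q Z h + (3 * Y + 6 * Q W (dl e h)) := by gcongr
      _ = _ := by ring
  exact (ENNReal.add_le_add_iff_right (by finiteness)).1 h3

/-- set side lengths in the directions of `J` -/
def sd (J : List (Fin d)) (t : ℝ) (a : Fin d → ℝ) : Fin d → ℝ := fun i => if i ∈ J then t else a i

lemma stepB (x : Euc d) {i0 i1 : Fin d} (hi : i0 ≠ i1) {l : ℝ} (hl : 0 < l) {h : Euc d → ℝ} (hh : Measurable h)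
    {C : ℝ} (hC : 0 ≤ C) (h0 : Q (Bx x fun _ => 2 * l) h ≤ ENNReal.ofReal C)
    (hD : ∀ i, i = i0 ∨ i = i1 → ∀ s, 0 ≤ s → s ≤ l →
      Q (Bx x fun _ => 2 * l) (dl (s • EuclideanSpace.single i (1:ℝ)) h) ≤ ENNReal.ofReal (C * s)) (n : ℕ) :
    Q (Bx x (sd [i0, i1] (2 * l * (1/2) ^ n) fun _ => 2 * l)) h ≤ ENNReal.ofReal ((C + 14 * C * l) * (1/2) ^ n) := by
  induction n with
  | zero =>
    refine (Q_mono_set (Bx_mono x fun i => ?_) h).trans (h0.trans (ENNReal.ofReal_le_ofReal ?_))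
    · simp [sd]
    · have : 0 ≤ C * l := by positivity
      simp; linarith
  | succ n ih =>
    set q : ℝ := (1/2) ^ n with hq
    have hq0 : 0 < q := by positivity
    have hq1 : q ≤ 1 := pow_le_one₀ (by norm_num) (by norm_num)
    set s : ℝ := l * q with hs
    have hs0 : 0 ≤ s := by positivity
    have hsl : s ≤ l := by nlinarith
    have e1 : 2 * l * (1/2) ^ (n+1) = s := by rw [pow_succ]; simp only [hs, hq]; ring
    have e2 : 2 * l * q = 2 * s := by simp only [hs]; ring
    rw [e2] at ih
    rw [e1]
    have b1 : sd [i0, i1] s (fun _ => 2 * l) = Function.update (Function.update (fun _ => 2 * l) i1 s) i0 s := by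
      funext i
      by_cases h1 : i = i0
      · simp [sd, h1]
      · by_cases h2 : i = i1
        · simp [sd, h2, hi.symm]
        · simp [sd, h1, h2]
    have b2 : sd [i0, i1] (2 * s) (fun _ => 2 * l) =
        Function.update (Function.update (fun _ => 2 * l) i0 (2*s)) i1 (2*s) := by
      funext i
      by_cases h1 : i = i0
      · simp [sd, h1, hi]
      · by_cases h2 : i = i1
        · simp [sd, h2]
        · simp [sd, h1, h2]
    have b3 : Function.update (Function.update (fun _ => 2 * l) i1 s) i0 (2 * s) =
        Function.update (Function.update (fun _ => 2 * l) i0 (2*s)) i1 s :=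
      Function.update_comm hi.symm _ _ _
    have H1 := halve x (Function.update (fun _ => 2 * l) i1 s) i0 hs0 hh
    have H2 := halve x (Function.update (fun _ => 2 * l) i0 (2*s)) i1 hs0 hh
    rw [b3] at H1
    rw [← b1] at H1
    rw [← b2] at H2
    have D1 := (Q_mono_set (Bx_mono x (a := sd [i0, i1] s fun _ => 2 * l) (b := fun _ => 2 * l) (fun i => by
      unfold sd; split_ifs <;> linarith)) _).trans (hD i0 (Or.inl rfl) s hs0 hsl)
    have D2 := (Q_mono_set (Bx_mono x (a := Function.update (Function.update (fun _ => 2 * l) i0 (2*s)) i1 s)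
      (b := fun _ => 2 * l) (fun i => by
        simp only [Function.update_apply]; split_ifs <;> linarith)) _).trans (hD i1 (Or.inr rfl) s hs0 hsl)
    generalize Q (Bx x (sd [i0, i1] s fun _ => 2 * l)) h = X at *
    generalize Q (Bx x (Function.update (Function.update (fun _ => 2 * l) i0 (2*s)) i1 s)) h = X' at *
    have H3 : 25 * X ≤ ENNReal.ofReal (9 * ((C + 14 * C * l) * q) + 48 * (C * s)) := by
      calc 25 * X = 5 * (5 * X) := by ring
        _ ≤ 5 * (3 * X' + 6 * ENNReal.ofReal (C * s)) := by
          gcongr; exact H1.trans (by gcongr)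
        _ = 3 * (5 * X') + 30 * ENNReal.ofReal (C * s) := by ring
        _ ≤ 3 * (3 * ENNReal.ofReal ((C + 14 * C * l) * q) + 6 * ENNReal.ofReal (C * s)) + 30 * ENNReal.ofReal (C * s) := by
          gcongr; exact H2.trans (by gcongr)
        _ = ENNReal.ofReal 9 * ENNReal.ofReal ((C + 14 * C * l) * q) + ENNReal.ofReal 48 * ENNReal.ofReal (C * s) := by
          rw [show ENNReal.ofReal 9 = 9 by simp, show ENNReal.ofReal 48 = 48 by simp]; ring
        _ = _ := by
          rw [← ENNReal.ofReal_mul (by norm_num), ← ENNReal.ofReal_mul (by norm_num),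
            ← ENNReal.ofReal_add (by positivity) (by positivity)]
    have H4 : 25 * X ≤ 25 * ENNReal.ofReal ((C + 14 * C * l) * (1/2) ^ (n+1)) := by
      refine H3.trans ?_
      rw [show (25:ℝ≥0∞) = ENNReal.ofReal 25 by simp, ← ENNReal.ofReal_mul (by norm_num)]
      refine ENNReal.ofReal_le_ofReal ?_
      rw [pow_succ, ← hq, hs]
      have : 0 ≤ C * l * q := by positivity
      have : 0 ≤ C * q := by positivity
      nlinarith
    exact (ENNReal.mul_le_mul_iff_right (by norm_num) (by norm_num)).1 H4

end boxes
end RH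
end

section
open Set Filter MeasureTheory Metric Topology
open scoped ENNReal NNReal

namespace RH
section stepA
variable {d : ℕ}

lemma tonelli_box (x : Euc d) (a : Fin d → ℝ) (j : Fin d) {t l : ℝ} (htl : t ≤ l)
    {F : Euc d → ℝ≥0∞} (hF : Measurable F) :
    ∫⁻ w in Bx x (Function.update a j t), ∫⁻ s in Ioc (0:ℝ) l, F (w + s • EuclideanSpace.single j (1:ℝ))
      ≤ ENNReal.ofReal t * ∫⁻ w in Bx x (Function.update a j (2 * l)), F w := by
  set W := Bx x (Function.update a j t) with hW
  set Z := Bx x (Function.update a j (2 * l)) with hZ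
  set e : Euc d := EuclideanSpace.single j (1:ℝ) with he
  have mW : MeasurableSet W := Bx_meas _ _
  have mZ : MeasurableSet Z := Bx_meas _ _
  have mF : Measurable fun q : Euc d × ℝ => F (q.1 + q.2 • e) := by fun_prop
  have mI : Measurable fun q : ℝ × Euc d => W.indicator 1 (q.2 - q.1 • e) * F q.2 := by
    refine Measurable.mul ?_ (hF.comp measurable_snd)
    exact (measurable_one.indicator mW).comp (by fun_prop)
  rw [lintegral_lintegral_swap (by exact mF.aemeasurable)]
  have h1 : ∀ s : ℝ, ∫⁻ w in W, F (w + s • e) = ∫⁻ v, W.indicator 1 (v - s • e) * F v := by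
    intro s
    rw [← lintegral_indicator mW, ← lintegral_add_right_eq_self (fun v => W.indicator 1 (v - s • e) * F v) (s • e)]
    refine lintegral_congr fun w => ?_
    by_cases hw : w ∈ W <;> simp [hw]
  simp only [h1]
  rw [lintegral_lintegral_swap (by exact mI.aemeasurable), ← lintegral_const_mul _ hF, ← lintegral_indicator mZ]
  refine lintegral_mono fun v => ?_
  rw [lintegral_mul_const _ (by exact (measurable_one.indicator mW).comp (by fun_prop))]
  by_cases hv : v ∈ Z
  · rw [indicator_of_mem hv]
    gcongr
    calc ∫⁻ s in Ioc (0:ℝ) l, W.indicator 1 (v - s • e)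
        ≤ ∫⁻ s, (Ico (v j - x j - t) (v j - x j)).indicator 1 s := by
          refine (setLIntegral_le_lintegral _ _).trans (lintegral_mono fun s => ?_)
          by_cases hs : v - s • e ∈ W
          · have := hs j
            simp only [he, Function.update_self, PiLp.sub_apply, PiLp.smul_apply, PiLp.single_apply, if_true, smul_eq_mul, mul_one] at this
            rw [indicator_of_mem (show s ∈ Ico (v j - x j - t) (v j - x j) from ⟨by linarith, by linarith⟩)]
            simp [hs]
          · simp [hs]
      _ = ENNReal.ofReal t := by
        rw [lintegral_indicator_one measurableSet_Ico, Real.volume_Ico]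
        congr 1; ring
  · rw [indicator_of_notMem hv]
    have : ∫⁻ s in Ioc (0:ℝ) l, W.indicator (1 : Euc d → ℝ≥0∞) (v - s • e) = 0 := by
      rw [setLIntegral_congr_fun measurableSet_Ioc (g := fun _ => 0)]
      · simp
      intro s hs
      have : v - s • e ∉ W := by
        intro hw
        apply hv
        intro i
        have := hw i
        by_cases hi : i = j
        · subst hi
          simp only [he, Function.update_self, PiLp.sub_apply, PiLp.smul_apply, PiLp.single_apply, if_true, smul_eq_mul, mul_one] at this ⊢
          constructor <;> linarith [hs.1, hs.2]
        · simpa [he, hi] using this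
      simp [this]
    rw [this, zero_mul]

lemma stepA_pt {h : Euc d → ℝ} (hh : ContDiff ℝ (⊤ : ℕ∞) h) (j : Fin d) {l : ℝ} (hl : 0 < l) (hl1 : l ≤ 1) (w : Euc d) :
    ENNReal.ofReal l * ‖h w‖ₑ ^ 2 ≤ 2 * ∫⁻ s in Ioc (0:ℝ) l, (‖h (w + s • EuclideanSpace.single j (1:ℝ))‖ₑ ^ 2 +
      ‖pder j h (w + s • EuclideanSpace.single j (1:ℝ))‖ₑ ^ 2) := by
  set e : Euc d := EuclideanSpace.single j (1:ℝ) with he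
  have hc : Continuous h := hh.continuous
  have hp : Continuous (pder j h) := (pder_contDiff hh j).continuous
  have mp : Measurable fun s : ℝ => ‖pder j h (w + s • e)‖ₑ :=
    hp.measurable.enorm.comp (by fun_prop)
  set P := ∫⁻ s in Ioc (0:ℝ) l, ‖pder j h (w + s • e)‖ₑ with hP
  set P2 := ∫⁻ s in Ioc (0:ℝ) l, ‖pder j h (w + s • e)‖ₑ ^ 2 with hP2
  have hPP : P ^ 2 ≤ ENNReal.ofReal l * P2 := by
    have := sq_lintegral_le (volume.restrict (Ioc (0:ℝ) l)) mp.aemeasurable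
    simpa [hP, hP2] using this
  have hder : ∀ s : ℝ, HasDerivAt (fun s : ℝ => h (w + s • e)) (pder j h (w + s • e)) s := by
    intro s
    have h1 : HasFDerivAt h (fderiv ℝ h (w + s • e)) (w + s • e) :=
      (hh.differentiable (by simp) _).hasFDerivAt
    have h2 : HasDerivAt (fun s : ℝ => w + s • e) e s := by
      simpa using ((hasDerivAt_id s).smul_const e).const_add w
    exact h1.comp_hasDerivAt s h2
  have hpt : ∀ s ∈ Ioc (0:ℝ) l, ‖h w‖ₑ ^ 2 ≤ 2 * ‖h (w + s • e)‖ₑ ^ 2 + 2 * P ^ 2 := by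
    intro s hs
    refine le_trans ?_ (sq_add_le_enn _ _)
    gcongr
    have := intervalIntegral.integral_eq_sub_of_hasDerivAt (a := 0) (b := s) (fun t _ => hder t)
      (Continuous.intervalIntegrable (by fun_prop) _ _)
    have e1 : h w = h (w + s • e) - ∫ t in (0:ℝ)..s, pder j h (w + t • e) := by
      rw [this]; simp
    rw [e1]
    refine (enorm_sub_le).trans ?_
    gcongr
    rw [intervalIntegral.integral_of_le hs.1.le]
    refine (enorm_integral_le_lintegral_enorm _).trans ?_
    exact lintegral_mono_set (Ioc_subset_Ioc_right hs.2)
  have h3 : ∫⁻ s in Ioc (0:ℝ) l, ‖h w‖ₑ ^ 2 ≤ ∫⁻ s in Ioc (0:ℝ) l, (2 * ‖h (w + s • e)‖ₑ ^ 2 + 2 * P ^ 2) :=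
    setLIntegral_mono' measurableSet_Ioc hpt
  rw [lintegral_add_right _ measurable_const, setLIntegral_const, setLIntegral_const, Real.volume_Ioc, sub_zero,
    lintegral_const_mul' _ _ (by simp)] at h3
  rw [lintegral_add_right _ (by fun_prop), mul_add, mul_comm]
  refine h3.trans (add_le_add le_rfl ?_)
  rw [mul_assoc]
  refine mul_le_mul_right ?_ _
  have hl1' : ENNReal.ofReal l ≤ 1 := by simpa using hl1
  calc P ^ 2 * ENNReal.ofReal l ≤ (ENNReal.ofReal l * P2) * ENNReal.ofReal l := by gcongr
    _ ≤ (1 * P2) * 1 := by gcongr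
    _ = P2 := by simp

lemma stepA (x : Euc d) (a : Fin d → ℝ) (j : Fin d) {t l : ℝ} (ht : 0 < t) (htl : t ≤ l) (hl1 : l ≤ 1)
    {h : Euc d → ℝ} (hh : ContDiff ℝ (⊤ : ℕ∞) h) {K : ℝ≥0∞}
    (h1 : Q (Bx x (Function.update a j (2 * l))) h ≤ K) (h2 : Q (Bx x (Function.update a j (2 * l))) (pder j h) ≤ K) :
    Q (Bx x (Function.update a j t)) h ≤ ENNReal.ofReal (4 * t / l) * K := by
  have hl : 0 < l := ht.trans_le htl
  have hc : Continuous h := hh.continuous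
  have hp : Continuous (pder j h) := (pder_contDiff hh j).continuous
  have hF : Measurable fun v => ‖h v‖ₑ ^ 2 + ‖pder j h v‖ₑ ^ 2 := by fun_prop
  have h3 : ENNReal.ofReal l * Q (Bx x (Function.update a j t)) h ≤ ENNReal.ofReal (4 * t) * K := by
    unfold Q
    rw [← lintegral_const_mul' _ _ (by simp)]
    refine (lintegral_mono fun w => stepA_pt hh j hl hl1 w).trans ?_
    rw [lintegral_const_mul' _ _ (by simp)]
    refine (mul_le_mul_right (tonelli_box x a j htl hF) _).trans ?_
    rw [lintegral_add_left (by fun_prop)]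
    refine (mul_le_mul_right (mul_le_mul_right (add_le_add h1 h2) _) _).trans (le_of_eq ?_)
    rw [ENNReal.ofReal_mul (by norm_num)]
    simp only [ENNReal.ofReal_ofNat]
    ring
  have : ENNReal.ofReal l * Q (Bx x (Function.update a j t)) h ≤ ENNReal.ofReal l * (ENNReal.ofReal (4 * t / l) * K) := by
    rw [← mul_assoc, ← ENNReal.ofReal_mul hl.le, mul_div_cancel₀ _ hl.ne']
    exact h3
  exact (ENNReal.mul_le_mul_iff_right (ENNReal.ofReal_pos.2 hl).ne' (by simp)).1 this

lemma dL_append (L : List (Fin d)) (j : Fin d) (f : Euc d → ℝ) : dL L (pder j f) = dL (L ++ [j]) f := by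
  induction L with
  | nil => rfl
  | cons i L ih => simp only [dL, List.cons_append, ih]

lemma stepA_iter (x : Euc d) {t l : ℝ} (ht : 0 < t) (htl : t ≤ l) (hl1 : l ≤ 1) (J : List (Fin d)) (hJ : J.Nodup) :
    ∀ (a : Fin d → ℝ) {h : Euc d → ℝ}, ContDiff ℝ (⊤ : ℕ∞) h → ∀ {K : ℝ≥0∞},
    (∀ L : List (Fin d), L.length ≤ J.length → (∀ j ∈ L, j ∈ J) → Q (Bx x (sd J (2 * l) a)) (dL L h) ≤ K) →
    Q (Bx x (sd J t a)) h ≤ ENNReal.ofReal (4 * t / l) ^ J.length * K := by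
  induction J with
  | nil =>
    intro a h _ K hK
    have := hK [] (by simp) (by simp)
    have e : sd [] t a = sd [] (2 * l) a := by funext i; simp [sd]
    rw [e]
    simpa [dL] using this
  | cons j J ih =>
    intro a h hh K hK
    obtain ⟨hj, hJ⟩ := List.nodup_cons.1 hJ
    have e1 : sd J (2 * l) (Function.update a j (2 * l)) = sd (j :: J) (2 * l) a := by
      funext i
      by_cases h1 : i = j
      · simp [sd, h1]
      · simp [sd, h1]
    have e2 : sd J t (Function.update a j (2 * l)) = Function.update (sd J t a) j (2 * l) := by
      funext i
      by_cases h1 : i = j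
      · simp [sd, h1, hj]
      · simp [sd, h1]
    have e3 : sd (j :: J) t a = Function.update (sd J t a) j t := by
      funext i
      by_cases h1 : i = j
      · simp [sd, h1]
      · simp [sd, h1]
    have i1 := ih hJ (Function.update a j (2 * l)) hh (K := K) (fun L hL hLJ => by
      rw [e1]; exact hK L (by simp; omega) fun i hi => List.mem_cons_of_mem _ (hLJ i hi))
    have i2 := ih hJ (Function.update a j (2 * l)) (pder_contDiff hh j) (K := K) (fun L hL hLJ => by
      rw [e1, dL_append]; refine hK _ (by simp; omega) fun i hi => ?_
      rw [List.mem_append, List.mem_singleton] at hi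
      rcases hi with hi | hi
      · exact List.mem_cons_of_mem _ (hLJ i hi)
      · subst hi; simp)
    rw [e2] at i1 i2
    rw [e3]
    refine (stepA x (sd J t a) j ht htl hl1 hh i1 i2).trans (le_of_eq ?_)
    rw [List.length_cons, pow_succ]
    ring

end stepA
end RH
end

section
open Set Filter MeasureTheory Metric Topology
open scoped ENNReal NNReal

namespace RH
section loc
variable {d : ℕ}

/-- averaging measure on a small cube -/
noncomputable def nuB (d : ℕ) (t : ℝ) : Measure (Euc d) :=
  (ENNReal.ofReal (t ^ d))⁻¹ • volume.restrict (Bx (0 : Euc d) fun _ => t)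

lemma nuB_univ {t : ℝ} (ht : 0 < t) : nuB d t univ = 1 := by
  have h : 0 < t ^ d := pow_pos ht d
  rw [nuB, Measure.smul_apply, Measure.restrict_apply_univ, Bx_volume]
  simp only [Finset.prod_const, Finset.card_univ, Fintype.card_fin, smul_eq_mul]
  rw [← ENNReal.ofReal_pow ht.le]
  exact ENNReal.inv_mul_cancel (ENNReal.ofReal_pos.2 h).ne' (by simp)

lemma nuB_ae {t : ℝ} : ∀ᵐ z ∂(nuB d t), z ∈ Bx (0 : Euc d) fun _ => t :=
  Measure.ae_smul_measure (ae_restrict_mem (Bx_meas _ _)) _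

lemma nuB_shift {t : ℝ} (x : Euc d) (F : Euc d → ℝ≥0∞) :
    ∫⁻ z, F (x + z) ∂(nuB d t) ≤ (ENNReal.ofReal (t ^ d))⁻¹ * ∫⁻ w in Bx x (fun _ => t), F w := by
  rw [nuB, lintegral_smul_measure, smul_eq_mul]
  refine mul_le_mul_right ?_ _
  simp only [add_comm x]
  refine setLIntegral_shift_le (Bx_meas _ _) (Bx_meas _ _) x (fun z hz i => ?_) F
  have := hz i
  simp only [PiLp.zero_apply, PiLp.add_apply] at this ⊢
  constructor <;> linarith

lemma nuB_int {t : ℝ} (ht : 0 < t) {f : Euc d → ℝ} (hf : Continuous f) (x : Euc d) :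
    Integrable (fun z => f (x + z)) (nuB d t) := by
  unfold nuB
  refine Integrable.smul_measure ?_ (ENNReal.inv_ne_top.2 (ENNReal.ofReal_pos.2 (pow_pos ht d)).ne')
  have hsub : Bx (0 : Euc d) (fun _ => t) ⊆ closedBall 0 (d * t) := by
    intro z hz
    rw [mem_closedBall_zero_iff]
    refine norm_le_box fun i => ?_
    have := hz i
    simp only [PiLp.zero_apply] at this
    rw [abs_le]; constructor <;> linarith
  refine IntegrableOn.mono_set ?_ hsub
  exact (Continuous.continuousOn (by fun_prop)).integrableOn_compact (isCompact_closedBall _ _)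

lemma cube_bound {i0 i1 : Fin d} (hi : i0 ≠ i1) {J : List (Fin d)} (hJ : J.Nodup) (h0J : i0 ∉ J) (h1J : i1 ∉ J)
    {C : ℝ≥0} {δ l : ℝ} (hl : 0 < l) (hl1 : l ≤ 1) (hlδ : l ≤ δ) (hld : d * (2 * l) ≤ 1 / 4)
    (σ : ℝ) {f : Euc d → ℝ} (hf : ContDiff ℝ (⊤ : ℕ∞) f)
    (H : ∀ L : List (Fin d), L.length ≤ J.length → (∀ j ∈ L, j ∈ J) →
      Q (AB i0 σ (3/4)) (dL L f) ≤ C ∧ ∀ z : Euc d, 0 ≤ z i0 → ‖z‖ ≤ δ →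
        Q (AB i0 σ (3/4)) (dl z (dL L f)) ≤ C * ‖z‖ₑ) (i : ℕ) {x : Euc d} (hx : x ∈ AB i0 σ (1/2)) :
    Q (Bx x fun _ => l * (1/4) ^ i) f ≤
      ENNReal.ofReal (4 ^ J.length * (C + 14 * C * l) * ((1/4) ^ i) ^ (J.length + 1)) := by
  set q : ℝ := (1/4) ^ i with hq
  have hq0 : 0 < q := by positivity
  have hq1 : q ≤ 1 := pow_le_one₀ (by norm_num) (by norm_num)
  set t := l * q with ht
  have ht0 : 0 < t := by positivity
  have htl : t ≤ l := by nlinarith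
  have hqq : (1/2 : ℝ) ^ (2 * i + 1) = q / 2 := by
    rw [pow_succ, pow_mul, hq]; norm_num; ring
  have e1 : 2 * l * (1/2) ^ (2 * i + 1) = t := by rw [hqq, ht]; ring
  have hsub : Bx x (fun _ => 2 * l) ⊆ AB i0 σ (3/4) := Bx_sub hx (t := 2 * l) (fun _ => le_rfl) (by linarith)
  have key : ∀ L : List (Fin d), L.length ≤ J.length → (∀ j ∈ L, j ∈ J) →
      Q (Bx x (sd [i0, i1] t fun _ => 2 * l)) (dL L f) ≤ ENNReal.ofReal ((C + 14 * C * l) * (q / 2)) := by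
    intro L hL hLJ
    obtain ⟨H1, H2⟩ := H L hL hLJ
    have := stepB x hi hl (h := dL L f) (dL_contDiff L hf).continuous.measurable (C := C) C.2
      ((Q_mono_set hsub _).trans (by simpa using H1)) (fun j hj s hs hsl => by
        refine (Q_mono_set hsub _).trans ?_
        have hn : ‖s • EuclideanSpace.single j (1:ℝ)‖ = s := by
          rw [norm_smul]; simp [abs_of_nonneg hs]
        refine (H2 (s • EuclideanSpace.single j (1:ℝ)) ?_ (by rw [hn]; linarith)).trans (le_of_eq ?_)
        · simp only [PiLp.smul_apply, PiLp.single_apply, smul_eq_mul]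
          split_ifs <;> simp [hs]
        · rw [ENNReal.ofReal_mul C.coe_nonneg, ← ofReal_norm, hn]; simp) (2 * i + 1)
    rw [e1, hqq] at this
    exact this
  have hA := stepA_iter x ht0 htl hl1 J hJ (sd [i0, i1] t fun _ => 2 * l) hf (fun L hL hLJ =>
    (Q_mono_set (Bx_mono x fun j => ?_) _).trans (key L hL hLJ))
  · refine (Q_mono_set (Bx_mono x fun j => ?_) f).trans (hA.trans ?_)
    · unfold sd; split_ifs <;> linarith
    · rw [← ENNReal.ofReal_pow (by positivity), ← ENNReal.ofReal_mul (by positivity)]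
      refine ENNReal.ofReal_le_ofReal ?_
      have : 4 * t / l = 4 * q := by rw [ht]; field_simp
      rw [this, mul_pow, pow_succ]
      have : 0 ≤ 4 ^ J.length * q ^ J.length * (C + 14 * C * l) * q := by positivity
      nlinarith
  · unfold sd
    split_ifs with h1 h2
    · exfalso
      simp only [List.mem_cons, List.not_mem_nil, or_false] at h2
      rcases h2 with h2 | h2
      · exact h0J (h2 ▸ h1)
      · exact h1J (h2 ▸ h1)
    · exact le_rfl
    · exact le_rfl
    · exact le_rfl

theorem loc_bound {i0 i1 : Fin d} (hi : i0 ≠ i1) {J : List (Fin d)} (hJ : J.Nodup) (h0J : i0 ∉ J) (h1J : i1 ∉ J)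
    {N : ℕ} (hN : 1 ≤ N) (hNd : d = J.length + 1 + N) {p : ℝ} (hp1 : 1 ≤ p) (hp : (N : ℝ) * p < 2 * (N + 1))
    (C : ℝ≥0) {δ : ℝ} (hδ : 0 < δ) : ∃ C' : ℝ≥0, ∀ (σ : ℝ) (f : Euc d → ℝ), ContDiff ℝ (⊤ : ℕ∞) f →
    (∀ L : List (Fin d), L.length ≤ J.length → (∀ j ∈ L, j ∈ J) →
      Q (AB i0 σ (3/4)) (dL L f) ≤ C ∧ ∀ z : Euc d, 0 ≤ z i0 → ‖z‖ ≤ δ →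
        Q (AB i0 σ (3/4)) (dl z (dL L f)) ≤ C * ‖z‖ₑ) →
    ∫⁻ x in AB i0 σ (1/2), ‖f x‖ₑ ^ p ≤ C' := by
  set l : ℝ := min δ (1/4) / (2 * (d + 1)) with hl_def
  have hm0 : 0 < min δ (1/4 : ℝ) := lt_min hδ (by norm_num)
  have hl : 0 < l := by positivity
  have hll : l * (2 * (d + 1)) = min δ (1/4) := by rw [hl_def]; field_simp
  have hd0 : (0:ℝ) ≤ d := d.cast_nonneg
  have h4 : min δ (1/4 : ℝ) ≤ 1/4 := min_le_right _ _
  have h5 : min δ (1/4 : ℝ) ≤ δ := min_le_left _ _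
  have hdl : 0 ≤ d * l := by positivity
  have hl1 : l ≤ 1 := by nlinarith
  have hlδ : l ≤ δ := by nlinarith
  have hld : d * (2 * l) ≤ 1 / 4 := by nlinarith
  have hdlδ : d * l ≤ δ := by nlinarith
  set A : ℝ := 4 ^ J.length * (C + 14 * C * l) / l ^ d with hA
  have hA0 : 0 ≤ A := by positivity
  set C1 : ℝ := 1 + A + C * (d * l) with hC1
  have hC1' : 0 ≤ C * (d * l) := by positivity
  have hC10 : 0 < C1 := by linarith
  obtain ⟨C', hC'⟩ := lp_abs N hN hp1 hp hC10 (volume (ball (0 : Euc d) (1/2))).toNNReal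
  refine ⟨C', fun σ f hf H => ?_⟩
  have hfc : Continuous f := hf.continuous
  let t : ℕ → ℝ := fun i => l * (1/4) ^ i
  have ht0 : ∀ i, 0 < t i := fun i => by positivity
  have htl : ∀ i, t i ≤ l := fun i => by
    have : (1/4 : ℝ) ^ i ≤ 1 := pow_le_one₀ (by norm_num) (by norm_num)
    show l * (1/4) ^ i ≤ l
    nlinarith
  have hprob : ∀ i, IsProbabilityMeasure (nuB d (t i)) := fun i => ⟨nuB_univ (ht0 i)⟩
  let b : ℕ → Euc d → ℝ := fun i x => ∫ z, f (x + z) ∂(nuB d (t i))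
  have mb : ∀ i, Measurable (b i) := fun i => by
    have := hprob i
    have : StronglyMeasurable (Function.uncurry fun (x z : Euc d) => f (x + z)) := by
      apply Continuous.stronglyMeasurable
      unfold Function.uncurry
      fun_prop
    exact (this.integral_prod_right).measurable
  refine hC' (volume.restrict (AB i0 σ (1/2))) ?_ f b (fun i x => f x - b i x)
    (fun i => hfc.measurable.sub (mb i)) hfc.measurable ?_ ?_
  · rw [Measure.restrict_apply_univ, ENNReal.coe_toNNReal measure_ball_lt_top.ne]
    exact measure_mono inter_subset_left
  · filter_upwards [ae_restrict_mem (AB_meas i0 σ (1/2))] with x hx i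
    refine ⟨by ring, ?_⟩
    have h1 := cube_bound hi hJ h0J h1J hl hl1 hlδ hld σ hf H i hx
    have h2 : ‖b i x‖ₑ ^ 2 ≤ ENNReal.ofReal ((C1 * 2 ^ (i * N)) ^ 2) := by
      have hm : AEMeasurable (fun z => ‖f (x + z)‖ₑ) (nuB d (t i)) := by fun_prop
      calc ‖b i x‖ₑ ^ 2 ≤ (∫⁻ z, ‖f (x + z)‖ₑ ∂(nuB d (t i))) ^ 2 := by
            gcongr; exact enorm_integral_le_lintegral_enorm _
        _ ≤ ∫⁻ z, ‖f (x + z)‖ₑ ^ 2 ∂(nuB d (t i)) := by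
            have := sq_lintegral_le _ hm
            rwa [nuB_univ (ht0 i), one_mul] at this
        _ ≤ (ENNReal.ofReal (t i ^ d))⁻¹ * Q (Bx x fun _ => t i) f :=
            nuB_shift x fun w => ‖f w‖ₑ ^ 2
        _ ≤ (ENNReal.ofReal (t i ^ d))⁻¹ * ENNReal.ofReal (4 ^ J.length * (C + 14 * C * l) * ((1/4) ^ i) ^ (J.length + 1)) := by
            gcongr
        _ ≤ _ := by
            rw [← ENNReal.ofReal_inv_of_pos (pow_pos (ht0 i) d), ← ENNReal.ofReal_mul (by have := ht0 i; positivity)]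
            refine ENNReal.ofReal_le_ofReal ?_
            have e1 : (t i ^ d)⁻¹ * (4 ^ J.length * (C + 14 * C * l) * ((1/4) ^ i) ^ (J.length + 1)) =
                A * (2 ^ (i * N)) ^ 2 := by
              have e2 : ((2:ℝ) ^ (i * N)) ^ 2 * ((1/4) ^ i) ^ N = 1 := by
                rw [← pow_mul, ← pow_mul, mul_comm (i * N) 2, pow_mul, ← mul_pow]; norm_num
              have e3 : t i ^ d = l ^ d * (((1/4) ^ i) ^ (J.length + 1) * ((1/4) ^ i) ^ N) := by
                rw [← pow_add, ← hNd, ← mul_pow]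
              rw [e3, hA]
              generalize (2:ℝ) ^ (i * N) = X at *
              have hq : (0:ℝ) < ((1/4) ^ i) ^ N := by positivity
              have hq' : (0:ℝ) < ((1/4) ^ i) ^ (J.length + 1) := by positivity
              generalize ((1/4 : ℝ) ^ i) ^ N = Y at *
              generalize ((1/4 : ℝ) ^ i) ^ (J.length + 1) = Z at *
              have : Y⁻¹ = X ^ 2 := by
                field_simp; linarith
              rw [mul_inv, mul_inv, this]
              field_simp
            rw [e1, mul_pow]
            have : A ≤ C1 ^ 2 := by nlinarith
            gcongr
    rw [Real.enorm_eq_ofReal_abs, ← ENNReal.ofReal_pow (abs_nonneg _),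
      ENNReal.ofReal_le_ofReal_iff (by positivity)] at h2
    exact le_of_sq_le_sq h2 (by positivity)
  · intro i
    have := hprob i
    have hG : Measurable (Function.uncurry fun (z x : Euc d) => ‖dl z f x‖ₑ) := by
      unfold Function.uncurry dl
      fun_prop
    have hz : ∀ᵐ z ∂(nuB d (t i)), ∫⁻ x in AB i0 σ (1/2), ‖dl z f x‖ₑ ^ 2 ≤ ENNReal.ofReal (C1 * (1/4) ^ i) := by
      filter_upwards [nuB_ae] with z hz
      have hzn : ‖z‖ ≤ d * t i := norm_le_box fun j => by
        have := hz j
        simp only [PiLp.zero_apply] at this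
        rw [abs_le]; constructor <;> linarith
      have hz0 : 0 ≤ z i0 := by
        have := (hz i0).1
        simp only [PiLp.zero_apply] at this
        exact this.le
      have h1 := ((H [] (by simp) (by simp)).2 z hz0 (hzn.trans (le_trans (by have := htl i; gcongr) hdlδ)))
      refine (Q_mono_set (AB_mono i0 σ (by norm_num)) _).trans (h1.trans ?_)
      rw [← ofReal_norm, ← ENNReal.ofReal_coe_nnreal, ← ENNReal.ofReal_mul C.coe_nonneg]
      refine ENNReal.ofReal_le_ofReal ?_
      have h2 : C * ‖z‖ ≤ C * (d * t i) := by gcongr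
      refine h2.trans ?_
      have e : (C:ℝ) * (d * t i) = C * (d * l) * (1/4) ^ i := by simp only [t]; ring
      rw [e]
      have : (C:ℝ) * (d * l) ≤ C1 := by linarith
      gcongr
    have hmk := mink (nuB d (t i)) (volume.restrict (AB i0 σ (1/2))) hG hz
    rw [nuB_univ (ht0 i), one_pow, one_mul] at hmk
    refine le_trans (lintegral_mono fun x => ?_) hmk
    gcongr
    have e : f x - b i x = - ∫ z, dl z f x ∂(nuB d (t i)) := by
      simp only [dl]
      rw [integral_sub (nuB_int (ht0 i) hfc x) (integrable_const _)]
      simp [b]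
    rw [e, enorm_neg]
    exact enorm_integral_le_lintegral_enorm _

end loc
end RH
end

section
open Set Filter MeasureTheory Metric Topology
open scoped ENNReal NNReal Convolution

namespace RH
section r1
variable {d : ℕ}

lemma exists_low {α : Type*} (S : Finset α) (f : α → ℝ) (hf : ∀ a, 0 < f a) : ∃ δ > 0, ∀ a ∈ S, δ ≤ f a := by
  classical
  induction S using Finset.induction with
  | empty => exact ⟨1, one_pos, by simp⟩
  | insert a S _ ih =>
    obtain ⟨δ, h0, h⟩ := ih
    refine ⟨min δ (f a), lt_min h0 (hf a), fun b hb => ?_⟩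
    rcases Finset.mem_insert.1 hb with rfl | hb
    · exact min_le_right _ _
    · exact (min_le_left _ _).trans (h b hb)

lemma M2_unif {K : ℝ} (hK : 0 ≤ K) (k : ℕ) {r r' : ℝ} (hr : 0 < r) (hrr : r < r') :
    ∃ C : ℝ≥0, ∃ δ > 0, ∃ σ0 > 0,
    ∀ (i0 : Fin d) (D : Set (Euc d)) (Y : Set (Fin d)), Dom i0 K D Y → ∀
    (lam : ℝ) (u : Euc d → ℝ) (g : Euc d → Euc d), 0 ≤ lam → Sol i0 D lam r' u g →
    ∀ φ : ContDiffBump (0 : Euc d), φ.rOut ≤ σ0 → ∀ c, ∀ L : List (Fin d), L.length ≤ k → (∀ j ∈ L, j ∈ Y) →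
    (Q (AB i0 φ.rOut r) (dL L (moll φ (comp lam u g c))) ≤ C * En i0 lam r' u g) ∧
    (∀ z : Euc d, 0 ≤ z i0 → ‖z‖ ≤ δ →
      Q (AB i0 φ.rOut r) (dl z (dL L (moll φ (comp lam u g c)))) ≤ C * ‖z‖ₑ * En i0 lam r' u g) := by
  choose C δ hδ σ hσ H using fun L : List (Fin d) => M2 hK L hr hrr
  have hfin : {L : List (Fin d) | L.length ≤ k}.Finite := List.finite_length_le _ _
  obtain ⟨δ', hδ'0, hδ'⟩ := exists_low hfin.toFinset δ hδ
  obtain ⟨σ', hσ'0, hσ'⟩ := exists_low hfin.toFinset σ hσ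
  refine ⟨∑ L ∈ hfin.toFinset, C L, δ', hδ'0, σ', hσ'0, fun i0 D Y hD lam u g hl s φ hφ c L hL hLY => ?_⟩
  have hm : L ∈ hfin.toFinset := by simpa using hL
  have hC : (C L : ℝ≥0∞) ≤ ((∑ L ∈ hfin.toFinset, C L : ℝ≥0) : ℝ≥0∞) := by
    exact_mod_cast Finset.single_le_sum (f := C) (fun _ _ => zero_le) hm
  obtain ⟨h1, h2⟩ := H L i0 D Y hD hLY lam u g hl s φ (hφ.trans (hσ' L hm)) c
  refine ⟨h1.trans (by gcongr), fun z hz hzd => (h2 z hz (hzd.trans (hδ' L hm))).trans (by gcongr)⟩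

/-- bump with given outer radius -/
noncomputable def bmp (d : ℕ) (s : ℝ) (n : ℕ) (hs : 0 < s) : ContDiffBump (0 : Euc d) where
  rIn := s / (n + 1) / 2
  rOut := s / (n + 1)
  rIn_pos := by positivity
  rIn_lt_rOut := half_lt_self (by positivity)

lemma fatou_moll {i0 : Fin d} {f : Euc d → ℝ} (hf : MemLp f 2 volume) {s r : ℝ} (hs : 0 < s)
    {p : ℝ} (hp : 0 < p) {K : ℝ≥0∞}
    (h : ∀ φ : ContDiffBump (0 : Euc d), φ.rOut ≤ s → ∫⁻ x in AB i0 φ.rOut r, ‖moll φ f x‖ₑ ^ p ≤ K) :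
    ∫⁻ x in HB i0 r, ‖f x‖ₑ ^ p ≤ K := by
  let φ : ℕ → ContDiffBump (0 : Euc d) := fun n => bmp d s n hs
  have hφo : ∀ n, (φ n).rOut = s / (n + 1) := fun n => rfl
  have hφi : ∀ n, (φ n).rIn = s / (n + 1) / 2 := fun n => rfl
  have hlim : Tendsto (fun n => (φ n).rOut) atTop (𝓝 0) := by
    simp only [hφo]
    have := (tendsto_one_div_add_atTop_nhds_zero_nat (𝕜 := ℝ)).const_mul s
    simpa [div_eq_mul_inv] using this
  have hae := ContDiffBump.ae_convolution_tendsto_right_of_locallyIntegrable (μ := volume) (K := 2) hlim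
    (Eventually.of_forall fun n => by rw [hφo, hφi]; linarith) (hf.locallyIntegrable (by norm_num))
  let F : ℕ → Euc d → ℝ≥0∞ := fun n => (AB i0 (φ n).rOut r).indicator fun x => ‖moll (φ n) f x‖ₑ ^ p
  have mF : ∀ n, Measurable (F n) := fun n =>
    (((moll_contDiff (φ n) hf).continuous.measurable.enorm).pow_const p).indicator (AB_meas _ _ _)
  have hle : ∀ n, ∫⁻ x, F n x ≤ K := fun n => by
    rw [lintegral_indicator (AB_meas _ _ _)]
    refine h (φ n) ?_
    rw [hφo]
    exact div_le_self hs.le (by linarith [n.cast_nonneg (α := ℝ)])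
  have hpt : ∀ᵐ x, x ∈ HB i0 r → ‖f x‖ₑ ^ p ≤ liminf (fun n => F n x) atTop := by
    filter_upwards [hae] with x hx hxH
    have h1 : Tendsto (fun n => moll (φ n) f x) atTop (𝓝 (f x)) := by
      refine hx.congr fun n => ?_
      rw [moll_eq_conv]
      rfl
    have h2 : Tendsto (fun n => ‖moll (φ n) f x‖ₑ ^ p) atTop (𝓝 (‖f x‖ₑ ^ p)) :=
      ((ENNReal.continuous_rpow_const.tendsto _).comp (h1.enorm))
    have h3 : Tendsto (fun n => F n x) atTop (𝓝 (‖f x‖ₑ ^ p)) := by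
      refine h2.congr' ?_
      have hx0 : 0 < x i0 := hxH.2
      filter_upwards [hlim.eventually (gt_mem_nhds hx0)] with n hn
      have : x ∈ AB i0 (φ n).rOut r := ⟨hxH.1, hn⟩
      simp only [F, indicator_of_mem this]
    exact h3.liminf_eq.ge
  calc ∫⁻ x in HB i0 r, ‖f x‖ₑ ^ p ≤ ∫⁻ x in HB i0 r, liminf (fun n => F n x) atTop := by
        refine lintegral_mono_ae ((ae_restrict_iff' (HB_meas i0 r)).2 hpt)
    _ ≤ ∫⁻ x, liminf (fun n => F n x) atTop := setLIntegral_le_lintegral _ _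
    _ ≤ liminf (fun n => ∫⁻ x, F n x) atTop := lintegral_liminf_le mF
    _ ≤ K := by
      refine (liminf_le_liminf (Eventually.of_forall hle)).trans ?_
      simp

theorem R1 {i0 i1 : Fin d} (hi : i0 ≠ i1) {J : List (Fin d)} (hJ : J.Nodup) (h0J : i0 ∉ J) (h1J : i1 ∉ J)
    {N : ℕ} (hN : 1 ≤ N) (hNd : d = J.length + 1 + N) {p : ℝ} (hp1 : 1 ≤ p) (hp : (N : ℝ) * p < 2 * (N + 1))
    {K : ℝ} (hK : 0 ≤ K) : ∃ C' : ℝ≥0, ∀ (D : Set (Euc d)), Dom i0 K D {j | j ∈ J} → ∀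
    (lam : ℝ) (u : Euc d → ℝ) (g : Euc d → Euc d), 0 ≤ lam → Sol i0 D lam 1 u g → ∀ c,
    ∫⁻ x in HB i0 (1/2), ‖comp lam u g c x‖ₑ ^ p ≤ C' * (En i0 lam 1 u g) ^ (p / 2) := by
  have hp0 : 0 < p := by linarith
  obtain ⟨C, δ, hδ, σ, hσ, H⟩ := M2_unif (d := d) hK J.length (r := 3/4) (r' := 1) (by norm_num) (by norm_num)
  obtain ⟨C', hC'⟩ := loc_bound hi hJ h0J h1J hN hNd hp1 hp C hδ
  refine ⟨C', fun D hD lam u g hl s c => ?_⟩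
  have hfin : En i0 lam 1 u g ≠ ⊤ := (En_lt_top hl s.lu s.lg).ne
  -- normalised version
  have norm1 : ∀ (u : Euc d → ℝ) (g : Euc d → Euc d), Sol i0 D lam 1 u g → En i0 lam 1 u g ≤ 1 →
      ∫⁻ x in HB i0 (1/2), ‖comp lam u g c x‖ₑ ^ p ≤ C' := by
    intro u g s hE
    refine fatou_moll (comp_memLp s.lu s.lg c) hσ hp0 fun φ hφ => ?_
    refine hC' φ.rOut _ (moll_contDiff φ (comp_memLp s.lu s.lg c)) fun L hL hLJ => ?_
    obtain ⟨h1, h2⟩ := H i0 D _ hD lam u g hl s φ hφ c L hL hLJ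
    refine ⟨h1.trans ?_, fun z hz hzd => (h2 z hz hzd).trans ?_⟩
    · calc (C : ℝ≥0∞) * En i0 lam 1 u g ≤ C * 1 := by gcongr
        _ = C := mul_one _
    · calc (C : ℝ≥0∞) * ‖z‖ₑ * En i0 lam 1 u g ≤ C * ‖z‖ₑ * 1 := by gcongr
        _ = C * ‖z‖ₑ := mul_one _
  by_cases hE0 : En i0 lam 1 u g = 0
  · have hQ : Q (HB i0 1) (comp lam u g c) = 0 := le_antisymm ((Q_comp_le hl i0 1 u g c).trans hE0.le) zero_le
    unfold Q at hQ
    rw [lintegral_eq_zero_iff ((comp_meas s.mu s.mg c).enorm.pow_const 2)] at hQ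
    have : ∫⁻ x in HB i0 1, ‖comp lam u g c x‖ₑ ^ p = 0 := by
      rw [lintegral_eq_zero_iff ((comp_meas s.mu s.mg c).enorm.pow_const p)]
      filter_upwards [hQ] with x hx
      simp only [Pi.zero_apply, pow_eq_zero_iff two_ne_zero] at hx ⊢
      rw [hx, ENNReal.zero_rpow_of_pos hp0]
    refine (lintegral_mono_set (HB_mono i0 (r' := 1) (by norm_num))).trans ?_
    rw [this]; exact zero_le
  set E := (En i0 lam 1 u g).toReal with hE
  have hEpos : 0 < E := ENNReal.toReal_pos hE0 hfin
  have hEe : En i0 lam 1 u g = ENNReal.ofReal E := (ENNReal.ofReal_toReal hfin).symm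
  set a : ℝ := (Real.sqrt E)⁻¹ with ha
  have hs0 : 0 < Real.sqrt E := Real.sqrt_pos.2 hEpos
  have ha0 : 0 < a := inv_pos.2 hs0
  have hfa := norm1 _ _ (s.smul a) (by
    rw [En_smul, hEe, ← ENNReal.ofReal_mul (by positivity), ha, inv_pow, Real.sq_sqrt hEpos.le,
      inv_mul_cancel₀ hEpos.ne']
    simp)
  rw [comp_smul] at hfa
  have e1 : ∀ x, ‖comp lam u g c x‖ₑ ^ p = ENNReal.ofReal E ^ (p / 2) * ‖a * comp lam u g c x‖ₑ ^ p := by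
    intro x
    rw [enorm_mul, ENNReal.mul_rpow_of_nonneg _ _ hp0.le, ← mul_assoc, Real.enorm_of_nonneg ha0.le,
      ENNReal.ofReal_rpow_of_pos hEpos, ENNReal.ofReal_rpow_of_pos ha0, ← ENNReal.ofReal_mul (by positivity)]
    have : E ^ (p / 2) * a ^ p = 1 := by
      have e : E ^ (p / 2) = Real.sqrt E ^ p := by
        rw [Real.sqrt_eq_rpow, ← Real.rpow_mul hEpos.le]; congr 1; ring
      rw [e, ha, ← Real.mul_rpow hs0.le (by positivity), mul_inv_cancel₀ hs0.ne', Real.one_rpow]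
    rw [this]; simp
  simp only [e1]
  rw [lintegral_const_mul' _ _ (by finiteness), hEe, mul_comm]
  gcongr

end r1
end RH
end

section
open Set Filter MeasureTheory Metric Topology
open scoped ENNReal NNReal

namespace RH
section scaling
variable {d : ℕ}

lemma lint_smul {R : ℝ} (hR : 0 < R) (F : Euc d → ℝ≥0∞) :
    ∫⁻ x, F (R • x) = ENNReal.ofReal ((R ^ d)⁻¹) * ∫⁻ x, F x := by
  have h := Measure.map_addHaar_smul (volume : Measure (Euc d)) hR.ne'
  rw [finrank_euclideanSpace_fin, abs_of_pos (by positivity)] at h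
  rw [← smul_eq_mul, ← lintegral_smul_measure, ← h]
  exact ((Homeomorph.smulOfNeZero R hR.ne').measurableEmbedding.lintegral_map F).symm

lemma memLp_smul {F : Type*} [NormedAddCommGroup F] {R : ℝ} (hR : 0 < R) {f : Euc d → F} (hf : MemLp f 2 volume) :
    MemLp (fun x => f (R • x)) 2 volume := by
  have h := Measure.map_addHaar_smul (volume : Measure (Euc d)) hR.ne'
  have h1 : MemLp f 2 (Measure.map (fun x : Euc d => R • x) volume) := by
    rw [h]; exact hf.smul_measure (by simp)
  exact ((Homeomorph.smulOfNeZero R hR.ne').measurableEmbedding.memLp_map_measure_iff).1 h1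

lemma mem_HB_smul {i0 : Fin d} {R r : ℝ} (hR : 0 < R) (x : Euc d) : R • x ∈ HB i0 (R * r) ↔ x ∈ HB i0 r := by
  have h1 : R • x ∈ ball (0 : Euc d) (R * r) ↔ x ∈ ball (0 : Euc d) r := by
    rw [mem_ball_zero_iff, mem_ball_zero_iff, norm_smul, Real.norm_of_nonneg hR.le]
    exact mul_lt_mul_iff_right₀ hR
  have h2 : 0 < (R • x) i0 ↔ 0 < x i0 := by
    rw [PiLp.smul_apply, smul_eq_mul]
    exact mul_pos_iff_of_pos_left hR
  exact and_congr h1 h2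

lemma lint_HB {i0 : Fin d} {R : ℝ} (hR : 0 < R) (r : ℝ) (F : Euc d → ℝ≥0∞) :
    ∫⁻ x in HB i0 r, F (R • x) = ENNReal.ofReal ((R ^ d)⁻¹) * ∫⁻ x in HB i0 (R * r), F x := by
  rw [← lintegral_indicator (HB_meas _ _), ← lintegral_indicator (HB_meas _ _), ← lint_smul hR]
  refine lintegral_congr fun x => ?_
  by_cases hx : x ∈ HB i0 r
  · rw [indicator_of_mem hx, indicator_of_mem ((mem_HB_smul hR x).2 hx)]
  · rw [indicator_of_notMem hx, indicator_of_notMem (fun h => hx ((mem_HB_smul hR x).1 h))]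

lemma Q_HB {G : Type*} [NormedAddCommGroup G] {i0 : Fin d} {R : ℝ} (hR : 0 < R) (r : ℝ) (f : Euc d → G) :
    Q (HB i0 r) (fun x => f (R • x)) = ENNReal.ofReal ((R ^ d)⁻¹) * Q (HB i0 (R * r)) f :=
  lint_HB hR r fun x => ‖f x‖ₑ ^ 2

lemma isTest_scale {ζ : Euc d → ℝ} (h : IsTest ζ) {R : ℝ} (hR : R ≠ 0) : IsTest fun x => ζ (R • x) :=
  ⟨h.1.comp (contDiff_const_smul R), h.2.comp_homeomorph (Homeomorph.smulOfNeZero R hR)⟩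

lemma gradVec_scale {ζ : Euc d → ℝ} (h : IsTest ζ) (R : ℝ) (x : Euc d) :
    gradVec (fun x => ζ (R • x)) x = R • gradVec ζ (R • x) := by
  ext i
  simp only [gradVec, PiLp.smul_apply, smul_eq_mul]
  have hd : DifferentiableAt ℝ ζ (R • x) := h.1.differentiable (by simp) _
  have h1 : HasFDerivAt (fun x : Euc d => R • x) (R • ContinuousLinearMap.id ℝ (Euc d)) x :=
    (hasFDerivAt_id (𝕜 := ℝ) x).const_smul R
  have := (hd.hasFDerivAt.comp x h1).fderiv
  rw [show (fun x => ζ (R • x)) = ζ ∘ fun x => R • x from rfl, this]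
  simp

lemma Sol.scale {i0 : Fin d} {D : Set (Euc d)} {lam R : ℝ} {u : Euc d → ℝ} {g : Euc d → Euc d} (hR : 0 < R)
    (s : Sol i0 D lam R u g) :
    Sol i0 {x | R • x ∈ D} (R ^ 2 * lam) 1 (fun x => u (R • x)) (fun x => R • g (R • x)) := by
  have hz : ∀ x : Euc d, x i0 ≤ 0 → (R • x) i0 ≤ 0 := fun x hx => by
    rw [PiLp.smul_apply, smul_eq_mul]; exact mul_nonpos_of_nonneg_of_nonpos hR.le hx
  refine ⟨s.mu.comp (measurable_const_smul R), (s.mg.comp (measurable_const_smul R)).const_smul R,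
    memLp_smul hR s.lu, (memLp_smul hR s.lg).const_smul R, fun x hx => s.zu _ (hz x hx),
    fun x hx => by simp only [s.zg _ (hz x hx), smul_zero], ?_, fun ζ hζ hs hD => ?_⟩
  · obtain ⟨un, h1, h2, h3⟩ := s.ap
    refine ⟨fun n x => un n (R • x), fun n => ⟨isTest_scale (h1 n).1 hR.ne', fun x hx => (h1 n).2 _ hx⟩, ?_, ?_⟩
    · have : ∀ n, Q (HB i0 1) (fun x => un n (R • x) - u (R • x)) =
          ENNReal.ofReal ((R ^ d)⁻¹) * Q (HB i0 R) (fun x => un n x - u x) := fun n => by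
        rw [Q_HB hR 1 fun x => un n x - u x, mul_one]
      simp only [this]
      simpa using ENNReal.Tendsto.const_mul h2 (Or.inr (by simp))
    · have : ∀ n, Q (HB i0 1) (fun x => gradVec (fun x => un n (R • x)) x - R • g (R • x)) =
          ENNReal.ofReal (R ^ 2) * ENNReal.ofReal ((R ^ d)⁻¹) * Q (HB i0 R) (fun x => gradVec (un n) x - g x) := fun n => by
        simp only [gradVec_scale (h1 n).1, ← smul_sub]
        rw [Q_smul, Q_HB hR 1 fun x => gradVec (un n) x - g x, mul_one, mul_assoc]
      simp only [this]
      simpa using ENNReal.Tendsto.const_mul h3 (Or.inr (by finiteness))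
  · set ζ' : Euc d → ℝ := fun y => ζ (R⁻¹ • y) with hζ'
    have hR' : R⁻¹ ≠ 0 := inv_ne_zero hR.ne'
    have ht : IsTest ζ' := isTest_scale hζ hR'
    have hback : ∀ x, ζ' (R • x) = ζ x := fun x => by simp [hζ', smul_smul, inv_mul_cancel₀ hR.ne']
    have hg : ∀ x, gradVec ζ x = R • gradVec ζ' (R • x) := fun x => by
      rw [← gradVec_scale ht R x]
      congr 1
      funext y; exact (hback y).symm
    have hsup : tsupport ζ' ⊆ ball 0 R := by
      intro y hy
      have h1 : R⁻¹ • y ∈ tsupport ζ := by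
        have := tsupport_comp_subset_preimage ζ (f := fun y : Euc d => R⁻¹ • y) (continuous_const_smul _)
        exact this hy
      have h2 := hs h1
      rw [mem_ball_zero_iff, norm_smul, norm_inv, Real.norm_of_nonneg hR.le, inv_mul_lt_iff₀ hR, mul_one] at h2
      rwa [mem_ball_zero_iff]
    have heq := s.eq ζ' ht hsup (fun y hy => hD _ (by
      show R • R⁻¹ • y ∈ D
      rwa [smul_smul, mul_inv_cancel₀ hR.ne', one_smul]))
    have : ∀ x, (inner ℝ (R • g (R • x)) (gradVec ζ x) : ℝ) + R ^ 2 * lam * u (R • x) * ζ x =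
        R ^ 2 * (fun y => (inner ℝ (g y) (gradVec ζ' y) : ℝ) + lam * u y * ζ' y) (R • x) := fun x => by
      rw [hg x, ← hback x, inner_smul_left, inner_smul_right]
      simp only [conj_trivial]
      ring
    simp only [this]
    rw [integral_const_mul, Measure.integral_comp_smul volume (fun y => (inner ℝ (g y) (gradVec ζ' y) : ℝ) + lam * u y * ζ' y) R,
      heq]
    simp

lemma Dom.scale {i0 : Fin d} {K : ℝ} {D : Set (Euc d)} {Y : Set (Fin d)} (h : Dom i0 K D Y) {R : ℝ} (hR : 0 < R) :
    Dom i0 K {x | R • x ∈ D} Y := by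
  obtain ⟨⟨e, he1, he2, he3⟩, h2, h3, h4⟩ := h
  refine ⟨⟨e, he1, he2, fun v t hv ht x hx => ?_⟩, fun x hx => ?_, h3, fun j hj t x hx => ?_⟩
  · show R • (x + (v + t • e)) ∈ D
    have := he3 (R • v) (R * t) (by simp [hv]) (by
      rw [norm_smul, Real.norm_of_nonneg hR.le]; nlinarith) (R • x) hx
    rw [smul_add, smul_add, smul_smul]
    exact this
  · have := h2 _ hx
    rw [PiLp.smul_apply, smul_eq_mul] at this
    exact (mul_eq_zero.1 this).resolve_left hR.ne'
  · show R • (x + _) ∈ D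
    rw [smul_add, smul_smul]
    exact h4 j hj _ _ hx

lemma comp_scale {lam R : ℝ} (hR : 0 < R) (u : Euc d → ℝ) (g : Euc d → Euc d)
    (c : Option (Fin d)) (x : Euc d) :
    comp (R ^ 2 * lam) (fun x => u (R • x)) (fun x => R • g (R • x)) c x = R * comp lam u g c (R • x) := by
  cases c with
  | none =>
    simp only [comp]
    rw [Real.sqrt_mul (by positivity), Real.sqrt_sq hR.le, mul_assoc]
  | some j => simp [comp]

lemma En_scale {i0 : Fin d} {lam R : ℝ} (hR : 0 < R) (u : Euc d → ℝ) (g : Euc d → Euc d) :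
    En i0 (R ^ 2 * lam) 1 (fun x => u (R • x)) (fun x => R • g (R • x)) =
      ENNReal.ofReal (R ^ 2) * (ENNReal.ofReal ((R ^ d)⁻¹) * En i0 lam R u g) := by
  unfold En
  rw [Q_smul, Q_HB hR 1 g, Q_HB hR 1 u, mul_one, ENNReal.ofReal_mul (by positivity)]
  ring

theorem RR {i0 i1 : Fin d} (hi : i0 ≠ i1) {J : List (Fin d)} (hJ : J.Nodup) (h0J : i0 ∉ J) (h1J : i1 ∉ J)
    {N : ℕ} (hN : 1 ≤ N) (hNd : d = J.length + 1 + N) {p : ℝ} (hp1 : 1 ≤ p) (hp : (N : ℝ) * p < 2 * (N + 1))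
    {K : ℝ} (hK : 0 ≤ K) : ∃ C' : ℝ≥0, ∀ (D : Set (Euc d)), Dom i0 K D {j | j ∈ J} → ∀
    (lam R : ℝ) (u : Euc d → ℝ) (g : Euc d → Euc d), 0 ≤ lam → 0 < R → Sol i0 D lam R u g → ∀ c,
    ∫⁻ x in HB i0 (R/2), ‖comp lam u g c x‖ₑ ^ p ≤
      C' * ENNReal.ofReal (R ^ d) * (ENNReal.ofReal ((R ^ d)⁻¹) * En i0 lam R u g) ^ (p / 2) := by
  have hp0 : 0 < p := by linarith
  obtain ⟨C', hC'⟩ := R1 hi hJ h0J h1J hN hNd hp1 hp hK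
  refine ⟨C', fun D hD lam R u g hl hR s c => ?_⟩
  have h := hC' _ (hD.scale hR) _ _ _ (by positivity : 0 ≤ R ^ 2 * lam) (s.scale hR) c
  rw [En_scale hR] at h
  simp only [comp_scale hR, enorm_mul] at h
  simp only [ENNReal.mul_rpow_of_nonneg _ _ hp0.le] at h
  rw [lintegral_const_mul' _ _ (by
      rw [Real.enorm_eq_ofReal_abs]; finiteness), lint_HB hR (1/2) fun x => ‖comp lam u g c x‖ₑ ^ p,
    mul_one_div] at h
  set I := ∫⁻ x in HB i0 (R/2), ‖comp lam u g c x‖ₑ ^ p with hI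
  set E := ENNReal.ofReal ((R ^ d)⁻¹) * En i0 lam R u g with hE
  rw [ENNReal.mul_rpow_of_nonneg _ _ (by positivity : 0 ≤ p / 2)] at h
  have e1 : ‖R‖ₑ ^ p = ENNReal.ofReal (R ^ p) := by
    rw [Real.enorm_of_nonneg hR.le, ENNReal.ofReal_rpow_of_pos hR]
  have e2 : ENNReal.ofReal (R ^ 2) ^ (p / 2) = ENNReal.ofReal (R ^ p) := by
    rw [ENNReal.ofReal_rpow_of_pos (by positivity), ← Real.rpow_natCast, ← Real.rpow_mul hR.le]
    congr 2; push_cast; ring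
  rw [e1, e2] at h
  have hRp : 0 < R ^ p := Real.rpow_pos_of_pos hR p
  have h2 : ENNReal.ofReal (R ^ p) * (ENNReal.ofReal ((R ^ d)⁻¹) * I) ≤ ENNReal.ofReal (R ^ p) * (C' * E ^ (p / 2)) := by
    refine h.trans (le_of_eq (by ring))
  have h3 := (ENNReal.mul_le_mul_iff_right (ENNReal.ofReal_pos.2 hRp).ne' (by simp)).1 h2
  calc I = ENNReal.ofReal (R ^ d) * (ENNReal.ofReal ((R ^ d)⁻¹) * I) := by
        rw [← mul_assoc, ← ENNReal.ofReal_mul (by positivity), mul_inv_cancel₀ (by positivity)]; simp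
    _ ≤ ENNReal.ofReal (R ^ d) * (C' * E ^ (p / 2)) := by gcongr
    _ = _ := by ring

end scaling
end RH
end

section
open Set Filter MeasureTheory Metric Topology
open scoped ENNReal NNReal

namespace RH
section fin1
variable {d : ℕ}

lemma Q_ae {F : Type*} [NormedAddCommGroup F] {A : Set (Euc d)} {f g : Euc d → F}
    (h : f =ᵐ[volume.restrict A] g) : Q A f = Q A g := by
  unfold Q
  refine lintegral_congr_ae ?_
  filter_upwards [h] with x hx
  rw [hx]

lemma Q_rpow {F : Type*} [NormedAddCommGroup F] {A : Set (Euc d)} {f : Euc d → F}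
    (hf : MemLp f 2 (volume.restrict A)) : Q A f = ENNReal.ofReal (∫ x in A, ‖f x‖ ^ (2 : ℝ)) := by
  have hi : Integrable (fun x => ‖f x‖ ^ (2 : ℝ)) (volume.restrict A) := by
    have := hf.integrable_norm_pow (by norm_num)
    refine this.congr (Eventually.of_forall fun x => ?_)
    exact (Real.rpow_two _).symm
  rw [ofReal_integral_eq_lintegral_ofReal hi (Eventually.of_forall fun x => by positivity)]
  unfold Q
  refine lintegral_congr fun x => ?_
  rw [Real.rpow_two, ENNReal.ofReal_pow (norm_nonneg _), ofReal_norm]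

lemma exists_rep {F : Type*} [NormedAddCommGroup F] [MeasurableSpace F] [BorelSpace F]
    {i0 : Fin d} {R : ℝ} {f : Euc d → F} (hf : MemLp f 2 (volume.restrict (HB i0 R))) :
    ∃ f' : Euc d → F, Measurable f' ∧ MemLp f' 2 volume ∧ (∀ x, x ∉ HB i0 R → f' x = 0) ∧
      f =ᵐ[volume.restrict (HB i0 R)] f' := by
  have hm := HB_meas i0 R
  have h1 : f =ᵐ[volume.restrict (HB i0 R)] (HB i0 R).indicator (hf.1.mk f) := by
    filter_upwards [hf.1.ae_eq_mk, ae_restrict_mem hm] with x hx hx2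
    rw [indicator_of_mem hx2, hx]
  refine ⟨(HB i0 R).indicator (hf.1.mk f), hf.1.stronglyMeasurable_mk.measurable.indicator hm, ?_,
    fun x hx => indicator_of_notMem hx _, h1⟩
  rw [memLp_indicator_iff_restrict hm]
  exact (memLp_congr_ae hf.1.ae_eq_mk).1 hf

lemma mkSol {i0 : Fin d} {D : Set (Euc d)} {lam R : ℝ} {u : Euc d → ℝ} {g : Euc d → Euc d}
    (lu : MemLp u 2 (volume.restrict (HB i0 R))) (lg : MemLp g 2 (volume.restrict (HB i0 R)))
    (ap : ApproxWD u g D (HB i0 R) 2)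
    (eq : ∀ ζ : Euc d → ℝ, IsTest ζ → tsupport ζ ⊆ ball (0 : Euc d) R →
          tsupport ζ ∩ closure D = ∅ →
          ∫ x in HB i0 R, ((inner ℝ (g x) (gradVec ζ x) : ℝ) + lam * u x * ζ x) = 0) :
    ∃ u' g', Sol i0 D lam R u' g' ∧ u =ᵐ[volume.restrict (HB i0 R)] u' ∧
      g =ᵐ[volume.restrict (HB i0 R)] g' := by
  obtain ⟨u', mu, lu', zu, hu⟩ := exists_rep lu
  obtain ⟨g', mg, lg', zg, hg⟩ := exists_rep lg
  have hm := HB_meas i0 R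
  refine ⟨u', g', ⟨mu, mg, lu', lg', fun x hx => zu x fun h => ?_, fun x hx => zg x fun h => ?_, ?_, ?_⟩,
    hu, hg⟩
  · exact absurd h.2 (not_lt.2 hx)
  · exact absurd h.2 (not_lt.2 hx)
  · obtain ⟨un, h1, h2, h3⟩ := ap
    refine ⟨un, fun n => ⟨(h1 n).1, fun x hx => ?_⟩, ?_, ?_⟩
    · by_contra hne
      have : x ∈ Function.support (un n) ∩ D := ⟨hne, hx⟩
      rw [(h1 n).2] at this
      exact this
    · have h4 := ENNReal.tendsto_ofReal h2
      rw [ENNReal.ofReal_zero] at h4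
      refine h4.congr fun n => ?_
      have h5 : MemLp (fun x => un n x - u x) 2 (volume.restrict (HB i0 R)) :=
        ((isTest_memLp (h1 n).1 2).restrict _).sub lu
      have h6 := Q_rpow h5
      simp only [Real.norm_eq_abs] at h6
      rw [← h6]
      refine Q_ae ?_
      filter_upwards [hu] with x hx
      rw [hx]
    · have h4 := ENNReal.tendsto_ofReal h3
      rw [ENNReal.ofReal_zero] at h4
      refine h4.congr fun n => ?_
      have h5 : MemLp (fun x => gradVec (un n) x - g x) 2 (volume.restrict (HB i0 R)) :=
        ((isTest_memLp_grad (h1 n).1 2).restrict _).sub lg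
      rw [← Q_rpow h5]
      refine Q_ae ?_
      filter_upwards [hg] with x hx
      rw [hx]
  · refine eq_upgrade lu' lg' fun ζ hζ hs hD => ?_
    rw [← eq ζ hζ hs hD, ← setIntegral_eq_integral_of_forall_compl_eq_zero (s := HB i0 R)]
    · refine integral_congr_ae ?_
      filter_upwards [hu, hg] with x hx hx2
      rw [hx, hx2]
    · intro x hx
      simp [zu x hx, zg x hx]

lemma mkDom {m : ℕ} (hm : m + 2 ≤ d) {M : ℝ} (hM : 0 < M) {φ : Euc m → ℝ} (hφ : LipConst M φ)
    {J : Set (Fin d)} (hJ : ∀ j ∈ J, m + 2 ≤ j.1) :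
    Dom (⟨0, by omega⟩ : Fin d) (M + 1) (Dhalf hm φ) J := by
  refine ⟨⟨EuclideanSpace.single ⟨1, by omega⟩ 1, by simp, by simp, ?_⟩, fun x hx => hx.1,
    fun h => by have := hJ _ h; simp at this, ?_⟩
  · intro h t h0 ht x hx
    refine ⟨by simp [hx.1, h0], ?_⟩
    have h1 : projTail hm (x + (h + t • EuclideanSpace.single ⟨1, by omega⟩ 1)) - projTail hm x
        = projTail hm h := by
      ext i
      simp [projTail]
    have h2 : ‖projTail hm h‖ ≤ ‖h‖ := by
      rw [EuclideanSpace.norm_eq, EuclideanSpace.norm_eq]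
      refine Real.sqrt_le_sqrt ?_
      simp only [projTail]
      have hinj : Function.Injective (fun i : Fin m => (⟨i.1 + 2, by omega⟩ : Fin d)) := by
        intro a b hab
        simp only [Fin.mk.injEq] at hab
        ext; omega
      rw [← Finset.sum_image (f := fun j => ‖h j‖ ^ 2) (g := fun i : Fin m => (⟨i.1 + 2, by omega⟩ : Fin d))
        (s := Finset.univ) (fun a _ b _ hab => hinj hab)]
      exact Finset.sum_le_sum_of_subset_of_nonneg (Finset.subset_univ _) fun _ _ _ => by positivity
    have h3 := hφ (projTail hm (x + (h + t • EuclideanSpace.single ⟨1, by omega⟩ 1))) (projTail hm x)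
    rw [h1] at h3
    have h4 : M * ‖projTail hm h‖ ≤ M * ‖h‖ := by gcongr
    have h5 : |h ⟨1, by omega⟩| ≤ ‖h‖ := by
      simpa using PiLp.norm_apply_le h ⟨1, by omega⟩
    have h6 := hx.2
    have h7 := (abs_le.1 h3).2
    have h8 := (abs_le.1 h5).1
    simp only [PiLp.add_apply, PiLp.smul_apply, EuclideanSpace.single_apply, smul_eq_mul, if_true, mul_one]
    linarith
  · intro j hj t x hx
    have hj2 := hJ j hj
    have h1 : projTail hm (x + t • EuclideanSpace.single j 1) = projTail hm x := by
      ext i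
      have : (⟨i.1 + 2, by omega⟩ : Fin d) ≠ j := by
        intro h; rw [← h] at hj2; simp at hj2; omega
      simp [projTail, this]
    have n0 : (⟨0, by omega⟩ : Fin d) ≠ j := by
      intro h; rw [← h] at hj2; simp at hj2
    have n1 : (⟨1, by omega⟩ : Fin d) ≠ j := by
      intro h; rw [← h] at hj2; simp at hj2
    refine ⟨by simp [n0, hx.1], ?_⟩
    rw [h1]
    simpa [n1] using hx.2

lemma norm_le_sum_coord (v : Euc d) : ‖v‖ ≤ ∑ j, ‖v j‖ := by
  have : v = ∑ j, v j • EuclideanSpace.single j (1:ℝ) := by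
    ext i
    simp [Pi.single_apply]
  calc ‖v‖ = ‖∑ j, v j • EuclideanSpace.single j (1:ℝ)‖ := by rw [← this]
    _ ≤ ∑ j, ‖v j • EuclideanSpace.single j (1:ℝ)‖ := norm_sum_le _ _
    _ = _ := by simp [norm_smul]

lemma U_le {lam : ℝ} (u : Euc d → ℝ) (g : Euc d → Euc d) (x : Euc d) :
    ‖g x‖ + Real.sqrt lam * |u x| ≤ ∑ c, ‖comp lam u g c x‖ := by
  rw [Fintype.sum_option]
  have := norm_le_sum_coord (g x)
  simp only [comp, norm_mul, Real.norm_eq_abs, abs_of_nonneg (Real.sqrt_nonneg lam)] at *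
  linarith

lemma vol_HB {i0 : Fin d} {R : ℝ} (hR : 0 < R) :
    (volume (HB i0 R)).toReal = R ^ d * (volume (HB i0 1)).toReal := by
  have h := lint_HB (i0 := i0) hR 1 (fun _ => 1)
  simp only [lintegral_const, one_mul, Measure.restrict_apply_univ, mul_one] at h
  rw [h, ENNReal.toReal_mul, ENNReal.toReal_ofReal (by positivity), ← mul_assoc,
    mul_inv_cancel₀ (by positivity), one_mul]

lemma vol_HB_pos (i0 : Fin d) : 0 < (volume (HB i0 1)).toReal := by
  refine ENNReal.toReal_pos ?_ ?_
  · have ho : IsOpen (HB i0 1) := by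
      refine isOpen_ball.inter ?_
      exact isOpen_lt continuous_const (by fun_prop)
    refine (ho.measure_pos volume ⟨EuclideanSpace.single i0 (1/2), ?_, ?_⟩).ne'
    · simp; norm_num
    · simp
  · exact ((measure_mono inter_subset_left).trans_lt measure_ball_lt_top).ne

lemma fin_alg {p v R X E : ℝ} {C : ℝ} (n : ℕ) (hp1 : 1 ≤ p) (hv : 0 < v) (hR : 0 < R) (hC : 0 ≤ C)
    (hX : 0 ≤ X) (hE : 0 ≤ E) (h : X ≤ C * R ^ n * ((R ^ n)⁻¹ * E) ^ (p / 2)) :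
    (((R / 2) ^ n * v)⁻¹ * X) ^ (1 / p) ≤
      (C * 2 ^ n * v⁻¹ * v ^ (p / 2) + 1) ^ (1 / p) * ((R ^ n * v)⁻¹ * E) ^ ((1 : ℝ) / 2) := by
  have hp0 : 0 < p := by linarith
  have e1 : (R ^ n)⁻¹ * E = v * ((R ^ n * v)⁻¹ * E) := by field_simp
  set a := (R ^ n * v)⁻¹ * E with ha
  have ha0 : 0 ≤ a := by positivity
  have h1 : ((R / 2) ^ n * v)⁻¹ * X ≤ (C * 2 ^ n * v⁻¹ * v ^ (p / 2) + 1) * a ^ (p / 2) := by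
    rw [e1, Real.mul_rpow hv.le ha0] at h
    calc ((R / 2) ^ n * v)⁻¹ * X ≤ ((R / 2) ^ n * v)⁻¹ * (C * R ^ n * (v ^ (p / 2) * a ^ (p / 2))) := by
          gcongr
      _ = (C * 2 ^ n * v⁻¹ * v ^ (p / 2)) * a ^ (p / 2) := by
          rw [div_pow]; field_simp
      _ ≤ _ := by
          have : 0 ≤ a ^ (p / 2) := by positivity
          nlinarith
  have h2 : 0 ≤ C * 2 ^ n * v⁻¹ * v ^ (p / 2) + 1 := by positivity
  calc (((R / 2) ^ n * v)⁻¹ * X) ^ (1 / p)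
      ≤ ((C * 2 ^ n * v⁻¹ * v ^ (p / 2) + 1) * a ^ (p / 2)) ^ (1 / p) :=
        Real.rpow_le_rpow (by positivity) h1 (by positivity)
    _ = _ := by
        rw [Real.mul_rpow h2 (by positivity), ← Real.rpow_mul ha0]
        congr 2
        field_simp

lemma fin_int {i0 : Fin d} {lam R p : ℝ} (hlam : 0 ≤ lam) (hp1 : 1 ≤ p) (hR : 0 < R)
    {u u' : Euc d → ℝ} {g g' : Euc d → Euc d} {C' : ℝ≥0}
    (lu : MemLp u 2 (volume.restrict (HB i0 R))) (lg : MemLp g 2 (volume.restrict (HB i0 R)))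
    (mu : Measurable u') (mg : Measurable g')
    (hu : u =ᵐ[volume.restrict (HB i0 R)] u') (hg : g =ᵐ[volume.restrict (HB i0 R)] g')
    (h : ∀ c, ∫⁻ x in HB i0 (R/2), ‖comp lam u' g' c x‖ₑ ^ p ≤
      C' * ENNReal.ofReal (R ^ d) * (ENNReal.ofReal ((R ^ d)⁻¹) * En i0 lam R u' g') ^ (p / 2)) :
    ∫ x in HB i0 (R/2), (‖g x‖ + Real.sqrt lam * |u x|) ^ p ≤
      (((d + 1 : ℕ) : ℝ) ^ (p - 1) * (d + 1 : ℕ) * C') * R ^ d *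
        ((R ^ d)⁻¹ * ∫ x in HB i0 R, (‖g x‖ + Real.sqrt lam * |u x|) ^ (2 : ℝ)) ^ (p / 2) := by
  have hp0 : 0 < p := by linarith
  set E := ∫ x in HB i0 R, (‖g x‖ + Real.sqrt lam * |u x|) ^ (2 : ℝ) with hE
  have hE0 : 0 ≤ E := integral_nonneg fun x => by positivity
  have hEn : En i0 lam R u' g' ≤ ENNReal.ofReal E := by
    have lU : MemLp (fun x => ‖g x‖ + Real.sqrt lam * |u x|) 2 (volume.restrict (HB i0 R)) :=
      lg.norm.add (lu.norm.const_mul _)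
    have h1 := Q_rpow lU
    have h2 : (∫ x in HB i0 R, ‖‖g x‖ + Real.sqrt lam * |u x|‖ ^ (2:ℝ)) = E := by
      refine integral_congr_ae (Eventually.of_forall fun x => ?_)
      have : 0 ≤ ‖g x‖ + Real.sqrt lam * |u x| := by positivity
      simp only [Real.norm_eq_abs, abs_of_nonneg this]
    rw [h2] at h1
    rw [← h1, Q_ae (g := fun x => ‖g' x‖ + Real.sqrt lam * |u' x|)
      (by filter_upwards [hu, hg] with x h1 h2; rw [h1, h2])]
    unfold En Q
    rw [← lintegral_const_mul' _ _ (by simp), ← lintegral_add_left (by fun_prop)]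
    refine lintegral_mono fun x => ?_
    have h3 : 0 ≤ ‖g' x‖ + Real.sqrt lam * |u' x| := by positivity
    rw [← ofReal_norm, ← ofReal_norm (u' x), ← ofReal_norm (_ + _ : ℝ), ← ENNReal.ofReal_pow (by positivity),
      ← ENNReal.ofReal_pow (by positivity), ← ENNReal.ofReal_pow (by positivity),
      ← ENNReal.ofReal_mul hlam, ← ENNReal.ofReal_add (by positivity) (by positivity)]
    refine ENNReal.ofReal_le_ofReal ?_
    rw [Real.norm_eq_abs (_ + _), abs_of_nonneg h3, Real.norm_eq_abs]
    have h4 := Real.sq_sqrt hlam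
    have h5 : 0 ≤ ‖g' x‖ * (Real.sqrt lam * |u' x|) := by positivity
    nlinarith [congrArg (· * |u' x| ^ 2) h4]
  have hsub : HB i0 (R/2) ⊆ HB i0 R := HB_mono i0 (by linarith)
  have hu2 := ae_restrict_of_ae_restrict_of_subset hsub hu
  have hg2 := ae_restrict_of_ae_restrict_of_subset hsub hg
  have e1 : ∫ x in HB i0 (R/2), (‖g x‖ + Real.sqrt lam * |u x|) ^ p =
      ∫ x in HB i0 (R/2), (‖g' x‖ + Real.sqrt lam * |u' x|) ^ p := by
    refine integral_congr_ae ?_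
    filter_upwards [hu2, hg2] with x h1 h2
    rw [h1, h2]
  rw [e1, integral_eq_lintegral_of_nonneg_ae (Eventually.of_forall fun x => by positivity)
    (by
      have : Measurable fun x => (‖g' x‖ + Real.sqrt lam * |u' x|) ^ p := by
        have : Measurable fun x => |u' x| := mu.norm
        fun_prop
      exact this.aestronglyMeasurable)]
  refine ENNReal.toReal_le_of_le_ofReal (by positivity) ?_
  have h6 : ∀ x, ENNReal.ofReal ((‖g' x‖ + Real.sqrt lam * |u' x|) ^ p) ≤
      ((d + 1 : ℕ) : ℝ≥0∞) ^ (p - 1) * ∑ c, ‖comp lam u' g' c x‖ₑ ^ p := by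
    intro x
    have h7 := ENNReal.rpow_sum_le_const_mul_sum_rpow (Finset.univ : Finset (Option (Fin d)))
      (fun c => ‖comp lam u' g' c x‖ₑ) hp1
    rw [Finset.card_univ, Fintype.card_option, Fintype.card_fin] at h7
    refine le_trans ?_ h7
    rw [← ENNReal.ofReal_rpow_of_nonneg (by positivity) hp0.le]
    refine ENNReal.rpow_le_rpow ?_ hp0.le
    refine (ENNReal.ofReal_le_ofReal (U_le u' g' x)).trans ?_
    rw [ENNReal.ofReal_sum_of_nonneg fun _ _ => norm_nonneg _]
    simp only [ofReal_norm, le_refl]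
  refine (lintegral_mono h6).trans ?_
  rw [lintegral_const_mul' _ _ (ENNReal.rpow_ne_top_of_nonneg (by linarith) (by simp)),
    lintegral_finsetSum _ (fun c _ => ((comp_meas mu mg c).enorm.pow_const p))]
  have h8 : ∑ c, ∫⁻ x in HB i0 (R/2), ‖comp lam u' g' c x‖ₑ ^ p ≤
      ∑ _c : Option (Fin d), ENNReal.ofReal (C' * R ^ d * ((R ^ d)⁻¹ * E) ^ (p / 2)) := by
    refine Finset.sum_le_sum fun c _ => (h c).trans ?_
    rw [ENNReal.ofReal_mul (by positivity), ENNReal.ofReal_mul (by positivity),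
      ENNReal.ofReal_coe_nnreal, ← ENNReal.ofReal_rpow_of_nonneg (by positivity) (by positivity),
      ENNReal.ofReal_mul (by positivity)]
    gcongr
  refine (mul_le_mul_right h8 _).trans ?_
  rw [Finset.sum_const, Finset.card_univ, Fintype.card_option, Fintype.card_fin, nsmul_eq_mul,
    ← ENNReal.ofReal_natCast, ENNReal.ofReal_rpow_of_nonneg (by positivity) (by linarith),
    ← ENNReal.ofReal_mul (by positivity), ← ENNReal.ofReal_mul (by positivity)]
  refine ENNReal.ofReal_le_ofReal (le_of_eq ?_)
  ring

theorem rhMain (d m : ℕ) (hm : m + 2 ≤ d) (M : ℝ) (hM : 0 < M)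
    (p : ℝ) (hp1 : 1 ≤ p) (hp2 : p < 2 * (m + 2) / (m + 1)) :
    ∃ C > (0 : ℝ), ∀ φ : Euc m → ℝ, LipConst M φ → φ 0 = 0 →
      ∀ R > (0 : ℝ), ∀ lam > (0 : ℝ), ∀ u : Euc d → ℝ, ∀ g : Euc d → Euc d,
        MemLp u 2 (volume.restrict (Bplus (by omega : 0 < d) R)) →
        MemLp g 2 (volume.restrict (Bplus (by omega : 0 < d) R)) →
        HasWeakGradOn u g (Bplus (by omega : 0 < d) R) →
        ApproxWD u g (Dhalf hm φ) (Bplus (by omega : 0 < d) R) 2 →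
        (∀ ζ : Euc d → ℝ, IsTest ζ → tsupport ζ ⊆ ball (0 : Euc d) R →
          tsupport ζ ∩ closure (Dhalf hm φ) = ∅ →
          ∫ x in Bplus (by omega : 0 < d) R,
            ((inner ℝ (g x) (gradVec ζ x) : ℝ) + lam * u x * ζ x) = 0) →
        ((volume (Bplus (by omega : 0 < d) (R / 2))).toReal⁻¹ *
            ∫ x in Bplus (by omega : 0 < d) (R / 2),
              (‖g x‖ + Real.sqrt lam * |u x|) ^ p) ^ (1 / p)
          ≤ C * ((volume (Bplus (by omega : 0 < d) R)).toReal⁻¹ *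
            ∫ x in Bplus (by omega : 0 < d) R,
              (‖g x‖ + Real.sqrt lam * |u x|) ^ (2 : ℝ)) ^ ((1 : ℝ) / 2) := by
  obtain ⟨k, rfl⟩ : ∃ k, d = m + 2 + k := ⟨d - (m + 2), by omega⟩
  let J : List (Fin (m + 2 + k)) := List.ofFn (fun i : Fin k => Fin.natAdd (m + 2) i)
  have hJm : ∀ j ∈ J, m + 2 ≤ j.1 := by
    intro j hj
    simp only [J, List.mem_ofFn] at hj
    obtain ⟨i, rfl⟩ := hj
    simp
  have hJn : J.Nodup := by
    simp only [J, List.nodup_ofFn]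
    intro a b hab
    simpa using hab
  obtain ⟨C', hC'⟩ := RR (i0 := (⟨0, by omega⟩ : Fin (m + 2 + k))) (i1 := ⟨1, by omega⟩) (by simp)
    hJn (fun h => by have := hJm _ h; simp at this) (fun h => by have := hJm _ h; simp at this)
    (N := m + 1) (by omega) (by simp only [J, List.length_ofFn]; omega) hp1
    (by
      rw [lt_div_iff₀ (by positivity)] at hp2
      push_cast
      linarith) (K := M + 1) (by linarith)
  set v := (volume (HB (⟨0, by omega⟩ : Fin (m + 2 + k)) 1)).toReal with hv
  have hv0 : 0 < v := vol_HB_pos _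
  set C := (((m + 2 + k + 1 : ℕ) : ℝ) ^ (p - 1) * (m + 2 + k + 1 : ℕ) * C') with hC
  have hC0 : 0 ≤ C := by positivity
  refine ⟨(C * 2 ^ (m + 2 + k) * v⁻¹ * v ^ (p / 2) + 1) ^ (1 / p), by positivity, ?_⟩
  intro φ hφ _ R hR lam hlam u g lu lg _ ap eq
  obtain ⟨u', g', hs, hu, hg⟩ := mkSol (i0 := (⟨0, by omega⟩ : Fin (m + 2 + k))) lu lg ap eq
  have h1 := hC' (Dhalf hm φ) (mkDom hm hM hφ hJm) lam R u' g' hlam.le hR hs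
  have h2 := fin_int hlam.le hp1 hR lu lg hs.mu hs.mg hu hg h1
  have h3 := fin_alg (m + 2 + k) hp1 hv0 hR hC0 (integral_nonneg fun x => by positivity)
    (integral_nonneg fun x => by positivity) h2
  rw [hv, ← vol_HB (by positivity), ← vol_HB hR] at h3
  exact h3

end fin1
end RH
end

/-- Reverse Hölder inequality on the half space (Theorem 3.1): if `u` is a `W^{1,2}`
weak solution of `−Δu + λu = 0` in `B_R^+` with `∂u/∂x^1 = 0` on `N ∩ B_R` and
`u = 0` on `D ∩ B_R`, where the interface is the `M`-Lipschitz graph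
`{x^1 = 0, x^2 = φ(x^3,…,x^{m+2})}`, then for every `p < 2(m+2)/(m+1)`,
`(U^p)^{1/p}_{B_{R/2}^+} ≤ C (U²)^{1/2}_{B_R^+}` with `C = C(d,p,M)`,
where `U = |∇u| + √λ |u|`. -/
theorem reverse_holder_half_space (d m : ℕ) (hm : m + 2 ≤ d) (M : ℝ) (hM : 0 < M)
    (p : ℝ) (hp1 : 1 ≤ p) (hp2 : p < 2 * (m + 2) / (m + 1)) :
    ∃ C > (0 : ℝ), ∀ φ : Euc m → ℝ, LipConst M φ → φ 0 = 0 →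
      ∀ R > (0 : ℝ), ∀ lam > (0 : ℝ), ∀ u : Euc d → ℝ, ∀ g : Euc d → Euc d,
        MemLp u 2 (volume.restrict (Bplus (by omega : 0 < d) R)) →
        MemLp g 2 (volume.restrict (Bplus (by omega : 0 < d) R)) →
        HasWeakGradOn u g (Bplus (by omega : 0 < d) R) →
        ApproxWD u g (Dhalf hm φ) (Bplus (by omega : 0 < d) R) 2 →
        (∀ ζ : Euc d → ℝ, IsTest ζ → tsupport ζ ⊆ ball (0 : Euc d) R →
          tsupport ζ ∩ closure (Dhalf hm φ) = ∅ →
          ∫ x in Bplus (by omega : 0 < d) R,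
            ((inner ℝ (g x) (gradVec ζ x) : ℝ) + lam * u x * ζ x) = 0) →
        ((volume (Bplus (by omega : 0 < d) (R / 2))).toReal⁻¹ *
            ∫ x in Bplus (by omega : 0 < d) (R / 2),
              (‖g x‖ + Real.sqrt lam * |u x|) ^ p) ^ (1 / p)
          ≤ C * ((volume (Bplus (by omega : 0 < d) R)).toReal⁻¹ *
            ∫ x in Bplus (by omega : 0 < d) R,
              (‖g x‖ + Real.sqrt lam * |u x|) ^ (2 : ℝ)) ^ ((1 : ℝ) / 2) := by
  exact RH.rhMain d m hm M hM p hp1 hp2
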